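/- arXiv:1609.05005 — 2 statements merged into one kernel-verified Lean document; each statement's English description precedes it below -/
import Mathlib

section
/- For every natural number n, the sum over all triples (Γ₁,Γ₂,Γ₃) ⊢ [n,n+1,n+2] of q^{pos_{1+}(Γ₁,Γ₂,Γ₃)} equals (1+q)·f_n(q) as polynomials in q. Equivalently, ∑_{n≥0} ( ∑_{(Γ₁,Γ₂,Γ₃)⊢[n,n+1,n+2]} q^{pos_{1+}(Γ₁,Γ₂,Γ₃)} ) z^n = (q+1)/((1−zq)(1−z²q²)) · ∏_{k≥1} 1/(1−z^k q^{k−1}); this is the generating function of the Poincaré polynomials of the punctual flag Hilbert schemes Hilb^{n,n+1,n+2}(0). -/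
/-!
Statement 0: the sum over all triples (Γ₁,Γ₂,Γ₃) ⊢ [n,n+1,n+2] of q^{pos_{1+}(Γ₁,Γ₂,Γ₃)}
equals (1+q)·f_n(q), where f_n(q) = Σ_{a+2b+|ν| = n} q^{n−ℓ(ν)}.
-/

open Polynomial

/-- The hook difference of a box `c` with respect to a finite set `s` of boxes:
the number of boxes of `s` strictly to the right of `c` in its row minus the number of
boxes of `s` strictly above `c` in its column. -/
def hookDiff (s : Finset (ℕ × ℕ)) (c : ℕ × ℕ) : ℤ :=
  ((s.filter fun d => d.2 = c.2 ∧ c.1 < d.1).card : ℤ)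
    - ((s.filter fun d => d.1 = c.1 ∧ c.2 < d.2).card : ℤ)

/-- `pos_{1+}` of a triple of nested Young diagrams, given the cells `s₁` of `Γ₁`,
the cells `s₂` of `Γ₂`, the box `b₁` of `Γ₂ ∖ Γ₁` and the box `b₂` of `Γ₃ ∖ Γ₂`. -/
def posOne (s₁ s₂ : Finset (ℕ × ℕ)) (b₁ b₂ : ℕ × ℕ) : ℕ :=
  (s₁.filter fun c => hookDiff s₁ c ≠ 0 ∧ hookDiff s₁ c ≠ 1).card
    + (s₁.filter fun c =>
        (hookDiff s₁ c = 0 ∧ c.1 = b₁.1) ∨ (hookDiff s₁ c = 1 ∧ c.2 = b₁.2)).card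
    + (s₂.filter fun c =>
        (hookDiff s₂ c = 0 ∧ c.1 = b₂.1) ∨ (hookDiff s₂ c = 1 ∧ c.2 = b₂.2)).card
    + (if b₁.1 + b₁.2 + 2 < b₂.1 + b₂.2
          ∨ (b₂.1 + b₂.2 = b₁.1 + b₁.2 + 2 ∧ b₁.2 < b₂.2) then 1 else 0)

/-- A triple of nested Young diagrams `(Γ₁,Γ₂,Γ₃) ⊢ [n,n+1,n+2]`, recorded together with
the (uniquely determined) added boxes `b₁ ∈ Γ₂ ∖ Γ₁` and `b₂ ∈ Γ₃ ∖ Γ₂`. -/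
structure TripleFlag (n : ℕ) where
  Γ₁ : YoungDiagram
  Γ₂ : YoungDiagram
  Γ₃ : YoungDiagram
  b₁ : ℕ × ℕ
  b₂ : ℕ × ℕ
  card₁ : Γ₁.card = n
  not_mem₁ : b₁ ∉ Γ₁
  cells₂ : Γ₂.cells = insert b₁ Γ₁.cells
  not_mem₂ : b₂ ∉ Γ₂
  cells₃ : Γ₃.cells = insert b₂ Γ₂.cells

/-- `f_n(q) = Σ q^{n−ℓ(ν)}`, summed over all triples `(a,b,ν)` with `a + 2b + |ν| = n`;
this is the coefficient of `z^n` in `(1/((1−zq)(1−z²q²)))·∏_{k≥1} 1/(1−z^k q^{k−1})`. -/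
noncomputable def fPoly (n : ℕ) : Polynomial ℤ :=
  ∑ p ∈ ((Finset.range (n + 1)) ×ˢ (Finset.range (n + 1))).filter
      (fun p => p.1 + 2 * p.2 ≤ n),
    ∑ ν : Nat.Partition (n - p.1 - 2 * p.2), (X : Polynomial ℤ) ^ (n - ν.parts.card)

namespace LW

/-- All words of length `n` in two letters (`true` = east step, `false` = south step). -/
def words : ℕ → Finset (List Bool)
  | 0 => {[]}
  | n + 1 => (words n).image (List.cons true) ∪ (words n).image (List.cons false)

lemma mem_words {n : ℕ} {L : List Bool} : L ∈ words n ↔ L.length = n := by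
  induction n generalizing L with
  | zero => simp [words]
  | succ n ih =>
    simp only [words, Finset.mem_union, Finset.mem_image, ih]
    constructor
    · rintro (⟨a, h, rfl⟩ | ⟨a, h, rfl⟩) <;> simp [h]
    · intro h
      match L, h with
      | true :: L, h => left; exact ⟨L, by simpa using h, rfl⟩
      | false :: L, h => right; exact ⟨L, by simpa using h, rfl⟩

lemma sum_words_succ {M : Type*} [AddCommMonoid M] (n : ℕ) (f : List Bool → M) :
    ∑ L ∈ words (n + 1), f L = ∑ L ∈ words n, f (true :: L) + ∑ L ∈ words n, f (false :: L) := by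
  rw [words, Finset.sum_union, Finset.sum_image, Finset.sum_image]
  · intro a _ b _ h; simpa using h
  · intro a _ b _ h; simpa using h
  · rw [Finset.disjoint_left]
    intro a ha hb
    simp only [Finset.mem_image] at ha hb
    obtain ⟨x, _, rfl⟩ := ha
    obtain ⟨y, _, h⟩ := hb
    simp at h

/-- Sum of `P a l` over the south steps of a word, `a` and `l` being the numbers of east and
south steps before it. -/
def fst : (ℕ → ℕ → ℕ) → List Bool → ℕ
  | _, [] => 0
  | P, true :: L => fst (fun a l => P (a + 1) l) L
  | P, false :: L => P 0 0 + fst (fun a l => P a (l + 1)) L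

/-- Sum of `P a l` over the pairs (east step, later south step), `a` and `l` being the numbers of
east and south steps strictly between. -/
def stW (P : ℕ → ℕ → ℕ) : List Bool → ℕ
  | [] => 0
  | true :: L => fst P L + stW P L
  | false :: L => stW P L

/-- Sum of `P a l` over the east steps of a word, `a` and `l` being the numbers of east and
south steps after it. -/
def lst (P : ℕ → ℕ → ℕ) : List Bool → ℕ
  | [] => 0
  | true :: L => P (L.count true) (L.count false) + lst P L
  | false :: L => lst P L

/-- Reversed path with the two kinds of steps exchanged. -/
def tr (L : List Bool) : List Bool := (L.map not).reverse

@[simp] lemma tr_nil : tr [] = [] := rfl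
@[simp] lemma tr_cons (b : Bool) (L : List Bool) : tr (b :: L) = tr L ++ [!b] := by simp [tr]
@[simp] lemma tr_tr (L : List Bool) : tr (tr L) = L := by
  simp [tr, List.map_reverse, Function.comp_def]
@[simp] lemma tr_length (L : List Bool) : (tr L).length = L.length := by simp [tr]

lemma count_tr (L : List Bool) :
    (tr L).count true = L.count false ∧ (tr L).count false = L.count true := by
  induction L with
  | nil => simp
  | cons b L ih => cases b <;> simp [ih.1, ih.2]

lemma fst_append_false (P : ℕ → ℕ → ℕ) (L : List Bool) :
    fst P (L ++ [false]) = fst P L + P (L.count true) (L.count false) := by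
  induction L generalizing P with
  | nil => simp [fst]
  | cons b L ih => cases b <;> simp [fst, ih, add_assoc]

lemma fst_append_true (P : ℕ → ℕ → ℕ) (L : List Bool) :
    fst P (L ++ [true]) = fst P L := by
  induction L generalizing P with
  | nil => simp [fst]
  | cons b L ih => cases b <;> simp [fst, ih]

lemma stW_append_false (P : ℕ → ℕ → ℕ) (L : List Bool) :
    stW P (L ++ [false]) = stW P L + lst P L := by
  induction L with
  | nil => simp [stW, lst]
  | cons b L ih =>
    cases b
    · simp [stW, lst, ih]
    · simp [stW, lst, ih, fst_append_false]; omega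

lemma stW_append_true (P : ℕ → ℕ → ℕ) (L : List Bool) :
    stW P (L ++ [true]) = stW P L := by
  induction L with
  | nil => simp [stW, fst]
  | cons b L ih =>
    cases b
    · simp [stW, ih]
    · simp [stW, ih, fst_append_true]

lemma lst_append_true (P : ℕ → ℕ → ℕ) (L : List Bool) :
    lst P (L ++ [true]) = P 0 0 + lst (fun a l => P (a + 1) l) L := by
  induction L with
  | nil => simp [lst]
  | cons b L ih => cases b <;> simp [lst, ih]; omega

lemma lst_append_false (P : ℕ → ℕ → ℕ) (L : List Bool) :
    lst P (L ++ [false]) = lst (fun a l => P a (l + 1)) L := by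
  induction L with
  | nil => simp [lst]
  | cons b L ih => cases b <;> simp [lst, ih]

lemma lst_tr (P : ℕ → ℕ → ℕ) (L : List Bool) :
    lst P (tr L) = fst (fun a l => P l a) L := by
  induction L generalizing P with
  | nil => simp [lst, fst]
  | cons b L ih => cases b <;> simp [fst, lst_append_true, lst_append_false, ih]

lemma stW_tr (P : ℕ → ℕ → ℕ) (L : List Bool) :
    stW P (tr L) = stW (fun a l => P l a) L := by
  induction L with
  | nil => simp [stW]
  | cons b L ih =>
    cases b
    · simp [stW, stW_append_true, ih]
    · simp [stW, stW_append_false, ih, lst_tr, add_comm]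

lemma fst_congr {P Q : ℕ → ℕ → ℕ} (h : ∀ a l, P a l = Q a l) (L : List Bool) :
    fst P L = fst Q L := by
  have : P = Q := by funext a l; exact h a l
  rw [this]

lemma stW_congr {P Q : ℕ → ℕ → ℕ} (h : ∀ a l, P a l = Q a l) (L : List Bool) :
    stW P L = stW Q L := by
  have : P = Q := by funext a l; exact h a l
  rw [this]

lemma fst_add (P Q : ℕ → ℕ → ℕ) (L : List Bool) :
    fst (fun a l => P a l + Q a l) L = fst P L + fst Q L := by
  induction L generalizing P Q with
  | nil => simp [fst]
  | cons b L ih =>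
    cases b
    · simp only [fst, ih (fun a l => P a (l + 1)) (fun a l => Q a (l + 1))]; omega
    · simp only [fst, ih (fun a l => P (a + 1) l) (fun a l => Q (a + 1) l)]

lemma stW_add (P Q : ℕ → ℕ → ℕ) (L : List Bool) :
    stW (fun a l => P a l + Q a l) L = stW P L + stW Q L := by
  induction L with
  | nil => simp [stW]
  | cons b L ih =>
    cases b
    · simp only [stW, ih]
    · simp only [stW, ih, fst_add]; omega

/-- starting levels of the east steps -/
def eE (r s : ℤ) : ℤ → List Bool → Multiset ℤ
  | _, [] => 0
  | v, true :: L => v ::ₘ eE r s (v + r) L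
  | v, false :: L => eE r s (v - s) L

/-- starting levels of the south steps -/
def eS (r s : ℤ) : ℤ → List Bool → Multiset ℤ
  | _, [] => 0
  | v, true :: L => eS r s (v + r) L
  | v, false :: L => v ::ₘ eS r s (v - s) L

/-- final level -/
def endp (r s : ℤ) (v : ℤ) (L : List Bool) : ℤ := v + r * L.count true - s * L.count false

lemma card_eE (r s v : ℤ) (L : List Bool) : (eE r s v L).card = L.count true := by
  induction L generalizing v with
  | nil => simp [eE]
  | cons b L ih => cases b <;> simp [eE, ih]

lemma card_eS (r s v : ℤ) (L : List Bool) : (eS r s v L).card = L.count false := by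
  induction L generalizing v with
  | nil => simp [eS]
  | cons b L ih => cases b <;> simp [eS, ih]

lemma eE_append (r s v : ℤ) (L M : List Bool) :
    eE r s v (L ++ M) = eE r s v L + eE r s (endp r s v L) M := by
  induction L generalizing v with
  | nil => simp [eE, endp]
  | cons b L ih =>
    cases b
    · simp only [List.cons_append, eE, ih]; congr 2; simp [endp]; ring
    · simp only [List.cons_append, eE, ih, Multiset.cons_add]; congr 3; simp [endp]; ring

lemma eS_append (r s v : ℤ) (L M : List Bool) :
    eS r s v (L ++ M) = eS r s v L + eS r s (endp r s v L) M := by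
  induction L generalizing v with
  | nil => simp [eS, endp]
  | cons b L ih =>
    cases b
    · simp only [List.cons_append, eS, ih, Multiset.cons_add]; congr 3; simp [endp]; ring
    · simp only [List.cons_append, eS, ih]; congr 2; simp [endp]; ring

lemma endp_tr (r s v : ℤ) (L : List Bool) : endp s r (endp r s v L) (tr L) = v := by
  simp [endp, count_tr]

lemma eE_tr (r s v : ℤ) (L : List Bool) :
    eE s r (endp r s v L) (tr L) = (eS r s v L).map (fun k => k - s) := by
  induction L generalizing v with
  | nil => simp [eE, eS]
  | cons b L ih =>
    cases b
    · have h1 : endp r s v (false :: L) = endp r s (v - s) L := by simp [endp]; ring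
      simp only [tr_cons, eE_append, h1, ih, endp_tr, eS, eE, Bool.not_false]
      simp [add_comm]
    · have h1 : endp r s v (true :: L) = endp r s (v + r) L := by simp [endp]; ring
      simp only [tr_cons, eE_append, h1, ih, endp_tr, eS, eE, Bool.not_true]
      simp

lemma eS_tr (r s v : ℤ) (L : List Bool) :
    eS s r (endp r s v L) (tr L) = (eE r s v L).map (fun k => k + r) := by
  induction L generalizing v with
  | nil => simp [eE, eS]
  | cons b L ih =>
    cases b
    · have h1 : endp r s v (false :: L) = endp r s (v - s) L := by simp [endp]; ring
      simp only [tr_cons, eS_append, h1, ih, endp_tr, eS, eE, Bool.not_false]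
      simp
    · have h1 : endp r s v (true :: L) = endp r s (v + r) L := by simp [endp]; ring
      simp only [tr_cons, eS_append, h1, ih, endp_tr, eS, eE, Bool.not_true]
      simp only [Multiset.cons_zero, Multiset.map_cons]
      rw [add_comm (Multiset.map _ _), Multiset.singleton_add]

lemma fst_level (r s u : ℤ) (f : ℤ → ℕ) (L : List Bool) :
    fst (fun a l => f (u + r * a - s * l)) L = ((eS r s u L).map f).sum := by
  induction L generalizing u with
  | nil => simp [fst, eS]
  | cons b L ih =>
    cases b
    · simp only [fst, eS, Multiset.map_cons, Multiset.sum_cons, ← ih]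
      congr 1
      · simp
      · apply fst_congr; intro a l; congr 1; push_cast; ring
    · simp only [fst, eS, ← ih]
      apply fst_congr; intro a l; congr 1; push_cast; ring

end LW

namespace LW

/-! ### area and core are determined by the multiset of east steps -/

lemma fst_one (L : List Bool) : fst (fun _ _ => 1) L = L.count false := by
  induction L with
  | nil => simp [fst]
  | cons b L ih => cases b <;> simp [fst, ih]; omega

lemma sum_eE (r s v : ℤ) (L : List Bool) :
    2 * (eE r s v L).sum = 2 * L.count true * v + r * L.count true * (L.count true - 1)
      - 2 * s * (L.count true * L.count false - stW (fun _ _ => 1) L) := by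
  induction L generalizing v with
  | nil => simp [eE, stW]
  | cons b L ih =>
    cases b
    · simp only [eE, ih, stW]; simp; ring
    · simp only [eE, stW, Multiset.sum_cons, mul_add, ih, fst_one]; simp; ring

/-- auxiliary function on naturals -/
def Qn (r s : ℕ) (m : ℕ) : ℤ :=
  if h : 0 < m ∧ 0 < r ∧ 0 < s then
    (if m < r + s then 1 else 0) + Qn r s (m - r) + Qn r s (m - s) - Qn r s (m - r - s)
  else 0
termination_by m
decreasing_by all_goals omega

lemma Qn_zero (r s : ℕ) : Qn r s 0 = 0 := by rw [Qn]; simp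

/-- auxiliary function on integers -/
def Qz (r s : ℕ) (m : ℤ) : ℤ := Qn r s m.toNat

lemma Qz_eq (r s : ℕ) (hr : 0 < r) (hs : 0 < s) (m : ℤ) :
    Qz r s m = Qz r s (m - r) + Qz r s (m - s) - Qz r s (m - r - s)
      + (if 0 < m ∧ m < r + s then 1 else 0) := by
  unfold Qz
  have h1 : (m - r).toNat = m.toNat - r := by omega
  have h2 : (m - s).toNat = m.toNat - s := by omega
  have h3 : (m - r - s).toNat = m.toNat - r - s := by omega
  rw [h1, h2, h3]
  rcases le_or_gt m 0 with h | h
  · have h4 : m.toNat = 0 := by omega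
    rw [h4]; simp [Qn_zero]; omega
  · rw [Qn]
    have h5 : (0 < m.toNat ∧ 0 < r ∧ 0 < s) := by omega
    have h6 : (m.toNat < r + s) ↔ (0 < m ∧ m < r + s) := by omega
    simp only [h5, h6]
    simp
    ring

/-- symmetrised version -/
def sg (r s : ℕ) (m : ℤ) : ℤ := Qz r s m + Qz r s (-m)

lemma sg_neg (r s : ℕ) (m : ℤ) : sg r s (-m) = sg r s m := by simp [sg, add_comm]

lemma sg_eq (r s : ℕ) (hr : 0 < r) (hs : 0 < s) (m : ℤ) :
    sg r s m - sg r s (m - r) - sg r s (m - s) + sg r s (m - s - r)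
      = 2 * (if 0 < m ∧ m < r + s then 1 else 0) := by
  have h1 := Qz_eq r s hr hs m
  have h2 := Qz_eq r s hr hs (r + s - m)
  have e1 : (r : ℤ) + s - m - r = -(m - s) := by ring
  have e2 : (r : ℤ) + s - m - s = -(m - r) := by ring
  have e3 : -(m - s) - (s:ℤ) = -m := by ring
  have e4 : (r : ℤ) + s - m = -(m - s - r) := by ring
  have e5 : m - s - r = m - r - (s : ℤ) := by ring
  have e6 : (0 < (r : ℤ) + s - m ∧ (r : ℤ) + s - m < r + s) ↔ (0 < m ∧ m < r + s) := by omega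
  simp only [e6] at h2
  rw [e1, e2, e3, e4, e5] at h2
  simp only [sg]
  rw [e5]
  linarith

/-- potential -/
def ph (r s : ℕ) (m : ℤ) : ℤ := sg r s m - sg r s (m - r)

/-- pair interaction -/
def kp (r s : ℕ) (m : ℤ) : ℤ := 2 * sg r s m - sg r s (m - r) - sg r s (m + r)

lemma kp_neg (r s : ℕ) (m : ℤ) : kp r s (-m) = kp r s m := by
  have h1 := sg_neg r s m
  have h2 := sg_neg r s (m - r)
  have h3 := sg_neg r s (m + r)
  have e1 : -m - r = -(m + r) := by ring
  have e2 : -m + r = -(m - r) := by ring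
  simp only [kp, e1, e2]
  rw [h1, h2, h3]; ring

/-- core indicator -/
def Pcore (r s : ℕ) (a l : ℕ) : ℕ :=
  if - (r : ℤ) < r * a - s * l ∧ (r : ℤ) * a - s * l < s then 1 else 0
/-- exit indicator -/
def Pexit (r s : ℕ) (a l : ℕ) : ℕ := if (r : ℤ) * a - s * l = - r then 1 else 0
/-- arrival indicator -/
def Parr (r s : ℕ) (a l : ℕ) : ℕ := if (r : ℤ) * a - s * l = s then 1 else 0

lemma eS_potential (r s : ℕ) (hr : 0 < r) (hs : 0 < s) (v u : ℤ) (L : List Bool) :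
    2 * (((eS r s u L).map (fun k => if 0 < k - v ∧ k - v < r + s then 1 else 0)).sum : ℕ)
      = ph r s (u - v) - ph r s (endp r s u L - v)
        - ((eE r s u L).map (fun k => kp r s (k - v))).sum := by
  induction L generalizing u with
  | nil => simp [eS, eE, endp]
  | cons b L ih =>
    cases b
    · have h1 : endp r s u (false :: L) = endp r s (u - s) L := by simp [endp]; ring
      have h2 := sg_eq r s hr hs (u - v)
      have h3 := ih (u - s)
      simp only [eS, eE, Multiset.map_cons, Multiset.sum_cons, h1]
      push_cast at h3 ⊢
      have e1 : u - v - s = u - s - v := by ring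
      have e2 : ph r s (u - v) - ph r s (u - s - v) = 2 * (if 0 < u - v ∧ u - v < r + s then 1 else 0) := by
        rw [← h2]; simp only [ph]; rw [e1]; ring
      linarith
    · have h1 : endp r s u (true :: L) = endp r s (u + r) L := by simp [endp]; ring
      have h3 := ih (u + r)
      simp only [eS, eE, Multiset.map_cons, Multiset.sum_cons, h1]
      have e2 : ph r s (u - v) - ph r s (u + r - v) = kp r s (u - v) := by
        simp only [ph, kp]
        have e3 : u + r - v = u - v + r := by ring
        rw [e3]; simp; ring
      linarith

lemma fst_core (r s : ℕ) (hr : 0 < r) (hs : 0 < s) (v : ℤ) (L : List Bool) :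
    2 * (fst (Pcore r s) L : ℤ)
      = ph r s r - ph r s (endp r s (v + r) L - v)
        - ((eE r s (v + r) L).map (fun k => kp r s (k - v))).sum := by
  have h := eS_potential r s hr hs v (v + r) L
  rw [← fst_level] at h
  have e : v + r - v = (r : ℤ) := by ring
  rw [e] at h
  rw [← h]
  congr 2
  apply fst_congr
  intro a l
  unfold Pcore
  apply if_congr _ rfl rfl
  constructor
  · rintro ⟨h1, h2⟩; constructor <;> linarith
  · rintro ⟨h1, h2⟩; constructor <;> linarith

lemma stW_core (r s : ℕ) (hr : 0 < r) (hs : 0 < s) (v : ℤ) (L : List Bool) :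
    4 * (stW (Pcore r s) L : ℤ)
      = 2 * ((eE r s v L).map (fun k => ph r s r - ph r s (endp r s v L - k))).sum
        - ((eE r s v L).map (fun k => ((eE r s v L).map (fun k' => kp r s (k' - k))).sum)).sum
        + L.count true * kp r s 0 := by
  induction L generalizing v with
  | nil => simp [stW, eE]
  | cons b L ih =>
    cases b
    · have h1 : endp r s v (false :: L) = endp r s (v - s) L := by simp [endp]; ring
      simp only [stW, eE, h1]; rw [ih (v - s)]; simp only [ne_eq, Bool.false_eq_true, not_false_eq_true, List.count_cons_of_ne]
    · have h1 : endp r s v (true :: L) = endp r s (v + r) L := by simp [endp]; ring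
      have h2 := fst_core r s hr hs v L
      have h3 := ih (v + r)
      simp only [stW, eE, h1, Multiset.map_cons, Multiset.sum_cons, Multiset.sum_map_add]
      have h4 : (fun k : ℤ => kp r s (v - k)) = (fun k : ℤ => kp r s (k - v)) := by
        funext k; rw [← kp_neg]; congr 1; ring
      rw [h4]
      simp only [List.count_cons_self, sub_self]
      push_cast
      linarith

end LW

namespace LW

/-- q-integer -/
noncomputable def qn (m : ℕ) : ℤ[X] := ∑ i ∈ Finset.range m, X ^ i

@[simp] lemma qn_zero : qn 0 = 0 := by simp [qn]
@[simp] lemma qn_one : qn 1 = 1 := by simp [qn]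

lemma qn_add (a b : ℕ) : qn (a + b) = qn a + X ^ a * qn b := by
  simp [qn, Finset.sum_range_add, Finset.mul_sum, pow_add]

lemma qn_ne (m : ℕ) (h : 0 < m) : qn m ≠ 0 := by
  intro h0
  have := congrArg (eval 1) h0
  simp [qn, eval_finsetSum] at this
  omega

/-- q-factorial -/
noncomputable def qf (m : ℕ) : ℤ[X] := ∏ i ∈ Finset.range m, qn (i + 1)

@[simp] lemma qf_zero : qf 0 = 1 := by simp [qf]
lemma qf_succ (m : ℕ) : qf (m + 1) = qf m * qn (m + 1) := by simp [qf, Finset.prod_range_succ]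
lemma qf_pred (m : ℕ) (h : 0 < m) : qf m = qf (m - 1) * qn m := by
  obtain ⟨k, rfl⟩ : ∃ k, m = k + 1 := ⟨m - 1, by omega⟩
  simp [qf_succ]
lemma qf_ne (m : ℕ) : qf m ≠ 0 := by
  rw [qf, Finset.prod_ne_zero_iff]
  intro i _; exact qn_ne _ (by omega)

/-- exit exponent of a path started at level `v` -/
def ex (r s : ℤ) : ℤ → List Bool → ℕ
  | _, [] => 0
  | v, true :: L => (eS r s (v + r) L).count v + ex r s (v + r) L
  | v, false :: L => ex r s (v - s) L

/-- partition function of the paths with prescribed edges -/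
noncomputable def Z (r s : ℤ) (N : ℕ) (v : ℤ) (E S : Multiset ℤ) : ℤ[X] :=
  ∑ L ∈ words N, if eE r s v L = E ∧ eS r s v L = S then X ^ ex r s v L else 0

lemma Z_zero (r s v : ℤ) : Z r s 0 v 0 0 = 1 := by simp [Z, words, eE, eS, ex]

lemma cons_eq_iff (a : ℤ) (M E : Multiset ℤ) : a ::ₘ M = E ↔ a ∈ E ∧ M = E.erase a := by
  constructor
  · rintro rfl; simp
  · rintro ⟨h, rfl⟩; exact Multiset.cons_erase h

lemma Z_succ (r s : ℤ) (N : ℕ) (v : ℤ) (E S : Multiset ℤ) :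
    Z r s (N + 1) v E S
      = (if v ∈ E then X ^ (S.count v) * Z r s N (v + r) (E.erase v) S else 0)
        + (if v ∈ S then Z r s N (v - s) E (S.erase v) else 0) := by
  rw [Z, sum_words_succ]
  congr 1
  · simp only [eE, eS, ex, cons_eq_iff]
    split_ifs with h
    · rw [Z, Finset.mul_sum]
      apply Finset.sum_congr rfl
      intro L _
      simp only [h, true_and]
      split_ifs with h1
      · rw [h1.2, pow_add]
      · simp
    · simp [h]
  · simp only [eE, eS, ex, cons_eq_iff]
    split_ifs with h
    · rw [Z]
      apply Finset.sum_congr rfl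
      intro L _
      simp only [h, true_and]
    · simp [h]

/-- matrix row -/
noncomputable def row (r s : ℤ) (e t : ℕ) (k l : ℤ) : ℤ[X] :=
  if e + t = 0 then (if l = k then 1 else 0) else
    (if l = k then qn (e + t) else 0) - (if l = k + r then qn e else 0)
      - (if l = k - s then X ^ e * qn t else 0)

/-- the q-Laplacian -/
noncomputable def lap (r s : ℤ) (V : Finset ℤ) (E S : Multiset ℤ) : Matrix V V ℤ[X] :=
  Matrix.of fun k l => row r s (E.count k.1) (S.count k.1) k.1 l.1

/-- flow conservation for paths from `v` to `w` -/
def Bal (r s v w : ℤ) (E S : Multiset ℤ) : Prop :=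
  ∀ k, E.count k + S.count k + (if k = w then 1 else 0)
    = E.count (k - r) + S.count (k + s) + (if k = v then 1 else 0)

lemma Bal.stepE {r s v w : ℤ} {E S : Multiset ℤ} (hr : 0 < r) (h : Bal r s v w E S) (hv : v ∈ E) :
    Bal r s (v + r) w (E.erase v) S := by
  intro k
  have hk := h k
  have h1 : 0 < E.count v := Multiset.count_pos.2 hv
  by_cases h2 : k = v
  · have h3 : k - r ≠ v := by omega
    have h4 : k ≠ v + r := by omega
    simp only [h2, Multiset.count_erase_self] at *
    simp only [Multiset.count_erase_of_ne h3, h4, if_true, if_false] at *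
    omega
  · by_cases h3 : k = v + r
    · subst h3
      have h5 : v + r - r = v := by ring
      rw [h5] at hk ⊢
      simp only [Multiset.count_erase_of_ne h2, Multiset.count_erase_self, h2, if_false, if_true] at *
      omega
    · have h4 : k - r ≠ v := by omega
      simp only [Multiset.count_erase_of_ne h2, Multiset.count_erase_of_ne h4, h2, h3, if_false] at *
      omega

lemma Bal.stepS {r s v w : ℤ} {E S : Multiset ℤ} (hs : 0 < s) (h : Bal r s v w E S) (hv : v ∈ S) :
    Bal r s (v - s) w E (S.erase v) := by
  intro k
  have hk := h k
  have h1 : 0 < S.count v := Multiset.count_pos.2 hv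
  by_cases h2 : k = v
  · have h3 : k + s ≠ v := by omega
    have h4 : k ≠ v - s := by omega
    simp only [h2, Multiset.count_erase_self] at *
    simp only [Multiset.count_erase_of_ne h3, h4, if_true, if_false] at *
    omega
  · by_cases h3 : k = v - s
    · subst h3
      have h5 : v - s + s = v := by ring
      rw [h5] at hk ⊢
      simp only [Multiset.count_erase_of_ne h2, Multiset.count_erase_self, h2, if_false, if_true] at *
      omega
    · have h4 : k + s ≠ v := by omega
      simp only [Multiset.count_erase_of_ne h2, Multiset.count_erase_of_ne h4, h2, h3, if_false] at *
      omega

lemma lap_erase_E (r s : ℤ) (V : Finset ℤ) (E S : Multiset ℤ) (v : V) :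
    lap r s V (E.erase v) S
      = (lap r s V E S).updateRow v (fun l => row r s (E.count v.1 - 1) (S.count v.1) v.1 l.1) := by
  ext1 k l
  by_cases h : k = v
  · subst h; simp [lap]
  · have h' : k.1 ≠ v.1 := fun h' => h (Subtype.ext h')
    simp [lap, Matrix.updateRow_ne h, Multiset.count_erase_of_ne h']

lemma lap_erase_S (r s : ℤ) (V : Finset ℤ) (E S : Multiset ℤ) (v : V) :
    lap r s V E (S.erase v)
      = (lap r s V E S).updateRow v (fun l => row r s (E.count v.1) (S.count v.1 - 1) v.1 l.1) := by
  ext1 k l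
  by_cases h : k = v
  · subst h; simp [lap]
  · have h' : k.1 ≠ v.1 := fun h' => h (Subtype.ext h')
    simp [lap, Matrix.updateRow_ne h, Multiset.count_erase_of_ne h']

lemma lap_erase_E_out (r s : ℤ) (V : Finset ℤ) (E S : Multiset ℤ) (v : ℤ) (hv : v ∉ V) :
    lap r s V (E.erase v) S = lap r s V E S := by
  ext1 k l
  have h' : k.1 ≠ v := fun h' => hv (h' ▸ k.2)
  simp [lap, Multiset.count_erase_of_ne h']

lemma lap_erase_S_out (r s : ℤ) (V : Finset ℤ) (E S : Multiset ℤ) (v : ℤ) (hv : v ∉ V) :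
    lap r s V E (S.erase v) = lap r s V E S := by
  ext1 k l
  have h' : k.1 ≠ v := fun h' => hv (h' ▸ k.2)
  simp [lap, Multiset.count_erase_of_ne h']

lemma row_rec (r s : ℤ) (e t : ℕ) (h : 2 ≤ e + t) (k l : ℤ) :
    qn (e + t - 1) * row r s e t k l
      = X ^ t * qn e * row r s (e - 1) t k l + qn t * row r s e (t - 1) k l := by
  unfold row
  rcases e with _ | e
  · obtain ⟨t, rfl⟩ : ∃ t', t = t' + 2 := ⟨t - 2, by omega⟩
    simp
    split_ifs <;> simp <;> ring
  · rcases t with _ | t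
    · obtain ⟨e, rfl⟩ : ∃ t', e = t' + 1 := ⟨e - 1, by omega⟩
      simp
      split_ifs <;> simp <;> ring
    · have a1 : e + 1 + (t + 1) - 1 = e + t + 1 := by omega
      have a2 : e + 1 - 1 = e := by omega
      have a3 : t + 1 - 1 = t := by omega
      rw [a1, a2, a3]
      have b1 : ¬ (e + 1 + (t + 1) = 0) := by omega
      have b2 : ¬ (e + (t + 1) = 0) := by omega
      have b3 : ¬ (e + 1 + t = 0) := by omega
      simp only [b1, b2, b3, if_false]
      have c1 : qn (e + t + 1) = qn t + X ^ t * qn (e + 1) := by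
        rw [← qn_add]; congr 1; omega
      have c2 : qn (e + 1 + (t + 1)) = qn (t + 1) + X ^ (t + 1) * qn (e + 1) := by
        rw [← qn_add]; congr 1; omega
      have c3 : qn (e + (t + 1)) = qn (e + t + 1) := by congr 1
      have c4 : qn (e + 1 + t) = qn (e + t + 1) := by rw [show e + 1 + t = e + t + 1 by omega]
      have c5 : qn (e + t + 1) = qn (t + 1) + X ^ (t + 1) * qn e := by
        rw [← qn_add]; congr 1; omega
      have d1 : qn (e + t + 1) * qn (e + 1 + (t + 1))
        = X ^ (t + 1) * qn (e + 1) * qn (e + (t + 1)) + qn (t + 1) * qn (e + 1 + t) := by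
        rw [c2, c3, c4]; ring
      have d2 : qn (e + t + 1) * qn (e + 1)
        = X ^ (t + 1) * qn (e + 1) * qn e + qn (t + 1) * qn (e + 1) := by
        rw [c5]; ring
      have d3 : qn (e + t + 1) * (X ^ (e + 1) * qn (t + 1))
        = X ^ (t + 1) * qn (e + 1) * (X ^ e * qn (t + 1)) + qn (t + 1) * (X ^ (e + 1) * qn t) := by
        rw [c1]; ring
      split_ifs
      · linear_combination d1 - d2 - d3
      · linear_combination d1 - d2
      · linear_combination d1 - d3
      · linear_combination d1
      · linear_combination - d2 - d3
      · linear_combination - d2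
      · linear_combination - d3
      · ring
end LW

namespace LW

lemma prod_upd {W : Finset ℤ} {v : ℤ} (hv : v ∈ W) (f g : ℤ → ℤ[X]) (c : ℤ[X])
    (h : ∀ k, k ≠ v → f k = g k) (hc : f v = c * g v) : ∏ k ∈ W, f k = c * ∏ k ∈ W, g k := by
  rw [← Finset.mul_prod_erase W f hv, ← Finset.mul_prod_erase W g hv, hc, mul_assoc]
  congr 2
  apply Finset.prod_congr rfl
  intro k hk
  exact h k (Finset.ne_of_mem_erase hk)

lemma det_col {V : Finset ℤ} (A : Matrix V V ℤ[X]) (v : V) (h : ∀ k, k ≠ v → A k v = 0)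
    (a b : V → ℤ[X]) (hab : a v = b v) : (A.updateRow v a).det = (A.updateRow v b).det := by
  have h1 : a = b + (a - b) := by simp
  rw [h1, Matrix.det_updateRow_add]
  have : (A.updateRow v (a - b)).det = 0 := by
    apply Matrix.det_eq_zero_of_column_eq_zero v
    intro k
    by_cases hk : k = v
    · subst hk; simp [hab]
    · rw [Matrix.updateRow_ne hk]; exact h k hk
  rw [this, add_zero]

/-- factorial weight of the edges -/
noncomputable def wt (W : Finset ℤ) (E S : Multiset ℤ) : ℤ[X] :=
  ∏ k ∈ W, qf (E.count k) * qf (S.count k)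

/-- factorial weight of the vertices -/
noncomputable def vt (V : Finset ℤ) (E S : Multiset ℤ) : ℤ[X] :=
  ∏ k ∈ V, qf (E.count k + S.count k - 1)

lemma wt_E {W : Finset ℤ} {E S : Multiset ℤ} {v : ℤ} (hv : v ∈ W) (hE : v ∈ E) :
    wt W E S = qn (E.count v) * wt W (E.erase v) S := by
  apply prod_upd hv
  · intro k hk; rw [Multiset.count_erase_of_ne hk]
  · rw [qf_pred _ (Multiset.count_pos.2 hE), Multiset.count_erase_self]; ring

lemma wt_S {W : Finset ℤ} {E S : Multiset ℤ} {v : ℤ} (hv : v ∈ W) (hE : v ∈ S) :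
    wt W E S = qn (S.count v) * wt W E (S.erase v) := by
  apply prod_upd hv
  · intro k hk; rw [Multiset.count_erase_of_ne hk]
  · rw [qf_pred (S.count v) (Multiset.count_pos.2 hE), Multiset.count_erase_self]; ring

lemma vt_E_out {V : Finset ℤ} {E S : Multiset ℤ} {v : ℤ} (hv : v ∉ V) :
    vt V (E.erase v) S = vt V E S := by
  apply Finset.prod_congr rfl
  intro k hk
  have : k ≠ v := fun h => hv (h ▸ hk)
  rw [Multiset.count_erase_of_ne this]

lemma vt_S_out {V : Finset ℤ} {E S : Multiset ℤ} {v : ℤ} (hv : v ∉ V) :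
    vt V E (S.erase v) = vt V E S := by
  apply Finset.prod_congr rfl
  intro k hk
  have : k ≠ v := fun h => hv (h ▸ hk)
  rw [Multiset.count_erase_of_ne this]

lemma vt_E {V : Finset ℤ} {E S : Multiset ℤ} {v : ℤ} (hv : v ∈ V) (hE : v ∈ E)
    (h2 : 2 ≤ E.count v + S.count v) :
    vt V E S = qn (E.count v + S.count v - 1) * vt V (E.erase v) S := by
  apply prod_upd hv
  · intro k hk; rw [Multiset.count_erase_of_ne hk]
  · have := Multiset.count_pos.2 hE
    rw [qf_pred _ (by omega), Multiset.count_erase_self, mul_comm]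
    congr 2; omega

lemma vt_S {V : Finset ℤ} {E S : Multiset ℤ} {v : ℤ} (hv : v ∈ V) (hE : v ∈ S)
    (h2 : 2 ≤ E.count v + S.count v) :
    vt V E S = qn (E.count v + S.count v - 1) * vt V E (S.erase v) := by
  apply prod_upd hv
  · intro k hk; rw [Multiset.count_erase_of_ne hk]
  · have := Multiset.count_pos.2 hE
    rw [qf_pred _ (by omega), Multiset.count_erase_self, mul_comm]
    congr 2; omega

lemma vt_E1 {V : Finset ℤ} {E S : Multiset ℤ} {v : ℤ} (hv : v ∈ V)
    (h2 : E.count v + S.count v = 1) :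
    vt V E S = vt V (E.erase v) S := by
  rw [← one_mul (vt V (E.erase v) S)]
  apply prod_upd hv
  · intro k hk; rw [Multiset.count_erase_of_ne hk]
  · rw [Multiset.count_erase_self, h2, one_mul]
    congr 1; omega

lemma vt_S1 {V : Finset ℤ} {E S : Multiset ℤ} {v : ℤ} (hv : v ∈ V)
    (h2 : E.count v + S.count v = 1) :
    vt V E S = vt V E (S.erase v) := by
  rw [← one_mul (vt V E (S.erase v))]
  apply prod_upd hv
  · intro k hk; rw [Multiset.count_erase_of_ne hk]
  · rw [Multiset.count_erase_self, h2, one_mul]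
    congr 1; omega

lemma lap_self (r s : ℤ) (V : Finset ℤ) (E S : Multiset ℤ) (v : V) :
    (lap r s V E S).updateRow v (fun l => row r s (E.count v.1) (S.count v.1) v.1 l.1)
      = lap r s V E S := by
  ext1 k l
  by_cases h : k = v
  · subst h; simp [lap]
  · simp [Matrix.updateRow_ne h]

lemma lap_det_rec (r s : ℤ) (V : Finset ℤ) (E S : Multiset ℤ) (v : V)
    (h : 2 ≤ E.count v.1 + S.count v.1) :
    qn (E.count v.1 + S.count v.1 - 1) * (lap r s V E S).det
      = X ^ (S.count v.1) * qn (E.count v.1) * (lap r s V (E.erase v) S).det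
        + qn (S.count v.1) * (lap r s V E (S.erase v)).det := by
  rw [lap_erase_E, lap_erase_S]
  conv_lhs => rw [← lap_self r s V E S v]
  rw [← Matrix.det_updateRow_smul, ← Matrix.det_updateRow_smul, ← Matrix.det_updateRow_smul,
    ← Matrix.det_updateRow_add]
  congr 2
  funext l
  have := row_rec r s _ _ h v.1 l.1
  simpa using this

lemma lap_kernel (r s w : ℤ) (V : Finset ℤ) (E S : Multiset ℤ) (hw : w ∉ V)
    (hE : ∀ k ∈ E, k ∈ insert w V) (hS : ∀ k ∈ S, k ∈ insert w V)
    (hb : Bal r s w w E S) (hw0 : E.count w + S.count w = 0) (hne : ∃ k, 0 < E.count k + S.count k) :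
    (lap r s V E S).det = 0 := by
  have hb' : ∀ k, E.count k + S.count k = E.count (k - r) + S.count (k + s) := by
    intro k; have := hb k; omega
  have hV : ∀ k, 0 < E.count k + S.count k → k ∈ V := by
    intro k hk
    have h1 : k ∈ insert w V := by
      by_cases h : 0 < E.count k
      · exact hE k (Multiset.count_pos.1 h)
      · exact hS k (Multiset.count_pos.1 (by omega))
    rcases Finset.mem_insert.1 h1 with h | h
    · subst h; omega
    · exact h
  apply Matrix.exists_mulVec_eq_zero_iff.1
  refine ⟨fun k => if 0 < E.count k.1 + S.count k.1 then 1 else 0, ?_, ?_⟩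
  · intro h0
    obtain ⟨k, hk⟩ := hne
    have := congrFun h0 ⟨k, hV k hk⟩
    simp [hk] at this
  · funext k
    simp only [Matrix.mulVec, dotProduct, lap, Matrix.of_apply, Pi.zero_apply]
    rw [Finset.sum_coe_sort V (fun l => row r s (E.count k.1) (S.count k.1) k.1 l *
      (if 0 < E.count l + S.count l then (1 : ℤ[X]) else 0))]
    by_cases h0 : E.count k.1 + S.count k.1 = 0
    · apply Finset.sum_eq_zero
      intro l _
      unfold row
      by_cases hl : l = k.1
      · subst hl; simp [h0]
      · simp [h0, hl]
    · simp only [row, h0, if_false, sub_mul, ite_mul, zero_mul, Finset.sum_sub_distrib,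
        Finset.sum_ite_eq']
      have h1 : (if k.1 + r ∈ V then qn (E.count k.1) * (if 0 < E.count (k.1 + r) + S.count (k.1 + r)
          then (1 : ℤ[X]) else 0) else 0) = qn (E.count k.1) := by
        by_cases he : E.count k.1 = 0
        · simp [he]
        · have h2 := hb' (k.1 + r)
          have h3 : k.1 + r - r = k.1 := by ring
          rw [h3] at h2
          have h4 : 0 < E.count (k.1 + r) + S.count (k.1 + r) := by omega
          rw [if_pos (hV _ h4), if_pos h4, mul_one]
      have h1' : (if k.1 - s ∈ V then X ^ (E.count k.1) * qn (S.count k.1) *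
          (if 0 < E.count (k.1 - s) + S.count (k.1 - s)
          then (1 : ℤ[X]) else 0) else 0) = X ^ (E.count k.1) * qn (S.count k.1) := by
        by_cases he : S.count k.1 = 0
        · simp [he]
        · have h2 := hb' (k.1 - s)
          have h3 : k.1 - s + s = k.1 := by ring
          rw [h3] at h2
          have h4 : 0 < E.count (k.1 - s) + S.count (k.1 - s) := by omega
          rw [if_pos (hV _ h4), if_pos h4, mul_one]
      rw [h1, h1', if_pos k.2, if_pos (by omega), qn_add]
      ring

theorem best (r s : ℤ) (hr : 0 < r) (hs : 0 < s) (w : ℤ) (V : Finset ℤ) (hw : w ∉ V) (N : ℕ) :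
    ∀ (v : ℤ) (E S : Multiset ℤ), (∀ k ∈ E, k ∈ insert w V) → (∀ k ∈ S, k ∈ insert w V) →
      E.card + S.card = N → Bal r s v w E S →
      Z r s N v E S * wt (insert w V) E S
        = qf (E.count w + S.count w) * vt V E S * (lap r s V E S).det := by
  induction N with
  | zero =>
    intro v E S _ _ hc hb
    have hE : E = 0 := Multiset.card_eq_zero.1 (by omega)
    have hS : S = 0 := Multiset.card_eq_zero.1 (by omega)
    subst hE hS
    have h1 : lap r s V 0 0 = 1 := by
      ext1 k l
      by_cases h : k = l
      · subst h; simp [lap, row]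
      · simp [lap, row, h]
        exact fun h2 => h h2.symm
    rw [Z_zero, h1]
    simp [wt, vt]
  | succ N ih =>
    intro v E S hE hS hc hb
    have hv : v ∈ insert w V := by
      have := hb v
      by_cases h1 : v = w
      · simp [h1]
      · simp only [h1, if_false, if_true] at this
        by_cases h : 0 < E.count v
        · exact hE v (Multiset.count_pos.1 h)
        · exact hS v (Multiset.count_pos.1 (by omega))
    -- the two inductive hypotheses
    have ihE : v ∈ E → Z r s N (v + r) (E.erase v) S * wt (insert w V) (E.erase v) S
        = qf ((E.erase v).count w + S.count w) * vt V (E.erase v) S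
          * (lap r s V (E.erase v) S).det := by
      intro h
      have hcc := Multiset.card_erase_add_one h
      exact ih _ _ _ (fun k hk => hE k (Multiset.mem_of_mem_erase hk)) hS (by omega) (hb.stepE hr h)
    have ihS : v ∈ S → Z r s N (v - s) E (S.erase v) * wt (insert w V) E (S.erase v)
        = qf (E.count w + (S.erase v).count w) * vt V E (S.erase v)
          * (lap r s V E (S.erase v)).det := by
      intro h
      have hcc := Multiset.card_erase_add_one h
      exact ih _ _ _ hE (fun k hk => hS k (Multiset.mem_of_mem_erase hk)) (by omega) (hb.stepS hs h)
    have key : Z r s (N + 1) v E S * wt (insert w V) E S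
        = X ^ (S.count v) * qn (E.count v) *
            (if v ∈ E then Z r s N (v + r) (E.erase v) S * wt (insert w V) (E.erase v) S else 0)
          + qn (S.count v) *
            (if v ∈ S then Z r s N (v - s) E (S.erase v) * wt (insert w V) E (S.erase v) else 0) := by
      rw [Z_succ, add_mul]
      congr 1
      · split_ifs with h
        · rw [wt_E hv h]; ring
        · simp
      · split_ifs with h
        · rw [wt_S hv h]; ring
        · simp
    rw [key]
    by_cases hvw : v = w
    · subst hvw
      by_cases h0 : E.count v + S.count v = 0
      · have h1 : v ∉ E := fun h => by have := Multiset.count_pos.2 h; omega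
        have h2 : v ∉ S := fun h => by have := Multiset.count_pos.2 h; omega
        rw [lap_kernel r s v V E S hw hE hS hb h0]
        · simp [h1, h2]
        · by_cases h3 : E = 0
          · have h4 : 0 < S.card := by subst h3; simp at hc; omega
            obtain ⟨k, hk⟩ := Multiset.card_pos_iff_exists_mem.1 h4
            have := Multiset.count_pos.2 hk
            exact ⟨k, by omega⟩
          · obtain ⟨k, hk⟩ := Multiset.exists_mem_of_ne_zero h3
            have := Multiset.count_pos.2 hk
            exact ⟨k, by omega⟩
      · have e1 : X ^ (S.count v) * qn (E.count v) *
            (if v ∈ E then Z r s N (v + r) (E.erase v) S * wt (insert v V) (E.erase v) S else 0)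
            = X ^ (S.count v) * qn (E.count v) *
              (qf (E.count v + S.count v - 1) * vt V E S * (lap r s V E S).det) := by
          split_ifs with h
          · have := Multiset.count_pos.2 h
            rw [ihE h, vt_E_out hw, lap_erase_E_out _ _ _ _ _ _ hw, Multiset.count_erase_self]
            congr 4; omega
          · rw [Multiset.count_eq_zero_of_notMem h]; simp
        have e2 : qn (S.count v) *
            (if v ∈ S then Z r s N (v - s) E (S.erase v) * wt (insert v V) E (S.erase v) else 0)
            = qn (S.count v) *
              (qf (E.count v + S.count v - 1) * vt V E S * (lap r s V E S).det) := by
          split_ifs with h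
          · have := Multiset.count_pos.2 h
            rw [ihS h, vt_S_out hw, lap_erase_S_out _ _ _ _ _ _ hw, Multiset.count_erase_self]
            congr 4; omega
          · rw [Multiset.count_eq_zero_of_notMem h]; simp
        rw [e1, e2, qf_pred (E.count v + S.count v) (by omega), add_comm (E.count v), qn_add]
        ring
    · have hvV : v ∈ V := by
        rcases Finset.mem_insert.1 hv with h | h
        · exact absurd h hvw
        · exact h
      have hwv : w ≠ v := fun h => hvw h.symm
      have hbv := hb v
      simp only [hvw, if_false, if_true] at hbv
      simp only [Multiset.count_erase_of_ne hwv] at ihE ihS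
      by_cases h2 : 2 ≤ E.count v + S.count v
      · have hd := lap_det_rec r s V E S ⟨v, hvV⟩ h2
        simp only at hd
        have hq : qn (E.count v + S.count v - 1) ≠ 0 := qn_ne _ (by omega)
        apply mul_left_cancel₀ hq
        have e1 : qn (E.count v + S.count v - 1) * (X ^ (S.count v) * qn (E.count v) *
            (if v ∈ E then Z r s N (v + r) (E.erase v) S * wt (insert w V) (E.erase v) S else 0))
            = X ^ (S.count v) * qn (E.count v) * (lap r s V (E.erase v) S).det *
              (qf (E.count w + S.count w) * vt V E S) := by
          split_ifs with h
          · rw [ihE h, vt_E hvV h h2]; ring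
          · rw [Multiset.count_eq_zero_of_notMem h]; simp
        have e2 : qn (E.count v + S.count v - 1) * (qn (S.count v) *
            (if v ∈ S then Z r s N (v - s) E (S.erase v) * wt (insert w V) E (S.erase v) else 0))
            = qn (S.count v) * (lap r s V E (S.erase v)).det *
              (qf (E.count w + S.count w) * vt V E S) := by
          split_ifs with h
          · rw [ihS h, vt_S hvV h h2]; ring
          · rw [Multiset.count_eq_zero_of_notMem h]; simp
        rw [mul_add, e1, e2]
        linear_combination (-(qf (E.count w + S.count w) * vt V E S)) * hd
      · have h1 : E.count v + S.count v = 1 := by omega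
        have hcol : ∀ k : V, k ≠ ⟨v, hvV⟩ → lap r s V E S k ⟨v, hvV⟩ = 0 := by
          intro k hk
          have hk' : v ≠ k.1 := fun h => hk (Subtype.ext h.symm)
          simp only [lap, Matrix.of_apply, row, hk', if_false]
          have g1 : (if v = k.1 + r then qn (E.count k.1) else 0) = 0 := by
            split_ifs with h
            · have : k.1 = v - r := by omega
              rw [this, show E.count (v - r) = 0 by omega, qn_zero]
            · rfl
          have g2 : (if v = k.1 - s then X ^ (E.count k.1) * qn (S.count k.1) else 0) = 0 := by
            split_ifs with h
            · have : k.1 = v + s := by omega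
              rw [this, show S.count (v + s) = 0 by omega, qn_zero, mul_zero]
            · rfl
          rw [g1, g2]; simp
        have hvr : v ≠ v + r := by omega
        have hvs : v ≠ v - s := by omega
        by_cases hE1 : v ∈ E
        · have c1 := Multiset.count_pos.2 hE1
          have c2 : S.count v = 0 := by omega
          have c3 : E.count v = 1 := by omega
          rw [if_pos hE1, ihE hE1, c2, c3, vt_E1 hvV h1]
          have : (lap r s V (E.erase v) S).det = (lap r s V E S).det := by
            conv_rhs => rw [← lap_self r s V E S ⟨v, hvV⟩]
            rw [lap_erase_E r s V E S ⟨v, hvV⟩]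
            apply det_col _ _ hcol
            simp [row, c2, c3, hvr]
          rw [this]
          simp
        · have c1 := Multiset.count_eq_zero_of_notMem hE1
          have c2 : S.count v = 1 := by omega
          have hS1 : v ∈ S := Multiset.count_pos.1 (by omega)
          rw [if_pos hS1, ihS hS1, c1, c2, vt_S1 hvV h1]
          have : (lap r s V E (S.erase v)).det = (lap r s V E S).det := by
            conv_rhs => rw [← lap_self r s V E S ⟨v, hvV⟩]
            rw [lap_erase_S r s V E S ⟨v, hvV⟩]
            apply det_col _ _ hcol
            simp [row, c1, c2, hvr, hvs]
          rw [this]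
          simp

end LW

namespace LW

/-- gauge exponent -/
def ga (s : ℤ) (E : Multiset ℤ) (k : ℤ) : ℕ := E.countP (fun x => x ≤ k ∧ s ∣ k - x)

lemma ga_step (s : ℤ) (hs : 0 < s) (E : Multiset ℤ) (k : ℤ) :
    ga s E k = ga s E (k - s) + E.count k := by
  induction E using Multiset.induction with
  | empty => simp [ga]
  | cons a E ih =>
    unfold ga at *
    rw [Multiset.countP_cons, Multiset.countP_cons, Multiset.count_cons, ih]
    have h1 : (a ≤ k ∧ s ∣ k - a) ↔ ((a ≤ k - s ∧ s ∣ k - s - a) ∨ k = a) := by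
      constructor
      · rintro ⟨h1, c, hc⟩
        rcases eq_or_ne k a with h | h
        · right; exact h
        · left
          have hc0 : 0 < c := by
            by_contra h'
            have : s * c ≤ 0 := mul_nonpos_of_nonneg_of_nonpos hs.le (by omega)
            omega
          have : s * 1 ≤ s * c := mul_le_mul_of_nonneg_left (by omega) hs.le
          refine ⟨by linarith, c - 1, ?_⟩
          linear_combination hc
      · rintro (⟨h1, c, hc⟩ | h)
        · exact ⟨by omega, c + 1, by linear_combination hc⟩
        · subst h; simp
    have h2 : ¬ ((a ≤ k - s ∧ s ∣ k - s - a) ∧ k = a) := by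
      rintro ⟨⟨h1, _⟩, rfl⟩; omega
    by_cases ha : k = a
    · have h3 : ¬ (a ≤ k - s ∧ s ∣ k - s - a) := fun h => h2 ⟨h, ha⟩
      rw [if_pos (h1.2 (Or.inr ha)), if_neg h3, if_pos ha]; omega
    · by_cases h3 : (a ≤ k - s ∧ s ∣ k - s - a)
      · rw [if_pos (h1.2 (Or.inl h3)), if_pos h3, if_neg ha]; omega
      · rw [if_neg (fun h => (h1.1 h).elim h3 ha), if_neg h3, if_neg ha]; omega

lemma ga_shift (r s : ℤ) (hr : 0 < r) (hs : 0 < s) (w : ℤ) (E S : Multiset ℤ)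
    (hb : Bal r s w w E S) (k : ℤ) :
    ga s E (k + r) = ga s E k + S.count (k + r + s) := by
  obtain ⟨lo, hlo⟩ := (E + S).toFinset.bddBelow
  have hE : ∀ x ∈ E, lo ≤ x := fun x hx => hlo (by simp [hx])
  have hS : ∀ x ∈ S, lo ≤ x := fun x hx => hlo (by simp [hx])
  have main : ∀ n : ℕ, ∀ k : ℤ, k + r + s < lo + n →
      ga s E (k + r) = ga s E k + S.count (k + r + s) := by
    intro n
    induction n with
    | zero =>
      intro k hk
      have h1 : ∀ j, j < lo → ga s E j = 0 := by
        intro j hj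
        unfold ga
        rw [Multiset.countP_eq_zero]
        intro x hx h
        have := hE x hx
        omega
      rw [h1 _ (by simp at hk; omega), h1 _ (by simp at hk; omega),
        Multiset.count_eq_zero_of_notMem]
      intro h
      have := hS _ h
      simp at hk; omega
    | succ n ih =>
      intro k hk
      have h1 := ih (k - s) (by push_cast at hk; omega)
      have h2 := ga_step s hs E k
      have h3 := ga_step s hs E (k + r)
      have h4 := hb (k + r)
      have e1 : k - s + r = k + r - s := by ring
      have e2 : k + r - s + s = k + r := by ring
      have e3 : k + r - r = k := by ring
      rw [e1, e2] at h1
      rw [e3] at h4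
      omega
  exact main ((k + r + s - lo).toNat + 1) k (by push_cast; omega)

lemma count_map_sub (S : Multiset ℤ) (s k : ℤ) : (S.map (fun x => x - s)).count k = S.count (k + s) := by
  have h : k = (fun x => x - s) (k + s) := by simp
  conv_lhs => rw [h]
  exact Multiset.count_map_eq_count' _ _ (fun a b h => by simpa using h) _

lemma count_map_add (S : Multiset ℤ) (s k : ℤ) : (S.map (fun x => x + s)).count k = S.count (k - s) := by
  have h : k = (fun x => x + s) (k - s) := by simp
  conv_lhs => rw [h]
  exact Multiset.count_map_eq_count' _ _ (fun a b h => by simpa using h) _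

lemma lap_dual (r s : ℤ) (hr : 0 < r) (hs : 0 < s) (w : ℤ) (V : Finset ℤ) (E S : Multiset ℤ)
    (hb : Bal r s w w E S) :
    (lap r s V E S).det = (lap s r V (S.map (fun x => x - s)) (E.map (fun x => x + r))).det := by
  set B := lap s r V (S.map (fun x => x - s)) (E.map (fun x => x + r)) with hB
  set D : Matrix V V ℤ[X] := Matrix.diagonal (fun k => X ^ ga s E k.1) with hD
  have h : lap r s V E S * D = D * B.transpose := by
    ext1 k l
    rw [hD, Matrix.mul_diagonal, Matrix.diagonal_mul, Matrix.transpose_apply, hB]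
    simp only [lap, Matrix.of_apply, row, count_map_sub, count_map_add]
    have hk := hb k.1
    have hl := hb l.1
    have hk' : E.count k.1 + S.count k.1 = E.count (k.1 - r) + S.count (k.1 + s) := by omega
    have hl' : E.count l.1 + S.count l.1 = S.count (l.1 + s) + E.count (l.1 - r) := by omega
    by_cases h1 : l.1 = k.1
    · have a1 : l.1 ≠ k.1 + r := by omega
      have a2 : l.1 ≠ k.1 - s := by omega
      have a3 : k.1 ≠ l.1 + s := by omega
      have a4 : k.1 ≠ l.1 - r := by omega
      rw [if_pos h1, if_pos h1, if_neg a1, if_neg a2, if_neg a3, if_neg a4, if_pos h1.symm,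
        if_pos h1.symm, ← hl', h1]
      split_ifs <;> ring
    · have h1' : k.1 ≠ l.1 := fun h => h1 h.symm
      rw [if_neg h1, if_neg h1, if_neg h1', if_neg h1']
      by_cases h2 : l.1 = k.1 + r
      · have a2 : l.1 ≠ k.1 - s := by omega
        have a3 : k.1 ≠ l.1 + s := by omega
        have a4 : k.1 = l.1 - r := by omega
        rw [if_pos h2, if_neg a2, if_neg a3, if_pos a4, ← hl', ← a4]
        have g := ga_shift r s hr hs w E S hb k.1
        rw [← h2] at g
        rw [g]
        by_cases b : E.count k.1 = 0
        · rw [b]; simp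
        · have b2 : ¬ (E.count l.1 + S.count l.1 = 0) := by
            rw [hl', ← a4]; omega
          rw [if_neg (by omega), if_neg b2]
          ring
      · have a4 : k.1 ≠ l.1 - r := by omega
        rw [if_neg h2, if_neg a4]
        by_cases h3 : l.1 = k.1 - s
        · have a3 : k.1 = l.1 + s := by omega
          rw [if_pos h3, if_pos a3, ← hl', ← a3]
          have g := ga_step s hs E k.1
          rw [← h3] at g
          rw [g]
          by_cases b : S.count k.1 = 0
          · rw [b]; simp
          · have b2 : ¬ (E.count l.1 + S.count l.1 = 0) := by
              rw [hl', ← a3]; omega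
            rw [if_neg (by omega), if_neg b2]
            ring
        · have a3 : k.1 ≠ l.1 + s := by omega
          rw [if_neg h3, if_neg a3]
          split_ifs <;> simp
  have hdet := congrArg Matrix.det h
  rw [Matrix.det_mul, Matrix.det_mul, Matrix.det_transpose, mul_comm] at hdet
  apply mul_left_cancel₀ _ hdet
  rw [hD, Matrix.det_diagonal, Finset.prod_ne_zero_iff]
  intro i _
  exact pow_ne_zero _ X_ne_zero

lemma prod_qf (W : Finset ℤ) (E : Multiset ℤ) (h : ∀ k ∈ E, k ∈ W) :
    ∏ k ∈ W, qf (E.count k) = ∏ k ∈ E.toFinset, qf (E.count k) := by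
  symm
  apply Finset.prod_subset
  · intro k hk; exact h k (by simpa using hk)
  · intro k _ hk
    rw [Multiset.count_eq_zero_of_notMem (by simpa using hk), qf_zero]

lemma prod_qf_map (E : Multiset ℤ) (f : ℤ → ℤ) (hf : Function.Injective f) :
    ∏ k ∈ (E.map f).toFinset, qf ((E.map f).count k) = ∏ k ∈ E.toFinset, qf (E.count k) := by
  rw [Multiset.toFinset_map, Finset.prod_image (fun a _ b _ h => hf h)]
  apply Finset.prod_congr rfl
  intro k _
  rw [Multiset.count_map_eq_count' _ _ hf]

theorem Z_dual (r s : ℤ) (hr : 0 < r) (hs : 0 < s) (w : ℤ) (E S : Multiset ℤ)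
    (hb : Bal r s w w E S) (N : ℕ) (hN : E.card + S.card = N) :
    Z r s N w E S = Z s r N w (S.map (fun x => x - s)) (E.map (fun x => x + r)) := by
  set E' := S.map (fun x => x - s) with hE'
  set S' := E.map (fun x => x + r) with hS'
  set V : Finset ℤ := (E + S + E' + S').toFinset.erase w with hV
  have hw : w ∉ V := by simp [hV]
  have m1 : ∀ x, x ∈ E ∨ x ∈ S ∨ x ∈ E' ∨ x ∈ S' → x ∈ insert w V := by
    intro x hx
    by_cases h : x = w
    · simp [h]
    · apply Finset.mem_insert_of_mem
      rw [hV, Finset.mem_erase]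
      refine ⟨h, ?_⟩
      rw [Multiset.mem_toFinset]
      simp only [Multiset.mem_add]
      tauto
  have hcE' : ∀ k, E'.count k = S.count (k + s) := fun k => count_map_sub S s k
  have hcS' : ∀ k, S'.count k = E.count (k - r) := fun k => count_map_add E r k
  have hout : ∀ k, E'.count k + S'.count k = E.count k + S.count k := by
    intro k
    have := hb k
    rw [hcE', hcS']; omega
  have hb' : Bal s r w w E' S' := by
    intro k
    rw [hout, hcE', hcS']
    simp
    omega
  have b1 := best r s hr hs w V hw N w E S (fun k hk => m1 k (Or.inl hk))
    (fun k hk => m1 k (Or.inr (Or.inl hk))) hN hb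
  have b2 := best s r hs hr w V hw N w E' S' (fun k hk => m1 k (Or.inr (Or.inr (Or.inl hk))))
    (fun k hk => m1 k (Or.inr (Or.inr (Or.inr hk)))) (by simp [hE', hS']; omega) hb'
  have hvt : vt V E' S' = vt V E S := by
    unfold vt
    apply Finset.prod_congr rfl
    intro k _
    rw [hout]
  have hwt : wt (insert w V) E' S' = wt (insert w V) E S := by
    unfold wt
    rw [Finset.prod_mul_distrib, Finset.prod_mul_distrib,
      prod_qf _ E' (fun k hk => m1 k (Or.inr (Or.inr (Or.inl hk)))),
      prod_qf _ S' (fun k hk => m1 k (Or.inr (Or.inr (Or.inr hk)))),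
      prod_qf _ E (fun k hk => m1 k (Or.inl hk)),
      prod_qf _ S (fun k hk => m1 k (Or.inr (Or.inl hk))), hE', hS',
      prod_qf_map _ _ (fun a b h => by simpa using h), prod_qf_map _ _ (fun a b h => by simpa using h),
      mul_comm]
  rw [hvt, hwt, hout, ← lap_dual r s hr hs w V E S hb, ← b1] at b2
  apply mul_right_cancel₀ _ b2.symm
  unfold wt
  rw [Finset.prod_ne_zero_iff]
  intro k _
  exact mul_ne_zero (qf_ne _) (qf_ne _)

lemma bal_path (r s v : ℤ) (L : List Bool) :
    Bal r s v (endp r s v L) (eE r s v L) (eS r s v L) := by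
  induction L generalizing v with
  | nil => intro k; simp [eE, eS, endp]
  | cons b L ih =>
    cases b
    · have h1 : endp r s v (false :: L) = endp r s (v - s) L := by simp [endp]; ring
      intro k
      have := ih (v - s) k
      simp only [h1, eE, eS, Multiset.count_cons]
      have e : (k + s = v) ↔ (k = v - s) := by constructor <;> intro h <;> omega
      simp only [e]
      omega
    · have h1 : endp r s v (true :: L) = endp r s (v + r) L := by simp [endp]; ring
      intro k
      have := ih (v + r) k
      simp only [h1, eE, eS, Multiset.count_cons]
      have e : (k - r = v) ↔ (k = v + r) := by constructor <;> intro h <;> omega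
      simp only [e]
      omega

lemma sum_map_ite (M : Multiset ℤ) (v : ℤ) :
    (M.map (fun k => if k = v then 1 else 0)).sum = M.count v := by
  induction M using Multiset.induction with
  | empty => simp
  | cons a M ih =>
    rw [Multiset.map_cons, Multiset.sum_cons, ih, Multiset.count_cons, add_comm]
    simp only [eq_comm]

lemma stW_exit (r s : ℕ) (v : ℤ) (L : List Bool) : stW (Pexit r s) L = ex r s v L := by
  induction L generalizing v with
  | nil => simp [stW, ex]
  | cons b L ih =>
    cases b
    · simp only [stW, ex]; exact ih _
    · simp only [stW, ex, ← ih (v + r), ← sum_map_ite, ← fst_level]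
      congr 1
      apply fst_congr
      intro a l
      unfold Pexit
      apply if_congr _ rfl rfl
      constructor <;> intro h <;> linarith

lemma stW_arr (r s : ℕ) (L : List Bool) : stW (Parr r s) L = stW (Pexit s r) (tr L) := by
  rw [stW_tr]
  apply stW_congr
  intro a l
  unfold Parr Pexit
  apply if_congr _ rfl rfl
  constructor <;> intro h <;> linarith

lemma endp_of_cards (r s v : ℤ) (L : List Bool) :
    endp r s v L = v + r * (eE r s v L).card - s * (eS r s v L).card := by
  rw [card_eE, card_eS, endp]

lemma sum_words_tr (N : ℕ) (F : List Bool → ℤ[X]) : ∑ L ∈ words N, F (tr L) = ∑ L ∈ words N, F L := by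
  apply Finset.sum_bij' (fun L _ => tr L) (fun L _ => tr L)
  · intro L hL; rw [mem_words] at *; simpa using hL
  · intro L hL; rw [mem_words] at *; simpa using hL
  · intro L _; simp
  · intro L _; simp
  · intro L _; rfl

lemma Z_arr (r s : ℕ) (w : ℤ) (E S : Multiset ℤ) (N : ℕ)
    (hc : (r : ℤ) * E.card = s * S.card) :
    Z s r N w (S.map (fun x => x - (s : ℤ))) (E.map (fun x => x + (r : ℤ)))
      = ∑ L ∈ words N, if eE r s w L = E ∧ eS r s w L = S then X ^ stW (Parr r s) L else 0 := by
  rw [Z, ← sum_words_tr]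
  apply Finset.sum_congr rfl
  intro L _
  have hiff : (eE s r w (tr L) = S.map (fun x => x - (s : ℤ)) ∧
      eS s r w (tr L) = E.map (fun x => x + (r : ℤ))) ↔ (eE r s w L = E ∧ eS r s w L = S) := by
    constructor
    · rintro ⟨h1, h2⟩
      have c1 := congrArg Multiset.card h1
      have c2 := congrArg Multiset.card h2
      rw [card_eE, (count_tr L).1, Multiset.card_map] at c1
      rw [card_eS, (count_tr L).2, Multiset.card_map] at c2
      have hw : endp r s w L = w := by
        unfold endp; rw [c1, c2, hc]; ring
      have h3 := eE_tr r s w L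
      have h4 := eS_tr r s w L
      rw [hw, h1] at h3
      rw [hw, h2] at h4
      exact ⟨(Multiset.map_injective (fun a b h => by simpa using h) h4).symm,
        (Multiset.map_injective (fun a b h => by simpa using h) h3).symm⟩
    · rintro ⟨h1, h2⟩
      have hw : endp r s w L = w := by
        rw [endp_of_cards, h1, h2, hc]; ring
      have h3 := eE_tr r s w L
      have h4 := eS_tr r s w L
      rw [hw] at h3 h4
      rw [h3, h4, h1, h2]
      exact ⟨rfl, rfl⟩
  simp only [hiff]
  rw [stW_arr, stW_exit s r w]

/-- words with given numbers of steps and given area -/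
def Wd (N a b n : ℕ) : Finset (List Bool) :=
  (words N).filter (fun L => L.count true = a ∧ L.count false = b ∧ stW (fun _ _ => 1) L = n)

theorem wall_words (r s : ℕ) (hr : 0 < r) (hs : 0 < s) (N a b n : ℕ) (hab : r * a = s * b) (hN : a + b = N) :
    ∑ L ∈ Wd N a b n, (X : ℤ[X]) ^ (stW (Pcore r s) L + stW (Pexit r s) L)
      = ∑ L ∈ Wd N a b n, (X : ℤ[X]) ^ (stW (Pcore r s) L + stW (Parr r s) L) := by
  classical
  set g : List Bool → Multiset ℤ × Multiset ℤ := fun L => (eE r s 0 L, eS r s 0 L) with hg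
  rw [← Finset.sum_fiberwise_of_maps_to (g := g) (t := (Wd N a b n).image g)
      (fun x hx => Finset.mem_image_of_mem g hx) (fun L => (X : ℤ[X]) ^ (stW (Pcore r s) L + stW (Pexit r s) L)),
    ← Finset.sum_fiberwise_of_maps_to (g := g) (t := (Wd N a b n).image g)
      (fun x hx => Finset.mem_image_of_mem g hx) (fun L => (X : ℤ[X]) ^ (stW (Pcore r s) L + stW (Parr r s) L))]
  apply Finset.sum_congr rfl
  rintro p hp
  obtain ⟨L0, hL0, rfl⟩ := Finset.mem_image.1 hp
  simp only [Wd, Finset.mem_filter] at hL0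
  obtain ⟨hw0, ha0, hb0, hn0⟩ := hL0
  set E := eE r s 0 L0 with hE
  set S := eS r s 0 L0 with hS
  have hEc : E.card = a := by rw [hE, card_eE, ha0]
  have hSc : S.card = b := by rw [hS, card_eS, hb0]
  have habz : (r : ℤ) * a = s * b := by exact_mod_cast hab
  have hend0 : ∀ L, eE r s 0 L = E → eS r s 0 L = S → endp r s 0 L = 0 := by
    intro L h1 h2
    rw [endp_of_cards, h1, h2, hEc, hSc, habz]; ring
  have hset : (Wd N a b n).filter (fun L => g L = g L0)
      = (words N).filter (fun L => eE r s 0 L = E ∧ eS r s 0 L = S) := by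
    ext L
    simp only [Wd, Finset.mem_filter, hg, Prod.mk.injEq]
    constructor
    · rintro ⟨⟨h1, _⟩, h2, h3⟩; exact ⟨h1, h2, h3⟩
    · rintro ⟨h1, h2, h3⟩
      have c1 : L.count true = a := by rw [← card_eE r s 0, h2, hEc]
      have c2 : L.count false = b := by rw [← card_eS r s 0, h3, hSc]
      refine ⟨⟨h1, c1, c2, ?_⟩, h2, h3⟩
      have s1 := sum_eE r s 0 L
      have s2 := sum_eE r s 0 L0
      rw [h2, c1, c2] at s1
      rw [← hE, ha0, hb0] at s2
      have s3 : (s : ℤ) * (stW (fun _ _ => 1) L) = s * stW (fun _ _ => 1) L0 := by linarith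
      have s4 := mul_left_cancel₀ (by omega : (s : ℤ) ≠ 0) s3
      have s5 : stW (fun _ _ => 1) L = stW (fun _ _ => 1) L0 := by exact_mod_cast s4
      rw [s5, hn0]
  rw [hset]
  have hcore : ∀ L ∈ (words N).filter (fun L => eE r s 0 L = E ∧ eS r s 0 L = S),
      stW (Pcore r s) L = stW (Pcore r s) L0 := by
    intro L hL
    obtain ⟨_, h2, h3⟩ := Finset.mem_filter.1 hL
    have s1 := stW_core r s hr hs 0 L
    have s2 := stW_core r s hr hs 0 L0
    rw [hend0 L h2 h3, h2, ← card_eE r s 0, h2] at s1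
    rw [hend0 L0 rfl rfl, ← hE, ← card_eE r s 0, ← hE] at s2
    have : (4 : ℤ) * stW (Pcore r s) L = 4 * stW (Pcore r s) L0 := by rw [s1, s2]
    omega
  have e1 : ∀ f : List Bool → ℕ, ∑ L ∈ (words N).filter (fun L => eE r s 0 L = E ∧ eS r s 0 L = S),
      (X : ℤ[X]) ^ (stW (Pcore r s) L + f L)
      = X ^ stW (Pcore r s) L0 * ∑ L ∈ words N, if eE r s 0 L = E ∧ eS r s 0 L = S then X ^ f L else 0 := by
    intro f
    rw [← Finset.sum_filter, Finset.mul_sum]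
    apply Finset.sum_congr rfl
    intro L hL
    rw [hcore L hL, pow_add]
  rw [e1, e1, ← Z_arr r s 0 E S N (by rw [hEc, hSc, habz])]
  have hbal : Bal r s 0 0 E S := by
    have := bal_path r s 0 L0
    rwa [hend0 L0 rfl rfl] at this
  rw [← Z_dual r s (by omega) (by omega) 0 E S hbal N (by omega)]
  rw [Z]
  congr 1
  apply Finset.sum_congr rfl
  intro L _
  rw [stW_exit r s 0]

end LW

namespace LW

lemma sum_cells {M : Type*} [AddCommMonoid M] (Γ : YoungDiagram) (A : ℕ)
    (hA : ∀ u v, (u, v) ∈ Γ → u < A) (F : ℕ → ℕ → M) :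
    ∑ c ∈ Γ.cells, F c.1 c.2 = ∑ u ∈ Finset.range A, ∑ v ∈ Finset.range (Γ.rowLen u), F u v := by
  rw [Finset.sum_sigma']
  apply Finset.sum_bij' (fun c _ => (⟨c.1, c.2⟩ : (_ : ℕ) × ℕ)) (fun c _ => (c.1, c.2))
  · rintro ⟨u, v⟩ h
    have h' : (u, v) ∈ Γ := h
    simp only [Finset.mem_sigma, Finset.mem_range]
    exact ⟨hA u v h', YoungDiagram.mem_iff_lt_rowLen.1 h'⟩
  · rintro ⟨u, v⟩ h
    simp only [Finset.mem_sigma, Finset.mem_range] at h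
    exact YoungDiagram.mem_iff_lt_rowLen.2 h.2
  · intros; rfl
  · intros; rfl
  · intros; rfl

/-- column heights of the diagram of a word -/
def hgt : List Bool → ℕ → ℕ
  | [], _ => 0
  | false :: L, u => hgt L u
  | true :: L, 0 => L.count false
  | true :: L, u + 1 => hgt L u

/-- row lengths of the diagram of a word -/
def rowl : List Bool → ℕ → ℕ
  | [], _ => 0
  | false :: L, v => rowl L v
  | true :: L, v => (if v < L.count false then 1 else 0) + rowl L v

lemma rowl_zero (L : List Bool) (v : ℕ) (h : L.count false ≤ v) : rowl L v = 0 := by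
  induction L with
  | nil => rfl
  | cons b L ih =>
    cases b
    · simp at h; simp only [rowl]; exact ih (by omega)
    · simp at h; simp only [rowl]; rw [if_neg (by omega), ih h]

lemma hgt_le (L : List Bool) (u : ℕ) : hgt L u ≤ L.count false := by
  induction L generalizing u with
  | nil => simp [hgt]
  | cons b L ih =>
    cases b
    · simp only [hgt]; have := ih u; simp; omega
    · cases u with
      | zero => simp [hgt]
      | succ u => simp only [hgt]; have := ih u; simp; omega

lemma hgt_zero (L : List Bool) (u : ℕ) (h : L.count true ≤ u) : hgt L u = 0 := by
  induction L generalizing u with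
  | nil => simp [hgt]
  | cons b L ih =>
    cases b
    · simp only [hgt]; simp at h; exact ih u h
    · cases u with
      | zero => simp at h
      | succ u => simp only [hgt]; simp at h; exact ih u h

lemma lt_hgt_iff (L : List Bool) (u v : ℕ) : v < hgt L u ↔ u < rowl L v := by
  induction L generalizing u with
  | nil => simp [hgt, rowl]
  | cons b L ih =>
    cases b
    · simp only [hgt, rowl, ih]
    · cases u with
      | zero =>
        simp only [hgt, rowl]
        by_cases h : v < L.count false
        · simp [h]
        · simp [h, rowl_zero L v (by omega)]
      | succ u =>
        simp only [hgt, rowl, ih]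
        by_cases h : v < L.count false
        · simp only [h, if_true]; omega
        · simp [h, rowl_zero L v (by omega)]

/-- the Young diagram of a word -/
def dg (L : List Bool) : YoungDiagram where
  cells := (Finset.range (L.count true) ×ˢ Finset.range (L.count false)).filter
    (fun c => c.2 < hgt L c.1)
  isLowerSet := by
    rintro ⟨u, v⟩ ⟨u', v'⟩ ⟨h1 : u' ≤ u, h2 : v' ≤ v⟩ h
    simp only [Finset.coe_filter, Finset.mem_product, Finset.mem_range, Set.mem_ofPred_eq] at h ⊢
    obtain ⟨⟨h3, h4⟩, h5⟩ := h
    refine ⟨⟨by omega, by omega⟩, ?_⟩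
    have h6 : v' < hgt L u := by omega
    rw [lt_hgt_iff] at h6 ⊢
    omega

lemma mem_dg (L : List Bool) (u v : ℕ) : (u, v) ∈ dg L ↔ v < hgt L u := by
  rw [← YoungDiagram.mem_cells]
  simp only [dg, Finset.mem_filter, Finset.mem_product, Finset.mem_range]
  constructor
  · exact fun h => h.2
  · intro h
    refine ⟨⟨?_, ?_⟩, h⟩
    · by_contra h'
      rw [hgt_zero L u (by omega)] at h; omega
    · have := hgt_le L u; omega

lemma rowLen_dg (L : List Bool) (u : ℕ) : (dg L).rowLen u = hgt L u := by
  apply eq_of_forall_lt_iff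
  intro v
  rw [← YoungDiagram.mem_iff_lt_rowLen, mem_dg]

lemma colLen_dg (L : List Bool) (v : ℕ) : (dg L).colLen v = rowl L v := by
  apply eq_of_forall_lt_iff
  intro u
  rw [← YoungDiagram.mem_iff_lt_colLen, mem_dg, lt_hgt_iff]

lemma fst_rowl (P : ℕ → ℕ → ℕ) (L : List Bool) :
    ∑ v ∈ Finset.range (L.count false), P (rowl L v) (L.count false - v - 1) = fst P L := by
  induction L generalizing P with
  | nil => simp [fst]
  | cons b L ih =>
    cases b
    · simp only [fst, rowl, ← ih]
      rw [List.count_cons_self, Finset.sum_range_succ, rowl_zero L _ le_rfl, add_comm]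
      congr 1
      · simp
      · apply Finset.sum_congr rfl
        intro v hv
        rw [Finset.mem_range] at hv
        congr 1; omega
    · simp only [fst, ← ih]
      have : List.count false (true :: L) = L.count false := by simp
      rw [this]
      apply Finset.sum_congr rfl
      intro v hv
      rw [Finset.mem_range] at hv
      simp only [rowl, hv, if_true, add_comm]

/-- statistic of a Young diagram: sum of `P arm leg` over its boxes -/
def stY (P : ℕ → ℕ → ℕ) (Γ : YoungDiagram) : ℕ :=
  ∑ c ∈ Γ.cells, P (Γ.colLen c.2 - c.1 - 1) (Γ.rowLen c.1 - c.2 - 1)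

lemma stY_word (P : ℕ → ℕ → ℕ) (L : List Bool) :
    ∑ u ∈ Finset.range (L.count true), ∑ v ∈ Finset.range (hgt L u),
      P (rowl L v - u - 1) (hgt L u - v - 1) = stW P L := by
  induction L with
  | nil => simp [stW]
  | cons b L ih =>
    cases b
    · simp only [stW, hgt, rowl, ← ih]; simp
    · rw [List.count_cons_self, Finset.sum_range_succ']
      simp only [stW, hgt, ← ih, ← fst_rowl]
      rw [add_comm]
      congr 1
      · apply Finset.sum_congr rfl
        intro v hv
        rw [Finset.mem_range] at hv
        simp only [rowl, hv, if_true]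
        congr 1; omega
      · apply Finset.sum_congr rfl
        intro u hu
        apply Finset.sum_congr rfl
        intro v hv
        rw [Finset.mem_range] at hv
        have := hgt_le L u
        have h2 : v < L.count false := by omega
        simp only [rowl, h2, if_true]
        congr 1; omega

lemma stY_dg (P : ℕ → ℕ → ℕ) (L : List Bool) : stY P (dg L) = stW P L := by
  rw [← stY_word, stY, sum_cells (dg L) (L.count true) ?_
    (fun u v => P ((dg L).colLen v - u - 1) ((dg L).rowLen u - v - 1))]
  · simp only [rowLen_dg, colLen_dg]
  · intro u v h
    rw [mem_dg] at h
    by_contra h'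
    rw [hgt_zero L u (by omega)] at h; omega

lemma stY_one (Γ : YoungDiagram) : stY (fun _ _ => 1) Γ = Γ.card := by simp [stY]

lemma hgt_inj (L L' : List Bool) (h1 : L.count true = L'.count true)
    (h2 : L.count false = L'.count false) (h : hgt L = hgt L') : L = L' := by
  induction L generalizing L' with
  | nil =>
    cases L' with
    | nil => rfl
    | cons b L' => cases b <;> simp at h1 h2
  | cons b L ih =>
    cases L' with
    | nil => cases b <;> simp at h1 h2
    | cons b' L' =>
      have h0 := congrFun h 0
      cases b <;> cases b'
      · simp at h1 h2
        rw [ih L' h1 h2]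
        funext u; have := congrFun h u; simpa [hgt] using this
      · simp only [hgt] at h0
        have := hgt_le L 0
        simp at h1 h2; omega
      · simp only [hgt] at h0
        have := hgt_le L' 0
        simp at h1 h2; omega
      · simp at h1 h2
        rw [ih L' h1 h2]
        funext u; have := congrFun h (u + 1); simpa [hgt] using this

lemma hgt_surj (n : ℕ) : ∀ (a b : ℕ) (f : ℕ → ℕ), a + b = n → (∀ i j, i ≤ j → f j ≤ f i) →
    (∀ u, f u ≤ b) → (∀ u, a ≤ u → f u = 0) →
    ∃ L : List Bool, L.count true = a ∧ L.count false = b ∧ hgt L = f := by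
  induction n with
  | zero =>
    intro a b f hn hf hb ha
    refine ⟨[], by simp; omega, by simp; omega, ?_⟩
    funext u
    simp only [hgt]
    exact (ha u (by omega)).symm
  | succ n ih =>
    intro a b f hn hf hb ha
    by_cases hc : 0 < a ∧ f 0 = b
    · obtain ⟨L, h1, h2, h3⟩ := ih (a - 1) b (fun u => f (u + 1)) (by omega)
        (fun i j hij => hf _ _ (by omega)) (fun u => hb _) (fun u hu => ha _ (by omega))
      refine ⟨true :: L, by simp; omega, by simp; omega, ?_⟩
      funext u
      cases u with
      | zero => simp only [hgt]; rw [h2, hc.2]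
      | succ u => simp only [hgt, h3]
    · have hb0 : f 0 < b := by
        have := hb 0
        by_cases h : 0 < a
        · omega
        · have := ha 0 (by omega); omega
      obtain ⟨L, h1, h2, h3⟩ := ih a (b - 1) f (by omega)
        hf (fun u => by have := hf 0 u (by omega); omega) ha
      refine ⟨false :: L, by simp; omega, by simp; omega, ?_⟩
      funext u
      simp only [hgt, h3]

lemma rowLen_le_card (Γ : YoungDiagram) (u : ℕ) : Γ.rowLen u ≤ Γ.card := by
  rw [YoungDiagram.rowLen_eq_card]
  exact Finset.card_le_card (Finset.filter_subset _ _)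

lemma colLen_le_card (Γ : YoungDiagram) (v : ℕ) : Γ.colLen v ≤ Γ.card := by
  rw [YoungDiagram.colLen_eq_card]
  exact Finset.card_le_card (Finset.filter_subset _ _)

lemma mem_lt_card {Γ : YoungDiagram} {u v : ℕ} (h : (u, v) ∈ Γ) : u < Γ.card ∧ v < Γ.card := by
  have h1 := YoungDiagram.mem_iff_lt_rowLen.1 h
  have h2 := YoungDiagram.mem_iff_lt_colLen.1 h
  have := rowLen_le_card Γ u
  have := colLen_le_card Γ v
  omega

lemma finite_YD (n : ℕ) : {Γ : YoungDiagram | Γ.card = n}.Finite := by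
  apply Set.Finite.of_finite_image (f := YoungDiagram.cells)
  · apply Set.Finite.subset (Finset.finite_toSet (Finset.range n ×ˢ Finset.range n).powerset)
    rintro s ⟨Γ, hΓ, rfl⟩
    simp only [Set.mem_ofPred_eq] at hΓ
    rw [Finset.mem_coe, Finset.mem_powerset]
    rintro ⟨u, v⟩ h
    have := mem_lt_card (show (u, v) ∈ Γ from h)
    simp; omega
  · intro a _ b _ h
    exact YoungDiagram.ext h

/-- the finset of Young diagrams with `n` boxes -/
noncomputable def YD (n : ℕ) : Finset YoungDiagram := (finite_YD n).toFinset

lemma mem_YD {n : ℕ} {Γ : YoungDiagram} : Γ ∈ YD n ↔ Γ.card = n := by simp [YD]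

lemma sum_YD (n a b : ℕ) (ha : n ≤ a) (hb : n ≤ b) (P : ℕ → ℕ → ℕ) :
    ∑ Γ ∈ YD n, (X : ℤ[X]) ^ stY P Γ = ∑ L ∈ Wd (a + b) a b n, (X : ℤ[X]) ^ stW P L := by
  symm
  apply Finset.sum_bij (fun L _ => dg L)
  · intro L hL
    simp only [Wd, Finset.mem_filter] at hL
    rw [mem_YD, ← stY_one, stY_dg]; exact hL.2.2.2
  · intro L hL L' hL' h
    simp only [Wd, Finset.mem_filter] at hL hL'
    apply hgt_inj
    · rw [hL.2.1, hL'.2.1]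
    · rw [hL.2.2.1, hL'.2.2.1]
    · funext u
      rw [← rowLen_dg, ← rowLen_dg]
      rw [h]
  · intro Γ hΓ
    rw [mem_YD] at hΓ
    obtain ⟨L, h1, h2, h3⟩ := hgt_surj (a + b) a b Γ.rowLen rfl Γ.rowLen_anti
      (fun u => (rowLen_le_card Γ u).trans (by omega)) (by
        intro u hu
        by_contra h
        have h' : (u, 0) ∈ Γ := YoungDiagram.mem_iff_lt_rowLen.2 (by omega)
        have := mem_lt_card h'
        omega)
    have hd : dg L = Γ := by
      apply YoungDiagram.ext
      ext ⟨u, v⟩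
      rw [YoungDiagram.mem_cells, YoungDiagram.mem_cells, mem_dg, h3, YoungDiagram.mem_iff_lt_rowLen]
    refine ⟨L, ?_, hd⟩
    simp only [Wd, Finset.mem_filter, mem_words]
    refine ⟨?_, h1, h2, ?_⟩
    · rw [← h1, ← h2]; exact (List.count_true_add_count_false L).symm
    · rw [← stY_dg, hd, stY_one, hΓ]
  · intro L _
    rw [stY_dg]

theorem wall_YD (n r s : ℕ) (hr : 0 < r) (hs : 0 < s) :
    ∑ Γ ∈ YD n, (X : ℤ[X]) ^ stY (fun a l => Pcore r s a l + Pexit r s a l) Γ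
      = ∑ Γ ∈ YD n, (X : ℤ[X]) ^ stY (fun a l => Pcore r s a l + Parr r s a l) Γ := by
  have h1 : n ≤ s * n := Nat.le_mul_of_pos_left n hs
  have h2 : n ≤ r * n := Nat.le_mul_of_pos_left n hr
  rw [sum_YD n (s * n) (r * n) h1 h2, sum_YD n (s * n) (r * n) h1 h2]
  simp only [stW_add]
  exact wall_words r s hr hs _ _ _ n (by ring) rfl

end LW

namespace LW

lemma stY_congr {n : ℕ} {Γ : YoungDiagram} (hΓ : Γ.card = n) {P Q : ℕ → ℕ → ℕ}
    (h : ∀ a l, a < n → l < n → P a l = Q a l) : stY P Γ = stY Q Γ := by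
  apply Finset.sum_congr rfl
  rintro ⟨u, v⟩ hc
  have hc' : (u, v) ∈ Γ := hc
  have h1 := YoungDiagram.mem_iff_lt_rowLen.1 hc'
  have h2 := YoungDiagram.mem_iff_lt_colLen.1 hc'
  have := rowLen_le_card Γ u
  have := colLen_le_card Γ v
  apply h
  · simp only; omega
  · simp only; omega

/-- right-closed indicator -/
def Pgt (r s a l : ℕ) : ℕ := if s * l < r * (a + 1) ∧ r * a ≤ s * (l + 1) then 1 else 0
/-- left-closed indicator -/
def Plt (r s a l : ℕ) : ℕ := if s * l ≤ r * (a + 1) ∧ r * a < s * (l + 1) then 1 else 0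

lemma Pgt_eq (r s a l : ℕ) (hr : 0 < r) (hs : 0 < s) : Pcore r s a l + Parr r s a l = Pgt r s a l := by
  unfold Pcore Parr Pgt
  have e1 : s * l < r * (a + 1) ↔ -(r : ℤ) < r * a - s * l := by
    zify; constructor <;> intro h <;> linarith
  have e2 : r * a ≤ s * (l + 1) ↔ (r : ℤ) * a - s * l ≤ s := by
    zify; constructor <;> intro h <;> linarith
  simp only [e1, e2]
  generalize (r : ℤ) * a - s * l = x
  split_ifs <;> omega

lemma Plt_eq (r s a l : ℕ) (hr : 0 < r) (hs : 0 < s) : Pcore r s a l + Pexit r s a l = Plt r s a l := by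
  unfold Pcore Pexit Plt
  have e1 : s * l ≤ r * (a + 1) ↔ -(r : ℤ) ≤ r * a - s * l := by
    zify; constructor <;> intro h <;> linarith
  have e2 : r * a < s * (l + 1) ↔ (r : ℤ) * a - s * l < s := by
    zify; constructor <;> intro h <;> linarith
  simp only [e1, e2]
  generalize (r : ℤ) * a - s * l = x
  split_ifs <;> omega

lemma wall_YD' (n r s : ℕ) (hr : 0 < r) (hs : 0 < s) :
    ∑ Γ ∈ YD n, (X : ℤ[X]) ^ stY (Plt r s) Γ = ∑ Γ ∈ YD n, (X : ℤ[X]) ^ stY (Pgt r s) Γ := by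
  have h := wall_YD n r s hr hs
  have e1 : (fun a l => Pcore r s a l + Pexit r s a l) = Plt r s := by
    funext a l; exact Plt_eq r s a l hr hs
  have e2 : (fun a l => Pcore r s a l + Parr r s a l) = Pgt r s := by
    funext a l; exact Pgt_eq r s a l hr hs
  rwa [e1, e2] at h

lemma Pgt_next (n M a l : ℕ) (hl : l < n) :
    Pgt n.factorial M a l = Plt n.factorial (M + 1) a l := by
  unfold Pgt Plt
  apply if_congr _ rfl rfl
  have d1 : (l + 1) ∣ n.factorial := Nat.dvd_factorial (by omega) (by omega)
  apply and_congr
  · rcases Nat.eq_zero_or_pos l with h | h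
    · subst h
      have := Nat.factorial_pos n
      simp [this]
    · obtain ⟨c, hc⟩ : l ∣ n.factorial := Nat.dvd_factorial h (by omega)
      rw [hc, mul_comm M, mul_comm (M + 1), mul_assoc, Nat.mul_lt_mul_left h, Nat.mul_le_mul_left_iff h]
      omega
  · obtain ⟨c, hc⟩ := d1
    rw [hc, mul_comm M, mul_comm (M + 1), mul_assoc, Nat.mul_lt_mul_left (by omega),
      Nat.mul_le_mul_left_iff (by omega)]
    omega

lemma chain (n M : ℕ) (hM : 0 < M) (j : ℕ) :
    ∑ Γ ∈ YD n, (X : ℤ[X]) ^ stY (Pgt n.factorial M) Γ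
      = ∑ Γ ∈ YD n, (X : ℤ[X]) ^ stY (Plt n.factorial (M + 1 + j)) Γ := by
  induction j with
  | zero =>
    apply Finset.sum_congr rfl
    intro Γ hΓ
    rw [stY_congr (mem_YD.1 hΓ) (fun a l _ hl => Pgt_next n M a l hl)]
  | succ j ih =>
    rw [ih, wall_YD' n _ _ (Nat.factorial_pos n) (by omega)]
    apply Finset.sum_congr rfl
    intro Γ hΓ
    rw [stY_congr (mem_YD.1 hΓ) (fun a l _ hl => Pgt_next n _ a l hl)]
    rfl

theorem LW_main (n : ℕ) :
    ∑ Γ ∈ YD n, (X : ℤ[X]) ^ stY (fun a l => if a = l ∨ a = l + 1 then 1 else 0) Γ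
      = ∑ Γ ∈ YD n, (X : ℤ[X]) ^ stY (fun _ l => if l = 0 then 1 else 0) Γ := by
  have hN := Nat.factorial_pos n
  have h := chain n n.factorial hN (n.factorial * n)
  have e1 : (fun a l : ℕ => if a = l ∨ a = l + 1 then 1 else 0) = Pgt n.factorial n.factorial := by
    funext a l
    unfold Pgt
    apply if_congr _ rfl rfl
    rw [Nat.mul_lt_mul_left hN, Nat.mul_le_mul_left_iff hN]
    omega
  rw [e1, h]
  apply Finset.sum_congr rfl
  intro Γ hΓ
  rw [stY_congr (mem_YD.1 hΓ)]
  intro a l ha hl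
  unfold Plt
  apply if_congr _ rfl rfl
  rcases Nat.eq_zero_or_pos l with h | h
  · subst h
    have : n.factorial * a ≤ n.factorial * n := Nat.mul_le_mul_left _ (by omega)
    simp; omega
  · have h1 : n.factorial * (a + 1) ≤ n.factorial * n := Nat.mul_le_mul_left _ (by omega)
    have h2 : (n.factorial + 1 + n.factorial * n) * 1 ≤ (n.factorial + 1 + n.factorial * n) * l :=
      Nat.mul_le_mul_left _ (by omega)
    constructor
    · rintro ⟨h3, _⟩; omega
    · intro h3; omega

lemma stY_leg (Γ : YoungDiagram) :
    stY (fun _ l => if l = 0 then 1 else 0) Γ = Γ.rowLens.length := by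
  rw [stY, sum_cells Γ (Γ.colLen 0) ?_ (fun u v => if Γ.rowLen u - v - 1 = 0 then 1 else 0)]
  · rw [YoungDiagram.length_rowLens]
    have : ∀ u ∈ Finset.range (Γ.colLen 0), ∑ v ∈ Finset.range (Γ.rowLen u),
        (if Γ.rowLen u - v - 1 = 0 then 1 else 0) = 1 := by
      intro u hu
      rw [Finset.mem_range, ← YoungDiagram.mem_iff_lt_colLen, YoungDiagram.mem_iff_lt_rowLen] at hu
      rw [Finset.sum_eq_single (Γ.rowLen u - 1)]
      · rw [if_pos (by omega)]
      · intro b hb hb'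
        rw [Finset.mem_range] at hb
        rw [if_neg (by omega)]
      · intro h; simp at h; omega
    rw [Finset.sum_congr rfl this]; simp
  · intro u v h
    rw [← YoungDiagram.mem_iff_lt_colLen]
    exact Γ.up_left_mem le_rfl (Nat.zero_le _) h

lemma sum_rowLens (Γ : YoungDiagram) : Γ.rowLens.sum = Γ.card := by
  rw [← stY_one, stY, sum_cells Γ (Γ.colLen 0) ?_ (fun u v => 1)]
  · simp [YoungDiagram.rowLens, Finset.sum, Finset.range, Multiset.range]
  · intro u v h
    rw [← YoungDiagram.mem_iff_lt_colLen]
    exact Γ.up_left_mem le_rfl (Nat.zero_le _) h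

lemma sum_part {M : Type*} [AddCommMonoid M] (n : ℕ) (φ : ℕ → M) :
    ∑ Γ ∈ YD n, φ Γ.rowLens.length = ∑ ν : Nat.Partition n, φ ν.parts.card := by
  apply Finset.sum_bij (fun Γ hΓ => (⟨(Γ.rowLens : Multiset ℕ),
    fun {i} hi => Γ.pos_of_mem_rowLens i hi, by
      rw [Multiset.sum_coe, sum_rowLens]; exact mem_YD.1 hΓ⟩ : Nat.Partition n))
  · intros; simp
  · intro a _ b _ h
    have h1 := congrArg Nat.Partition.parts h
    simp only [Multiset.coe_eq_coe] at h1
    have h2 := h1.eq_of_sortedGE a.rowLens_sorted b.rowLens_sorted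
    apply YoungDiagram.equivListRowLens.injective
    exact Subtype.ext h2
  · intro ν _
    have hs : (ν.parts.sort (· ≥ ·)).SortedGE := (Multiset.pairwise_sort ν.parts (· ≥ ·)).sortedGE
    have hp : ∀ x ∈ ν.parts.sort (· ≥ ·), 0 < x := by
      intro x hx; exact ν.parts_pos (by simpa using hx)
    have h1 := YoungDiagram.rowLens_ofRowLens_eq_self (hw := hs) hp
    have h2 : ((YoungDiagram.ofRowLens _ hs).rowLens : Multiset ℕ) = ν.parts := by
      rw [h1]; exact Multiset.sort_eq _ _
    refine ⟨YoungDiagram.ofRowLens _ hs, ?_, ?_⟩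
    · rw [mem_YD, ← sum_rowLens, ← Multiset.sum_coe, h2, ν.parts_sum]
    · exact Nat.Partition.ext h2
  · intro Γ _
    simp

/-- number of boxes with hook difference 0 or 1 -/
def st01 (Γ : YoungDiagram) : ℕ := stY (fun a l => if a = l ∨ a = l + 1 then 1 else 0) Γ

theorem sum_st01 (n : ℕ) (φ : ℕ → ℤ[X]) :
    ∑ Γ ∈ YD n, φ (st01 Γ) = ∑ ν : Nat.Partition n, φ ν.parts.card := by
  have h1 := LW_main n
  simp only [stY_leg] at h1
  rw [sum_part n (fun j => (X : ℤ[X]) ^ j)] at h1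
  have hl : ∀ (ι : Type) (s : Finset ι) (g : ι → ℕ),
      (∑ i ∈ s, (X : ℤ[X]) ^ g i).sum (fun j c => C c * φ j) = ∑ i ∈ s, φ (g i) := by
    intro ι s g
    classical
    induction s using Finset.induction with
    | empty => simp
    | insert a s ha ih =>
      rw [Finset.sum_insert ha, Finset.sum_insert ha, Polynomial.sum_add_index, ih]
      · rw [← Polynomial.monomial_one_right_eq_X_pow, Polynomial.sum_monomial_index] <;> simp
      · intro i; simp
      · intro i a b; simp [add_mul]
  have h2 := congrArg (fun p : ℤ[X] => p.sum (fun j c => C c * φ j)) h1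
  simp only [hl] at h2
  exact h2

end LW

namespace LW

/-- the box `(u,v)` can be added -/
def isAdd (Γ : YoungDiagram) (u v : ℕ) : Prop := Γ.colLen v = u ∧ Γ.rowLen u = v
/-- the box `(u,v)` can be removed -/
def isRem (Γ : YoungDiagram) (u v : ℕ) : Prop := Γ.colLen v = u + 1 ∧ Γ.rowLen u = v + 1

instance (Γ : YoungDiagram) (u v : ℕ) : Decidable (isAdd Γ u v) := by unfold isAdd; infer_instance
instance (Γ : YoungDiagram) (u v : ℕ) : Decidable (isRem Γ u v) := by unfold isRem; infer_instance

lemma mem_iff_row_col (Γ : YoungDiagram) (u v : ℕ) : v < Γ.rowLen u ↔ u < Γ.colLen v := by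
  rw [← YoungDiagram.mem_iff_lt_rowLen, YoungDiagram.mem_iff_lt_colLen]

/-- addable boxes -/
def addS (Γ : YoungDiagram) : Finset (ℕ × ℕ) :=
  (Finset.range (Γ.card + 1) ×ˢ Finset.range (Γ.card + 1)).filter (fun b => isAdd Γ b.1 b.2)
/-- removable boxes -/
def remS (Γ : YoungDiagram) : Finset (ℕ × ℕ) := Γ.cells.filter (fun b => isRem Γ b.1 b.2)

lemma mem_addS {Γ : YoungDiagram} {u v : ℕ} : (u, v) ∈ addS Γ ↔ isAdd Γ u v := by
  simp only [addS, Finset.mem_filter, Finset.mem_product, Finset.mem_range, and_iff_right_iff_imp]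
  rintro ⟨h1, h2⟩
  have := rowLen_le_card Γ u
  have := colLen_le_card Γ v
  omega

lemma mem_remS {Γ : YoungDiagram} {u v : ℕ} : (u, v) ∈ remS Γ ↔ isRem Γ u v := by
  simp only [remS, Finset.mem_filter, and_iff_right_iff_imp]
  rintro ⟨h1, h2⟩
  rw [YoungDiagram.mem_cells, YoungDiagram.mem_iff_lt_rowLen]
  omega

/-- number of rows `v < m` with `R v = k` -/
def aa (Γ : YoungDiagram) (k m : ℕ) : ℕ := ((Finset.range m).filter (fun v => Γ.colLen v + v = k)).card
/-- number of columns `u < m` with `C u = k - 1` -/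
def cc (Γ : YoungDiagram) (k m : ℕ) : ℕ := ((Finset.range m).filter (fun u => Γ.rowLen u + u + 1 = k)).card

lemma aa_succ (Γ : YoungDiagram) (k m : ℕ) :
    aa Γ k (m + 1) = aa Γ k m + if Γ.colLen m + m = k then 1 else 0 := by
  unfold aa
  rw [Finset.range_add_one, Finset.filter_insert]
  split_ifs with h
  · rw [Finset.card_insert_of_notMem (by simp)]
  · rfl

lemma cc_succ (Γ : YoungDiagram) (k m : ℕ) :
    cc Γ k (m + 1) = cc Γ k m + if Γ.rowLen m + m + 1 = k then 1 else 0 := by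
  unfold cc
  rw [Finset.range_add_one, Finset.filter_insert]
  split_ifs with h
  · rw [Finset.card_insert_of_notMem (by simp)]
  · rfl

/-- weight at the `t`-th point of the `k`-th antidiagonal -/
def Phi (Γ : YoungDiagram) (k t : ℕ) : ℕ := aa Γ k (k - t) + cc Γ k t
/-- interpolating weight -/
def Psi (Γ : YoungDiagram) (k t : ℕ) : ℕ := aa Γ k (k + 1 - t) + cc Γ k (t - 1)
  + if 1 ≤ t ∧ t ≤ k ∧ Γ.rowLen (t - 1) ≤ k - t then 1 else 0

/-- sum of an arithmetic function -/
noncomputable def Gs (φ : ℕ → ℤ[X]) (m : ℕ) : ℤ[X] := ∑ i ∈ Finset.range m, φ i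

/-- difference of the add and remove contributions at a point -/
noncomputable def Dd (Γ : YoungDiagram) (φ : ℕ → ℤ[X]) (k t : ℕ) : ℤ[X] :=
  (if isAdd Γ t (k - t) then φ (Phi Γ k t) else 0)
    - (if 1 ≤ t ∧ t < k ∧ isRem Γ (t - 1) (k - t - 1) then φ (Phi Γ k t) else 0)

lemma step (Γ : YoungDiagram) (φ : ℕ → ℤ[X]) (k t : ℕ) (ht : t ≤ k) :
    Gs φ (Psi Γ k t) - Gs φ (Psi Γ k (t + 1)) = Dd Γ φ k t := by
  have hX : Psi Γ k t = Phi Γ k t + ((if Γ.colLen (k - t) = t then 1 else 0) +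
      (if 1 ≤ t ∧ Γ.rowLen (t - 1) < k - t then 1 else 0)) := by
    unfold Psi Phi
    have e1 : k + 1 - t = (k - t) + 1 := by omega
    rw [e1, aa_succ]
    rcases t with _ | t
    · simp [cc]
    · have e2 : t + 1 - 1 = t := by omega
      rw [e2, cc_succ]
      split_ifs <;> omega
  have hY : Psi Γ k (t + 1) = Phi Γ k t + (if t < k ∧ Γ.rowLen t < k - t then 1 else 0) := by
    unfold Psi Phi
    have e1 : k + 1 - (t + 1) = k - t := by omega
    have e2 : t + 1 - 1 = t := by omega
    rw [e1, e2]
    split_ifs <;> omega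
  have m1 := mem_iff_row_col Γ t (k - t)
  have m2 := mem_iff_row_col Γ (t - 1) (k - t)
  have m3 := mem_iff_row_col Γ t (k - t - 1)
  have m4 := mem_iff_row_col Γ (t - 1) (k - t - 1)
  have a1 := Γ.rowLen_anti (t - 1) t (by omega)
  have a2 := Γ.colLen_anti (k - t - 1) (k - t) (by omega)
  have key : ((if Γ.colLen (k - t) = t then 1 else 0) +
      (if 1 ≤ t ∧ Γ.rowLen (t - 1) < k - t then 1 else 0) : ℕ)
        = (if isAdd Γ t (k - t) then 1 else 0) +
          (if (Γ.colLen (k - t) = t ∧ ¬ Γ.rowLen t = k - t) ∨ (1 ≤ t ∧ Γ.rowLen (t - 1) < k - t) then 1 else 0)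
      ∧ ((if t < k ∧ Γ.rowLen t < k - t then 1 else 0) : ℕ)
        = (if 1 ≤ t ∧ t < k ∧ isRem Γ (t - 1) (k - t - 1) then 1 else 0) +
          (if (Γ.colLen (k - t) = t ∧ ¬ Γ.rowLen t = k - t) ∨ (1 ≤ t ∧ Γ.rowLen (t - 1) < k - t) then 1 else 0)
      ∧ ¬ (isAdd Γ t (k - t) ∧ 1 ≤ t ∧ t < k ∧ isRem Γ (t - 1) (k - t - 1))
      ∧ (((Γ.colLen (k - t) = t ∧ ¬ Γ.rowLen t = k - t) ∨ (1 ≤ t ∧ Γ.rowLen (t - 1) < k - t)) →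
        ¬ isAdd Γ t (k - t) ∧ ¬ (1 ≤ t ∧ t < k ∧ isRem Γ (t - 1) (k - t - 1))) := by
    clear hX hY
    refine ⟨?_, ?_, ?_, ?_⟩
    · split_ifs <;> simp only [isAdd, isRem] at * <;> omega
    · split_ifs <;> simp only [isAdd, isRem] at * <;> omega
    · simp only [isAdd, isRem] at *; omega
    · simp only [isAdd, isRem] at *; omega
  obtain ⟨k1, k2, k3, k4⟩ := key
  rw [hX, hY, k1, k2]
  unfold Dd
  by_cases c : (Γ.colLen (k - t) = t ∧ ¬ Γ.rowLen t = k - t) ∨ (1 ≤ t ∧ Γ.rowLen (t - 1) < k - t)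
  · obtain ⟨c1, c2⟩ := k4 c
    rw [if_neg c1, if_neg c1, if_neg c2, if_neg c2]; ring
  · rw [if_neg c]
    by_cases c1 : isAdd Γ t (k - t)
    · have c2 : ¬ (1 ≤ t ∧ t < k ∧ isRem Γ (t - 1) (k - t - 1)) := fun h => k3 ⟨c1, h⟩
      rw [if_pos c1, if_pos c1, if_neg c2, if_neg c2]
      simp [Gs, Finset.sum_range_succ]
    · rw [if_neg c1, if_neg c1]
      split_ifs
      · simp [Gs, Finset.sum_range_succ]
      · simp

lemma step_sum (Γ : YoungDiagram) (φ : ℕ → ℤ[X]) (k m : ℕ) (hm : m ≤ k + 1) :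
    ∑ t ∈ Finset.range m, Dd Γ φ k t = Gs φ (Psi Γ k 0) - Gs φ (Psi Γ k m) := by
  induction m with
  | zero => simp
  | succ m ih =>
    rw [Finset.sum_range_succ, ih (by omega), ← step Γ φ k m (by omega)]; ring

lemma sum_range_ite_lt_eq (k : ℕ) (p q : ℕ → Prop) [DecidablePred p] [DecidablePred q]
    (h : ∀ i, i < k → (p i ↔ q (k - 1 - i))) :
    ((Finset.range k).filter p).card = ((Finset.range k).filter q).card := by
  apply Finset.card_bij (fun i _ => k - 1 - i)
  · intro i hi
    simp only [Finset.mem_filter, Finset.mem_range] at hi ⊢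
    exact ⟨by omega, (h i hi.1).1 hi.2⟩
  · intro i hi j hj hij
    simp only [Finset.mem_filter, Finset.mem_range] at hi hj
    omega
  · intro j hj
    simp only [Finset.mem_filter, Finset.mem_range] at hj
    refine ⟨k - 1 - j, ?_, by omega⟩
    simp only [Finset.mem_filter, Finset.mem_range]
    refine ⟨by omega, (h _ (by omega)).2 ?_⟩
    rw [show k - 1 - (k - 1 - j) = j by omega]; exact hj.2

lemma card_split (k : ℕ) (f : ℕ → ℕ) :
    ((Finset.range (k + 1)).filter (fun v => f v + v = k)).card
      + ((Finset.range (k + 1)).filter (fun v => k - v < f v)).card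
      = 1 + ((Finset.range k).filter (fun v => k - 1 - v < f v)).card := by
  have h1 : ((Finset.range (k + 1)).filter (fun v => f v + v = k)).card
      + ((Finset.range (k + 1)).filter (fun v => k - v < f v)).card
      = ((Finset.range (k + 1)).filter (fun v => k - v ≤ f v)).card := by
    rw [← Finset.card_union_of_disjoint]
    · congr 1
      ext v
      simp only [Finset.mem_union, Finset.mem_filter, Finset.mem_range]
      omega
    · rw [Finset.disjoint_left]
      intro v
      simp only [Finset.mem_filter, Finset.mem_range]
      omega
  rw [h1, Finset.range_add_one, Finset.filter_insert, if_pos (by omega),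
    Finset.card_insert_of_notMem (by simp), add_comm]
  congr 2
  apply Finset.filter_congr
  intro v hv
  rw [Finset.mem_range] at hv
  omega

lemma aa_eq_cc (Γ : YoungDiagram) (k : ℕ) : aa Γ k (k + 1) = cc Γ (k + 1) (k + 1) := by
  have h1 := card_split k Γ.colLen
  have h2 := card_split k Γ.rowLen
  have h3 : ∀ j, ((Finset.range j).filter (fun v => j - 1 - v < Γ.colLen v)).card
      = ((Finset.range j).filter (fun v => j - 1 - v < Γ.rowLen v)).card := by
    intro j
    apply sum_range_ite_lt_eq
    intro i hi
    rw [← mem_iff_row_col, show j - 1 - (j - 1 - i) = i by omega]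
  have h4 := h3 k
  have h5 := h3 (k + 1)
  simp only [Nat.add_sub_cancel] at h5
  unfold aa cc
  simp only [Nat.add_right_cancel_iff]
  omega

lemma Psi_zero (Γ : YoungDiagram) (k : ℕ) : Psi Γ k 0 = aa Γ k (k + 1) := by
  simp [Psi, cc]
lemma Psi_last (Γ : YoungDiagram) (k : ℕ) : Psi Γ k (k + 1) = cc Γ k k := by
  simp [Psi, aa]

lemma level_sum (Γ : YoungDiagram) (φ : ℕ → ℤ[X]) (K : ℕ) :
    ∑ k ∈ Finset.range K, ∑ t ∈ Finset.range (k + 1), Dd Γ φ k t = Gs φ (cc Γ K K) := by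
  induction K with
  | zero => simp [cc, Gs]
  | succ K ih =>
    rw [Finset.sum_range_succ, ih, step_sum Γ φ K (K + 1) le_rfl, Psi_zero, Psi_last, aa_eq_cc]
    ring

lemma cc_large (Γ : YoungDiagram) (K : ℕ) (hK : 2 * Γ.card + 2 ≤ K) : cc Γ K K = 1 := by
  unfold cc
  rw [Finset.card_eq_one]
  refine ⟨K - 1, ?_⟩
  ext u
  simp only [Finset.mem_filter, Finset.mem_range, Finset.mem_singleton]
  have h1 := rowLen_le_card Γ u
  have h2 := mem_iff_row_col Γ u 0
  have h3 := colLen_le_card Γ 0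
  constructor
  · rintro ⟨a, b⟩
    omega
  · intro h
    omega

lemma sumAdd (Γ : YoungDiagram) (K : ℕ) (hK : 2 * Γ.card + 2 ≤ K) (F : ℕ → ℕ → ℤ[X]) :
    ∑ k ∈ Finset.range K, ∑ t ∈ Finset.range (k + 1), (if isAdd Γ t (k - t) then F k t else 0)
      = ∑ b ∈ addS Γ, F (b.1 + b.2) b.1 := by
  rw [Finset.sum_sigma', ← Finset.sum_filter]
  apply Finset.sum_bij' (fun x _ => (x.2, x.1 - x.2)) (fun b _ => (⟨b.1 + b.2, b.1⟩ : (_ : ℕ) × ℕ))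
  · rintro ⟨k, t⟩ h
    simp only [Finset.mem_filter, Finset.mem_sigma, Finset.mem_range] at h
    rw [mem_addS]; exact h.2
  · rintro ⟨u, v⟩ h
    have h' := mem_addS.1 h
    simp only [addS, Finset.mem_filter, Finset.mem_product, Finset.mem_range] at h
    simp only [Finset.mem_filter, Finset.mem_sigma, Finset.mem_range]
    refine ⟨⟨by omega, by omega⟩, ?_⟩
    simpa using h'
  · rintro ⟨k, t⟩ h
    simp only [Finset.mem_filter, Finset.mem_sigma, Finset.mem_range] at h
    simp; omega
  · rintro ⟨u, v⟩ h
    simp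
  · rintro ⟨k, t⟩ h
    simp only [Finset.mem_filter, Finset.mem_sigma, Finset.mem_range] at h
    simp only
    rw [show t + (k - t) = k by omega]

lemma sumRem (Γ : YoungDiagram) (K : ℕ) (hK : 2 * Γ.card + 2 ≤ K) (F : ℕ → ℕ → ℤ[X]) :
    ∑ k ∈ Finset.range K, ∑ t ∈ Finset.range (k + 1),
      (if 1 ≤ t ∧ t < k ∧ isRem Γ (t - 1) (k - t - 1) then F k t else 0)
      = ∑ b ∈ remS Γ, F (b.1 + b.2 + 2) (b.1 + 1) := by
  rw [Finset.sum_sigma', ← Finset.sum_filter]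
  refine Finset.sum_bij' (fun x _ => (x.2 - 1, x.1 - x.2 - 1))
    (fun b _ => (⟨b.1 + b.2 + 2, b.1 + 1⟩ : (_ : ℕ) × ℕ)) ?_ ?_ ?_ ?_ ?_
  · rintro ⟨k, t⟩ h
    simp only [Finset.mem_filter, Finset.mem_sigma, Finset.mem_range] at h
    rw [mem_remS]; exact h.2.2.2
  · rintro ⟨u, v⟩ h
    have h' := mem_remS.1 h
    have h1 := rowLen_le_card Γ u
    have h2 := colLen_le_card Γ v
    obtain ⟨h3, h4⟩ := h'
    simp only [Finset.mem_filter, Finset.mem_sigma, Finset.mem_range]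
    refine ⟨⟨by omega, by omega⟩, by omega, by omega, ?_⟩
    rw [show u + 1 - 1 = u by omega, show u + v + 2 - (u + 1) - 1 = v by omega]
    exact ⟨h3, h4⟩
  · rintro ⟨k, t⟩ h
    simp only [Finset.mem_filter, Finset.mem_sigma, Finset.mem_range] at h
    simp; omega
  · rintro ⟨u, v⟩ h
    simp; omega
  · rintro ⟨k, t⟩ h
    simp only [Finset.mem_filter, Finset.mem_sigma, Finset.mem_range] at h
    simp only
    rw [show t - 1 + (k - t - 1) + 2 = k by omega, show t - 1 + 1 = t by omega]

/-- weight of an addable box -/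
def wA (Γ : YoungDiagram) (b : ℕ × ℕ) : ℕ := Phi Γ (b.1 + b.2) b.1
/-- weight of a removable box -/
def wR (Γ : YoungDiagram) (b : ℕ × ℕ) : ℕ := Phi Γ (b.1 + b.2 + 2) (b.1 + 1)

/-- part (i) -/
theorem add_rem (Γ : YoungDiagram) (φ : ℕ → ℤ[X]) :
    ∑ b ∈ addS Γ, φ (wA Γ b) = φ 0 + ∑ c ∈ remS Γ, φ (wR Γ c) := by
  have h := level_sum Γ φ (2 * Γ.card + 2)
  rw [cc_large Γ _ le_rfl] at h
  simp only [Dd, Finset.sum_sub_distrib] at h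
  rw [sumAdd Γ _ le_rfl (fun k t => φ (Phi Γ k t)), sumRem Γ _ le_rfl (fun k t => φ (Phi Γ k t))] at h
  simp only [Gs, Finset.range_one, Finset.sum_singleton] at h
  unfold wA wR
  linear_combination h

/-- region of the shifted points -/
def reg (b : ℕ × ℕ) (k t : ℕ) : Prop := b.1 + b.2 + 2 < k ∨ (k = b.1 + b.2 + 2 ∧ t ≤ b.1 + 1)

instance (b : ℕ × ℕ) (k t : ℕ) : Decidable (reg b k t) := by unfold reg; infer_instance

lemma Gs_geom (m : ℕ) : (X - 1) * Gs (fun i => (X : ℤ[X]) ^ i) m = X ^ m - 1 := by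
  unfold Gs
  exact mul_geom_sum X m

lemma reg_sum (Γ : YoungDiagram) (b : ℕ × ℕ) (hb : b ∈ remS Γ) (φ : ℕ → ℤ[X]) :
    ∑ k ∈ Finset.range (2 * Γ.card + 2), ∑ t ∈ Finset.range (k + 1),
      (if reg b k t then Dd Γ φ k t else 0) = Gs φ 1 - Gs φ (wR Γ b + 1) := by
  obtain ⟨u, v⟩ := b
  obtain ⟨h1, h2⟩ := mem_remS.1 hb
  have c1 := rowLen_le_card Γ u
  have c2 := colLen_le_card Γ v
  set K0 := u + v + 2 with hK0
  obtain ⟨d, hd⟩ : ∃ d, 2 * Γ.card + 2 = K0 + 1 + d := ⟨2 * Γ.card + 2 - K0 - 1, by omega⟩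
  have htot := level_sum Γ φ (2 * Γ.card + 2)
  have hlow := level_sum Γ φ (K0 + 1)
  rw [cc_large Γ _ le_rfl, hd, Finset.sum_range_add, hlow] at htot
  rw [hd, Finset.sum_range_add, Finset.sum_range_succ]
  have e1 : ∑ k ∈ Finset.range K0, ∑ t ∈ Finset.range (k + 1),
      (if reg (u, v) k t then Dd Γ φ k t else 0) = 0 := by
    apply Finset.sum_eq_zero; intro k hk
    apply Finset.sum_eq_zero; intro t ht
    rw [Finset.mem_range] at hk
    rw [if_neg]
    unfold reg; simp only; omega
  have e2 : ∑ k ∈ Finset.range d, ∑ t ∈ Finset.range (K0 + 1 + k + 1),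
      (if reg (u, v) (K0 + 1 + k) t then Dd Γ φ (K0 + 1 + k) t else 0)
      = ∑ k ∈ Finset.range d, ∑ t ∈ Finset.range (K0 + 1 + k + 1), Dd Γ φ (K0 + 1 + k) t := by
    apply Finset.sum_congr rfl; intro k hk
    apply Finset.sum_congr rfl; intro t ht
    rw [if_pos]
    unfold reg; simp only; omega
  have e3 : ∑ t ∈ Finset.range (K0 + 1), (if reg (u, v) K0 t then Dd Γ φ K0 t else 0)
      = Gs φ (Psi Γ K0 0) - Gs φ (Psi Γ K0 (u + 2)) := by
    rw [← Finset.sum_filter, ← step_sum Γ φ K0 (u + 2) (by omega)]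
    refine Finset.sum_congr ?_ (fun _ _ => rfl)
    ext t
    rw [Finset.mem_filter, Finset.mem_range, Finset.mem_range]
    unfold reg
    simp only
    omega
  have e4 : Psi Γ K0 (u + 2) = wR Γ (u, v) + 1 := by
    have m1 := mem_iff_row_col Γ (u + 1) v
    unfold Psi wR Phi
    simp only
    rw [if_pos]
    · congr 2; rw [← hK0]; congr 1; omega
    · rw [show u + 2 - 1 = u + 1 by omega]; omega
  rw [e1, e2, e3, e4, Psi_zero, aa_eq_cc]
  linear_combination htot

/-- the correction `δ` -/
def dl (b₁ b₂ : ℕ × ℕ) : ℕ := if b₁.1 + b₁.2 + 2 < b₂.1 + b₂.2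
          ∨ (b₂.1 + b₂.2 = b₁.1 + b₁.2 + 2 ∧ b₁.2 < b₂.2) then 1 else 0
/-- the correction for pairs of removable boxes -/
def dr (b c : ℕ × ℕ) : ℕ := if b.1 + b.2 < c.1 + c.2
          ∨ (c.1 + c.2 = b.1 + b.2 ∧ b.2 < c.2) then 1 else 0

/-- part (ii) -/
theorem add_rem_dl (Γ : YoungDiagram) (b : ℕ × ℕ) (hb : b ∈ remS Γ) :
    ∑ c ∈ addS Γ, (X : ℤ[X]) ^ (wA Γ c + dl b c)
      = (1 + X) + ∑ c ∈ (remS Γ).erase b, (X : ℤ[X]) ^ (wR Γ c + dr b c) := by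
  set φ : ℕ → ℤ[X] := fun i => X ^ i with hφ
  have hreg := reg_sum Γ b hb φ
  have htot := level_sum Γ φ (2 * Γ.card + 2)
  rw [cc_large Γ _ le_rfl] at htot
  have hsum : ∑ k ∈ Finset.range (2 * Γ.card + 2), ∑ t ∈ Finset.range (k + 1),
      (if reg b k t then X else 1) * Dd Γ φ k t
      = Gs φ 1 + (X - 1) * (Gs φ 1 - Gs φ (wR Γ b + 1)) := by
    rw [← hreg, ← htot, Finset.mul_sum, ← Finset.sum_add_distrib]
    apply Finset.sum_congr rfl; intro k _
    rw [Finset.mul_sum, ← Finset.sum_add_distrib]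
    apply Finset.sum_congr rfl; intro t _
    split_ifs <;> ring
  have hG : Gs φ 1 + (X - 1) * (Gs φ 1 - Gs φ (wR Γ b + 1)) = 1 + X - X * X ^ (wR Γ b) := by
    rw [mul_sub, Gs_geom, Gs_geom]
    simp [Gs, hφ]
    ring
  rw [hG] at hsum
  simp only [Dd, mul_sub, mul_ite, mul_zero, Finset.sum_sub_distrib] at hsum
  rw [sumAdd Γ _ le_rfl (fun k t => (if reg b k t then X else 1) * φ (Phi Γ k t)),
    sumRem Γ _ le_rfl (fun k t => (if reg b k t then X else 1) * φ (Phi Γ k t)),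
    ← Finset.add_sum_erase _ _ hb] at hsum
  have e1 : ∑ c ∈ addS Γ, (X : ℤ[X]) ^ (wA Γ c + dl b c)
      = ∑ c ∈ addS Γ, (if reg b (c.1 + c.2) c.1 then X else 1) * φ (Phi Γ (c.1 + c.2) c.1) := by
    apply Finset.sum_congr rfl
    rintro ⟨u, v⟩ _
    have : (b.1 + b.2 + 2 < u + v ∨ (u + v = b.1 + b.2 + 2 ∧ b.2 < v)) ↔ reg b (u + v) u := by
      unfold reg; omega
    unfold dl wA
    simp only [this, hφ]
    split_ifs <;> ring
  have e2 : ∑ c ∈ (remS Γ).erase b, (X : ℤ[X]) ^ (wR Γ c + dr b c)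
      = ∑ c ∈ (remS Γ).erase b, (if reg b (c.1 + c.2 + 2) (c.1 + 1) then X else 1)
          * φ (Phi Γ (c.1 + c.2 + 2) (c.1 + 1)) := by
    apply Finset.sum_congr rfl
    rintro ⟨u, v⟩ hc
    have hne : (u, v) ≠ b := Finset.ne_of_mem_erase hc
    have hne' : ¬ (u = b.1 ∧ v = b.2) := fun h => hne (Prod.ext h.1 h.2)
    have : (b.1 + b.2 < u + v ∨ (u + v = b.1 + b.2 ∧ b.2 < v)) ↔ reg b (u + v + 2) (u + 1) := by
      unfold reg; omega
    unfold dr wR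
    simp only [this, hφ]
    split_ifs <;> ring
  have e3 : (if reg b (b.1 + b.2 + 2) (b.1 + 1) then X else 1) * φ (Phi Γ (b.1 + b.2 + 2) (b.1 + 1))
      = X * X ^ (wR Γ b) := by
    rw [if_pos (by unfold reg; omega)]; rfl
  rw [e1, e2]
  rw [e3] at hsum
  linear_combination hsum

end LW

namespace LW

/-- `Γ'` is `Γ` with the box `(u,v)` added -/
structure Ins (Γ : YoungDiagram) (u v : ℕ) (Γ' : YoungDiagram) : Prop where
  notMem : (u, v) ∉ Γ
  cells : Γ'.cells = insert (u, v) Γ.cells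

lemma Ins.mem {Γ Γ' : YoungDiagram} {u v : ℕ} (h : Ins Γ u v Γ') (i j : ℕ) :
    (i, j) ∈ Γ' ↔ (i = u ∧ j = v) ∨ (i, j) ∈ Γ := by
  rw [← YoungDiagram.mem_cells, h.cells, Finset.mem_insert, YoungDiagram.mem_cells]
  simp

lemma Ins.row {Γ Γ' : YoungDiagram} {u v : ℕ} (h : Ins Γ u v Γ') : Γ.rowLen u = v := by
  have h1 := h.notMem
  rw [YoungDiagram.mem_iff_lt_rowLen] at h1
  by_contra hne
  have h2 : (u, v) ∈ Γ' := (h.mem u v).2 (Or.inl ⟨rfl, rfl⟩)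
  have h3 : (u, Γ.rowLen u) ∈ Γ' := Γ'.up_left_mem le_rfl (by omega) h2
  rw [h.mem, YoungDiagram.mem_iff_lt_rowLen] at h3
  omega

lemma Ins.col {Γ Γ' : YoungDiagram} {u v : ℕ} (h : Ins Γ u v Γ') : Γ.colLen v = u := by
  have h1 := h.notMem
  rw [YoungDiagram.mem_iff_lt_colLen] at h1
  by_contra hne
  have h2 : (u, v) ∈ Γ' := (h.mem u v).2 (Or.inl ⟨rfl, rfl⟩)
  have h3 : (Γ.colLen v, v) ∈ Γ' := Γ'.up_left_mem (by omega) le_rfl h2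
  rw [h.mem, YoungDiagram.mem_iff_lt_colLen] at h3
  omega

lemma eq_of_lt_iff {a b : ℕ} (h : ∀ j, j < a ↔ j < b) : a = b := by
  have h1 := h a
  have h2 := h b
  omega

lemma Ins.rowLen {Γ Γ' : YoungDiagram} {u v : ℕ} (h : Ins Γ u v Γ') (i : ℕ) :
    Γ'.rowLen i = Γ.rowLen i + if i = u then 1 else 0 := by
  apply eq_of_lt_iff
  intro j
  rw [← YoungDiagram.mem_iff_lt_rowLen, h.mem, YoungDiagram.mem_iff_lt_rowLen]
  have := h.row
  split_ifs with hi
  · subst hi; omega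
  · omega

lemma Ins.colLen {Γ Γ' : YoungDiagram} {u v : ℕ} (h : Ins Γ u v Γ') (j : ℕ) :
    Γ'.colLen j = Γ.colLen j + if j = v then 1 else 0 := by
  apply eq_of_lt_iff
  intro i
  rw [← YoungDiagram.mem_iff_lt_colLen, h.mem, YoungDiagram.mem_iff_lt_colLen]
  have := h.col
  split_ifs with hi
  · subst hi; omega
  · omega

lemma Ins.isAdd {Γ Γ' : YoungDiagram} {u v : ℕ} (h : Ins Γ u v Γ') : isAdd Γ u v := ⟨h.col, h.row⟩
lemma Ins.isRem {Γ Γ' : YoungDiagram} {u v : ℕ} (h : Ins Γ u v Γ') : isRem Γ' u v := by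
  refine ⟨?_, ?_⟩
  · rw [h.colLen, if_pos rfl, h.col]
  · rw [h.rowLen, if_pos rfl, h.row]

lemma Ins.card {Γ Γ' : YoungDiagram} {u v : ℕ} (h : Ins Γ u v Γ') : Γ'.card = Γ.card + 1 := by
  change Γ'.cells.card = Γ.cells.card + 1
  rw [h.cells, Finset.card_insert_of_notMem]
  rw [YoungDiagram.mem_cells]; exact h.notMem

lemma exists_ins {Γ : YoungDiagram} {u v : ℕ} (h : isAdd Γ u v) : ∃ Γ', Ins Γ u v Γ' := by
  obtain ⟨h1, h2⟩ := h
  refine ⟨⟨insert (u, v) Γ.cells, ?_⟩, ?_, rfl⟩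
  · rintro ⟨i, j⟩ ⟨i', j'⟩ hle hm
    simp only [Finset.coe_insert, Set.mem_insert_iff, Prod.mk.injEq, Finset.mem_coe,
      YoungDiagram.mem_cells] at hm ⊢
    obtain ⟨l1, l2⟩ := Prod.mk_le_mk.1 hle
    rcases hm with ⟨rfl, rfl⟩ | hm
    · by_cases e : i' = i
      · subst e
        rw [YoungDiagram.mem_iff_lt_rowLen]; omega
      · right
        rw [YoungDiagram.mem_iff_lt_colLen]
        have := Γ.colLen_anti _ _ l2
        omega
    · right
      exact Γ.up_left_mem l1 l2 hm
  · rw [YoungDiagram.mem_iff_lt_rowLen]; omega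

lemma exists_del {Γ : YoungDiagram} {u v : ℕ} (h : isRem Γ u v) : ∃ Γ', Ins Γ' u v Γ := by
  obtain ⟨h1, h2⟩ := h
  refine ⟨⟨Γ.cells.erase (u, v), ?_⟩, ?_, ?_⟩
  · rintro ⟨i, j⟩ ⟨i', j'⟩ hle hm
    simp only [Finset.coe_erase, Set.mem_sdiff, Finset.mem_coe, Set.mem_singleton_iff,
      YoungDiagram.mem_cells, Prod.mk.injEq] at hm ⊢
    obtain ⟨l1, l2⟩ := Prod.mk_le_mk.1 hle
    obtain ⟨hm, hn⟩ := hm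
    refine ⟨Γ.up_left_mem l1 l2 hm, ?_⟩
    rintro ⟨rfl, rfl⟩
    have h3 := Γ.up_left_mem le_rfl l2 hm
    have h4 := Γ.up_left_mem l1 le_rfl hm
    rw [YoungDiagram.mem_iff_lt_colLen] at h4
    have h5 := Γ.colLen_anti _ _ l2
    have h6 := Γ.rowLen_anti _ _ l1
    rw [YoungDiagram.mem_iff_lt_rowLen] at hm
    have h7 := Γ.up_left_mem le_rfl l2 (YoungDiagram.mem_iff_lt_rowLen.2 hm)
    rw [YoungDiagram.mem_iff_lt_colLen] at h7
    omega
  · rw [← YoungDiagram.mem_cells]; simp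
  · simp only
    rw [Finset.insert_erase]
    rw [YoungDiagram.mem_cells, YoungDiagram.mem_iff_lt_rowLen]; omega

lemma Ins.unique {Γ Γ' Γ'' : YoungDiagram} {u v : ℕ} (h : Ins Γ u v Γ') (h' : Ins Γ u v Γ'') : Γ' = Γ'' := by
  ext c
  rw [h.cells, h'.cells]

lemma Ins.unique' {Γ Γ' Γ'' : YoungDiagram} {u v : ℕ} (h : Ins Γ u v Γ'') (h' : Ins Γ' u v Γ'') : Γ = Γ' := by
  have e : insert (u, v) Γ.cells = insert (u, v) Γ'.cells := by rw [← h.cells, ← h'.cells]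
  have e2 := congrArg (fun s => Finset.erase s (u, v)) e
  rw [Finset.erase_insert, Finset.erase_insert] at e2
  · ext c; rw [e2]
  · rw [YoungDiagram.mem_cells]; exact h'.notMem
  · rw [YoungDiagram.mem_cells]; exact h.notMem

lemma Ins.aa {Γ Γ' : YoungDiagram} {u v : ℕ} (h : Ins Γ u v Γ') (k m : ℕ) :
    aa Γ' k m + (if v < m ∧ u + v = k then 1 else 0) = aa Γ k m + if v < m ∧ u + v + 1 = k then 1 else 0 := by
  induction m with
  | zero => simp [LW.aa]
  | succ m ih =>
    have hc := h.col
    rw [aa_succ, aa_succ, h.colLen]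
    by_cases e : m = v
    · subst e
      simp only [lt_irrefl, false_and, if_false, add_zero, Nat.lt_succ_self, true_and, if_true] at ih ⊢
      rw [ih]
      split_ifs <;> omega
    · rw [if_neg e]
      split_ifs at ih ⊢ <;> omega

lemma Ins.cc {Γ Γ' : YoungDiagram} {u v : ℕ} (h : Ins Γ u v Γ') (k m : ℕ) :
    cc Γ' k m + (if u < m ∧ u + v + 1 = k then 1 else 0) = cc Γ k m + if u < m ∧ u + v + 2 = k then 1 else 0 := by
  induction m with
  | zero => simp [LW.cc]
  | succ m ih =>
    have hc := h.row
    rw [cc_succ, cc_succ, h.rowLen]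
    by_cases e : m = u
    · subst e
      simp only [lt_irrefl, false_and, if_false, add_zero, Nat.lt_succ_self, true_and, if_true] at ih ⊢
      rw [ih]
      split_ifs <;> omega
    · rw [if_neg e]
      split_ifs at ih ⊢ <;> omega

lemma wR_eq {Γ Γ' : YoungDiagram} {u v : ℕ} (h : Ins Γ u v Γ') :
    wR Γ' (u, v) = 1 + aa Γ (u + v + 2) v + cc Γ (u + v + 2) u := by
  have h1 := h.aa (u + v + 2) v
  have h2 := h.cc (u + v + 2) u
  have hc := h.isRem
  obtain ⟨hc1, hc2⟩ := hc
  unfold wR Phi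
  simp only
  rw [show u + v + 2 - (u + 1) = v + 1 by omega, aa_succ, cc_succ, hc1, hc2]
  simp at h1 h2
  split_ifs <;> omega

lemma wA_eq (Γ : YoungDiagram) (u v : ℕ) :
    wA Γ (u, v) = aa Γ (u + v) v + cc Γ (u + v) u := by
  unfold wA Phi
  simp

/-- part (iv) -/
lemma swap_four {Γ Γb Γc Γ' : YoungDiagram} {u v u' v' : ℕ} (hb : Ins Γ u v Γb) (hc : Ins Γ u' v' Γc)
    (hb' : Ins Γc u v Γ') (hc' : Ins Γb u' v' Γ') :
    wA Γc (u, v) + wR Γ' (u', v') = wA Γ (u, v) + wR Γc (u', v') := by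
  rw [wA_eq, wA_eq, wR_eq hc', wR_eq hc]
  have h1 := hc.aa (u + v) v
  have h2 := hc.cc (u + v) u
  have h3 := hb.aa (u' + v' + 2) v'
  have h4 := hb.cc (u' + v' + 2) u'
  have a1 := hb.row
  have a2 := hb.col
  have b1 := hc.row
  have b2 := hc.col
  have c1 := hb'.row
  have c2 := hb'.col
  rw [hc.rowLen] at c1
  rw [hc.colLen] at c2
  have d1 := Γ.rowLen_anti u u'
  have d2 := Γ.rowLen_anti u' u
  have d3 := Γ.colLen_anti v v'
  have d4 := Γ.colLen_anti v' v
  have ne1 : u ≠ u' := by rintro rfl; rw [if_pos rfl] at c1; omega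
  have ne2 : v ≠ v' := by rintro rfl; rw [if_pos rfl] at c2; omega
  rcases lt_or_gt_of_ne ne1 with hu | hu
  · have hv : v' < v := by have := d1 hu.le; omega
    split_ifs at h1 h2 h3 h4 <;> omega
  · have hv : v < v' := by have := d2 hu.le; omega
    split_ifs at h1 h2 h3 h4 <;> omega

lemma sum_row {M : Type*} [AddCommMonoid M] (Γ : YoungDiagram) (u : ℕ) (f : ℕ → M) :
    (∑ c ∈ Γ.cells, if c.1 = u then f c.2 else 0) = ∑ v ∈ Finset.range (Γ.rowLen u), f v := by
  rw [← Finset.sum_filter]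
  refine Finset.sum_bij' (fun c _ => c.2) (fun v _ => (u, v)) ?_ ?_ ?_ ?_ ?_
  · rintro ⟨i, j⟩ hc
    simp only [Finset.mem_filter, YoungDiagram.mem_cells, YoungDiagram.mem_iff_lt_rowLen] at hc
    simp only [Finset.mem_range]
    rw [← hc.2]; exact hc.1
  · intro v hv
    simp only [Finset.mem_filter, YoungDiagram.mem_cells, YoungDiagram.mem_iff_lt_rowLen]
    exact ⟨Finset.mem_range.1 hv, trivial⟩
  · rintro ⟨i, j⟩ hc
    simp only [Finset.mem_filter] at hc
    simp [hc.2]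
  · intro v hv; rfl
  · intro c hc; rfl

lemma sum_col {M : Type*} [AddCommMonoid M] (Γ : YoungDiagram) (v : ℕ) (f : ℕ → M) :
    (∑ c ∈ Γ.cells, if c.2 = v then f c.1 else 0) = ∑ u ∈ Finset.range (Γ.colLen v), f u := by
  rw [← Finset.sum_filter]
  refine Finset.sum_bij' (fun c _ => c.1) (fun u _ => (u, v)) ?_ ?_ ?_ ?_ ?_
  · rintro ⟨i, j⟩ hc
    simp only [Finset.mem_filter, YoungDiagram.mem_cells, YoungDiagram.mem_iff_lt_colLen] at hc
    simp only [Finset.mem_range]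
    rw [← hc.2]; exact hc.1
  · intro v hv
    simp only [Finset.mem_filter, YoungDiagram.mem_cells, YoungDiagram.mem_iff_lt_colLen]
    exact ⟨Finset.mem_range.1 hv, trivial⟩
  · rintro ⟨i, j⟩ hc
    simp only [Finset.mem_filter] at hc
    simp [hc.2]
  · intro v hv; rfl
  · intro c hc; rfl

lemma aa_sum (Γ : YoungDiagram) (k m : ℕ) :
    aa Γ k m = ∑ v ∈ Finset.range m, if Γ.colLen v + v = k then 1 else 0 := by
  unfold aa; rw [Finset.card_filter]
lemma cc_sum (Γ : YoungDiagram) (k m : ℕ) :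
    cc Γ k m = ∑ v ∈ Finset.range m, if Γ.rowLen v + v + 1 = k then 1 else 0 := by
  unfold cc; rw [Finset.card_filter]

lemma aa_cells {Γ : YoungDiagram} {u v : ℕ} (h : isAdd Γ u v) (k : ℕ) :
    aa Γ k v = ∑ c ∈ Γ.cells, if c.1 = u then (if Γ.colLen c.2 + c.2 = k then 1 else 0) else 0 := by
  rw [sum_row Γ u (fun j => if Γ.colLen j + j = k then 1 else 0), h.2, aa_sum]
lemma cc_cells {Γ : YoungDiagram} {u v : ℕ} (h : isAdd Γ u v) (k : ℕ) :
    cc Γ k u = ∑ c ∈ Γ.cells, if c.2 = v then (if Γ.rowLen c.1 + c.1 + 1 = k then 1 else 0) else 0 := by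
  rw [sum_col Γ v (fun j => if Γ.rowLen j + j + 1 = k then 1 else 0), h.1, cc_sum]

lemma st01_sum (Γ : YoungDiagram) : st01 Γ = ∑ c ∈ Γ.cells,
    if Γ.colLen c.2 + c.2 = Γ.rowLen c.1 + c.1 ∨ Γ.colLen c.2 + c.2 = Γ.rowLen c.1 + c.1 + 1 then 1 else 0 := by
  unfold st01 stY
  apply Finset.sum_congr rfl
  rintro ⟨i, j⟩ hc
  have h1 := hc
  rw [YoungDiagram.mem_cells, YoungDiagram.mem_iff_lt_rowLen] at hc
  rw [YoungDiagram.mem_cells, YoungDiagram.mem_iff_lt_colLen] at h1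
  simp only
  split_ifs <;> omega

/-- part (iii) -/
lemma ins_st {Γ Γ' : YoungDiagram} {u v : ℕ} (h : Ins Γ u v Γ') :
    st01 Γ' + wA Γ (u, v) = st01 Γ + wR Γ' (u, v) := by
  rw [wA_eq, wR_eq h, aa_cells h.isAdd, aa_cells h.isAdd, cc_cells h.isAdd, cc_cells h.isAdd,
    st01_sum, st01_sum, h.cells, Finset.sum_insert (by rw [YoungDiagram.mem_cells]; exact h.notMem)]
  rw [if_pos (by left; simp only; rw [h.colLen, h.rowLen, if_pos rfl, if_pos rfl, h.col, h.row]; omega)]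
  have key : ∀ c ∈ Γ.cells,
      (if Γ'.colLen c.2 + c.2 = Γ'.rowLen c.1 + c.1 ∨ Γ'.colLen c.2 + c.2 = Γ'.rowLen c.1 + c.1 + 1 then 1 else 0)
      + ((if c.1 = u then (if Γ.colLen c.2 + c.2 = u + v then 1 else 0) else 0)
      + (if c.2 = v then (if Γ.rowLen c.1 + c.1 + 1 = u + v then 1 else 0) else 0))
      = (if Γ.colLen c.2 + c.2 = Γ.rowLen c.1 + c.1 ∨ Γ.colLen c.2 + c.2 = Γ.rowLen c.1 + c.1 + 1 then 1 else 0)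
      + ((if c.1 = u then (if Γ.colLen c.2 + c.2 = u + v + 2 then 1 else 0) else 0)
      + (if c.2 = v then (if Γ.rowLen c.1 + c.1 + 1 = u + v + 2 then 1 else 0) else 0)) := by
    rintro ⟨i, j⟩ hc
    simp only
    have hn : ¬ (i = u ∧ j = v) := by
      rintro ⟨rfl, rfl⟩
      exact h.notMem hc
    have hr := h.row
    have hc := h.col
    rw [h.rowLen, h.colLen]
    by_cases e1 : i = u
    · subst e1
      have e2 : ¬ j = v := by tauto
      simp only [if_true, e2, if_false]
      split_ifs <;> omega
    · by_cases e2 : j = v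
      · subst e2
        simp only [if_true, e1, if_false]
        split_ifs <;> omega
      · simp only [e1, e2, if_false]
        rfl
  have := Finset.sum_congr rfl key
  simp only [Finset.sum_add_distrib] at this
  omega

end LW

namespace LW

lemma st01_le (Γ : YoungDiagram) : st01 Γ ≤ Γ.card := by
  rw [st01_sum]
  calc _ ≤ ∑ c ∈ Γ.cells, 1 := Finset.sum_le_sum (fun c _ => by split_ifs <;> omega)
    _ = Γ.card := by simp [YoungDiagram.card]

/-- number of boxes with hook difference not 0 or 1 -/
def posY (Γ : YoungDiagram) : ℕ := Γ.card - st01 Γ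

lemma ins_pos {Γ Γ' : YoungDiagram} {u v : ℕ} (h : Ins Γ u v Γ') :
    posY Γ' + wR Γ' (u, v) = posY Γ + wA Γ (u, v) + 1 := by
  have h1 := st01_le Γ
  have h2 := st01_le Γ'
  have h3 := h.card
  have h4 := ins_st h
  unfold posY
  omega

lemma filter_card_lt (a b : ℕ) : ∑ i ∈ Finset.range b, (if a < i then 1 else 0) = b - a - 1 := by
  induction b with
  | zero => simp
  | succ b ih =>
    rw [Finset.sum_range_succ, ih]
    split_ifs <;> omega

lemma hook_eq (Γ : YoungDiagram) (i j : ℕ) (h : (i, j) ∈ Γ) :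
    hookDiff Γ.cells (i, j) = ((Γ.colLen j + j : ℕ) : ℤ) - ((Γ.rowLen i + i : ℕ) : ℤ) := by
  have h1 : (Γ.cells.filter fun d => d.2 = j ∧ i < d.1).card = Γ.colLen j - i - 1 := by
    rw [Finset.card_filter, ← filter_card_lt i (Γ.colLen j), ← sum_col Γ j]
    apply Finset.sum_congr rfl
    intro c _
    split_ifs <;> tauto
  have h2 : (Γ.cells.filter fun d => d.1 = i ∧ j < d.2).card = Γ.rowLen i - j - 1 := by
    rw [Finset.card_filter, ← filter_card_lt j (Γ.rowLen i), ← sum_row Γ i]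
    apply Finset.sum_congr rfl
    intro c _
    split_ifs <;> tauto
  unfold hookDiff
  simp only
  rw [h1, h2]
  have h3 := h
  rw [YoungDiagram.mem_iff_lt_rowLen] at h
  rw [YoungDiagram.mem_iff_lt_colLen] at h3
  omega

lemma first_term (Γ : YoungDiagram) :
    (Γ.cells.filter fun c => hookDiff Γ.cells c ≠ 0 ∧ hookDiff Γ.cells c ≠ 1).card = posY Γ := by
  have h := Finset.card_filter_add_card_filter_not (s := Γ.cells)
    (fun c => hookDiff Γ.cells c ≠ 0 ∧ hookDiff Γ.cells c ≠ 1)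
  have h2 : (Γ.cells.filter fun c => ¬ (hookDiff Γ.cells c ≠ 0 ∧ hookDiff Γ.cells c ≠ 1)).card = st01 Γ := by
    rw [st01_sum, Finset.card_filter]
    apply Finset.sum_congr rfl
    rintro ⟨i, j⟩ hc
    rw [hook_eq Γ i j hc]
    simp only
    split_ifs <;> omega
  have h3 : Γ.card = Γ.cells.card := rfl
  unfold posY
  omega

lemma second_term {Γ : YoungDiagram} {u v : ℕ} (h : isAdd Γ u v) :
    (Γ.cells.filter fun c => (hookDiff Γ.cells c = 0 ∧ c.1 = u) ∨ (hookDiff Γ.cells c = 1 ∧ c.2 = v)).card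
      = wA Γ (u, v) := by
  rw [wA_eq, aa_cells h, cc_cells h, ← Finset.sum_add_distrib, Finset.card_filter]
  apply Finset.sum_congr rfl
  rintro ⟨i, j⟩ hc
  have h1 := hc
  rw [YoungDiagram.mem_cells, YoungDiagram.mem_iff_lt_rowLen] at h1
  rw [hook_eq Γ i j hc]
  simp only
  obtain ⟨h2, h3⟩ := h
  by_cases e1 : i = u
  · subst e1
    have e2 : ¬ j = v := by omega
    simp only [e2, and_true, and_false, or_false, if_true, if_false]
    split_ifs <;> omega
  · by_cases e2 : j = v
    · subst e2
      simp only [e1, and_true, and_false, false_or, if_true, if_false]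
      split_ifs <;> omega
    · simp [e1, e2]

lemma posOne_eq {Γ₁ Γ₂ : YoungDiagram} {b₁ b₂ : ℕ × ℕ} (h₁ : isAdd Γ₁ b₁.1 b₁.2)
    (h₂ : isAdd Γ₂ b₂.1 b₂.2) :
    posOne Γ₁.cells Γ₂.cells b₁ b₂ = posY Γ₁ + wA Γ₁ b₁ + wA Γ₂ b₂ + dl b₁ b₂ := by
  unfold posOne
  rw [first_term, second_term h₁, second_term h₂]
  rfl

/-- adding a box -/
noncomputable def ad (Γ : YoungDiagram) (b : ℕ × ℕ) : YoungDiagram :=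
  if h : isAdd Γ b.1 b.2 then (exists_ins h).choose else Γ
/-- deleting a box -/
noncomputable def rm (Γ : YoungDiagram) (b : ℕ × ℕ) : YoungDiagram :=
  if h : isRem Γ b.1 b.2 then (exists_del h).choose else Γ

lemma ad_spec {Γ : YoungDiagram} {b : ℕ × ℕ} (h : b ∈ addS Γ) : Ins Γ b.1 b.2 (ad Γ b) := by
  have h' : isAdd Γ b.1 b.2 := mem_addS.1 h
  unfold ad
  rw [dif_pos h']
  exact (exists_ins h').choose_spec

lemma rm_spec {Γ : YoungDiagram} {b : ℕ × ℕ} (h : b ∈ remS Γ) : Ins (rm Γ b) b.1 b.2 Γ := by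
  have h' : isRem Γ b.1 b.2 := mem_remS.1 h
  unfold rm
  rw [dif_pos h']
  exact (exists_del h').choose_spec

lemma Ins.memA {Γ Γ' : YoungDiagram} {b : ℕ × ℕ} (h : Ins Γ b.1 b.2 Γ') : b ∈ addS Γ :=
  mem_addS.2 h.isAdd
lemma Ins.memR {Γ Γ' : YoungDiagram} {b : ℕ × ℕ} (h : Ins Γ b.1 b.2 Γ') : b ∈ remS Γ' :=
  mem_remS.2 h.isRem
lemma Ins.ad_eq {Γ Γ' : YoungDiagram} {b : ℕ × ℕ} (h : Ins Γ b.1 b.2 Γ') : ad Γ b = Γ' :=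
  (ad_spec h.memA).unique h
lemma Ins.rm_eq {Γ Γ' : YoungDiagram} {b : ℕ × ℕ} (h : Ins Γ b.1 b.2 Γ') : rm Γ' b = Γ :=
  (rm_spec h.memR).unique' h

lemma sum_ins (n : ℕ) (F : YoungDiagram → YoungDiagram → ℕ × ℕ → ℤ[X]) :
    ∑ Γ ∈ YD n, ∑ b ∈ addS Γ, F Γ (ad Γ b) b = ∑ Γ ∈ YD (n + 1), ∑ b ∈ remS Γ, F (rm Γ b) Γ b := by
  rw [Finset.sum_sigma', Finset.sum_sigma']
  refine Finset.sum_bij' (fun x _ => (⟨ad x.1 x.2, x.2⟩ : (_ : YoungDiagram) × (ℕ × ℕ)))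
    (fun x _ => (⟨rm x.1 x.2, x.2⟩ : (_ : YoungDiagram) × (ℕ × ℕ))) ?_ ?_ ?_ ?_ ?_
  · rintro ⟨Γ, b⟩ h
    simp only [Finset.mem_sigma, mem_YD] at h ⊢
    have h1 := ad_spec h.2
    exact ⟨by rw [h1.card, h.1], h1.memR⟩
  · rintro ⟨Γ, b⟩ h
    simp only [Finset.mem_sigma, mem_YD] at h ⊢
    have h1 := rm_spec h.2
    exact ⟨by have := h1.card; omega, h1.memA⟩
  · rintro ⟨Γ, b⟩ h
    simp only [Finset.mem_sigma, mem_YD] at h ⊢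
    rw [(ad_spec h.2).rm_eq]
  · rintro ⟨Γ, b⟩ h
    simp only [Finset.mem_sigma, mem_YD] at h ⊢
    rw [(rm_spec h.2).ad_eq]
  · rintro ⟨Γ, b⟩ h
    simp only [Finset.mem_sigma, mem_YD] at h ⊢
    rw [(ad_spec h.2).rm_eq]

lemma addS_ne {Γ : YoungDiagram} {b c : ℕ × ℕ} (hb : b ∈ addS Γ) (hc : c ∈ addS Γ) (hne : b ≠ c) :
    b.1 ≠ c.1 ∧ b.2 ≠ c.2 := by
  obtain ⟨u, v⟩ := b
  obtain ⟨u', v'⟩ := c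
  obtain ⟨h1, h2⟩ := mem_addS.1 hb
  obtain ⟨h3, h4⟩ := mem_addS.1 hc
  simp only
  constructor
  · rintro rfl; exact hne (by rw [← h2, ← h4])
  · rintro rfl; exact hne (by rw [← h1, ← h3])

lemma remS_ne {Γ : YoungDiagram} {b c : ℕ × ℕ} (hb : b ∈ remS Γ) (hc : c ∈ remS Γ) (hne : b ≠ c) :
    b.1 ≠ c.1 ∧ b.2 ≠ c.2 := by
  obtain ⟨u, v⟩ := b
  obtain ⟨u', v'⟩ := c
  obtain ⟨h1, h2⟩ := mem_remS.1 hb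
  obtain ⟨h3, h4⟩ := mem_remS.1 hc
  simp only
  constructor
  · rintro rfl; exact hne (by rw [show v = v' by omega])
  · rintro rfl; exact hne (by rw [show u = u' by omega])

lemma Ins.add_ne {Γ Γ' : YoungDiagram} {b c : ℕ × ℕ} (h : Ins Γ b.1 b.2 Γ')
    (h1 : b.1 ≠ c.1) (h2 : b.2 ≠ c.2) : c ∈ addS Γ' ↔ c ∈ addS Γ := by
  obtain ⟨u', v'⟩ := c
  rw [mem_addS, mem_addS]
  unfold LW.isAdd
  rw [h.rowLen, h.colLen, if_neg (fun e => h2 e.symm), if_neg (fun e => h1 e.symm)]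
  rfl

lemma Ins.rem_ne {Γ Γ' : YoungDiagram} {b c : ℕ × ℕ} (h : Ins Γ b.1 b.2 Γ')
    (h1 : b.1 ≠ c.1) (h2 : b.2 ≠ c.2) : c ∈ remS Γ' ↔ c ∈ remS Γ := by
  obtain ⟨u', v'⟩ := c
  rw [mem_remS, mem_remS]
  unfold LW.isRem
  rw [h.rowLen, h.colLen, if_neg (fun e => h2 e.symm), if_neg (fun e => h1 e.symm)]
  rfl

/-- diamond -/
lemma diamond {Γ Γb Γ' : YoungDiagram} {b c : ℕ × ℕ} (hb : Ins Γ b.1 b.2 Γb) (hc' : Ins Γb c.1 c.2 Γ')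
    (h1 : b.1 ≠ c.1) (h2 : b.2 ≠ c.2) :
    ∃ Γc, Ins Γ c.1 c.2 Γc ∧ Ins Γc b.1 b.2 Γ' := by
  have hc : c ∈ addS Γ := (hb.add_ne h1 h2).1 hc'.memA
  obtain ⟨Γc, hΓc⟩ : ∃ Γc, Ins Γ c.1 c.2 Γc := ⟨_, ad_spec hc⟩
  have hb2 : b ∈ addS Γc := (hΓc.add_ne h1.symm h2.symm).2 hb.memA
  have h3 := ad_spec hb2
  refine ⟨Γc, hΓc, ?_⟩
  have : ad Γc b = Γ' := by
    ext x
    rw [h3.cells, hΓc.cells, hc'.cells, hb.cells, Finset.insert_comm]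
  rw [← this]; exact h3

lemma diamond_pos {Γ Γb Γ' : YoungDiagram} {b c : ℕ × ℕ} (hb : Ins Γ b.1 b.2 Γb) (hc' : Ins Γb c.1 c.2 Γ')
    (h1 : b.1 ≠ c.1) (h2 : b.2 ≠ c.2) :
    posY Γ' + wR Γ' b + wR Γ' c = posY Γ + wA Γ b + wA Γ c + 2 := by
  obtain ⟨Γc, hc, hb'⟩ := diamond hb hc' h1 h2
  have e1 := swap_four hb hc hb' hc'
  have e2 := ins_pos hb'
  have e3 := ins_pos hc
  simp only [Prod.mk.eta] at e1 e2 e3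
  omega

lemma sum_ins2 (n : ℕ) :
    ∑ Γ ∈ YD (n + 2), ∑ p ∈ (remS Γ).offDiag, (X : ℤ[X]) ^ (posY Γ + wR Γ p.1 + wR Γ p.2)
      = X ^ 2 * ∑ Γ ∈ YD n, ∑ p ∈ (addS Γ).offDiag, (X : ℤ[X]) ^ (posY Γ + wA Γ p.1 + wA Γ p.2) := by
  rw [Finset.sum_sigma', Finset.sum_sigma', Finset.mul_sum]
  symm
  refine Finset.sum_bij'
    (fun x _ => (⟨ad (ad x.1 x.2.1) x.2.2, x.2⟩ : (_ : YoungDiagram) × ((ℕ × ℕ) × (ℕ × ℕ))))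
    (fun x _ => (⟨rm (rm x.1 x.2.2) x.2.1, x.2⟩ : (_ : YoungDiagram) × ((ℕ × ℕ) × (ℕ × ℕ)))) ?_ ?_ ?_ ?_ ?_
  · rintro ⟨Γ, b, c⟩ h
    simp only [Finset.mem_sigma, mem_YD, Finset.mem_offDiag] at h ⊢
    obtain ⟨hn, hb, hc, hne⟩ := h
    obtain ⟨n1, n2⟩ := addS_ne hb hc hne
    have i1 := ad_spec hb
    have i2 := ad_spec ((i1.add_ne n1 n2).2 hc)
    obtain ⟨_, i3, i4⟩ := diamond i1 i2 n1 n2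
    exact ⟨by rw [i2.card, i1.card, hn], i4.memR, i2.memR, hne⟩
  · rintro ⟨Γ, b, c⟩ h
    simp only [Finset.mem_sigma, mem_YD, Finset.mem_offDiag] at h ⊢
    obtain ⟨hn, hb, hc, hne⟩ := h
    obtain ⟨n1, n2⟩ := remS_ne hb hc hne
    have i1 := rm_spec hc
    have i2 := rm_spec ((i1.rem_ne n1.symm n2.symm).1 hb)
    obtain ⟨_, i3, i4⟩ := diamond i2 i1 n1 n2
    exact ⟨by have := i1.card; have := i2.card; omega, i2.memA, i3.memA, hne⟩
  · rintro ⟨Γ, b, c⟩ h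
    simp only [Finset.mem_sigma, mem_YD, Finset.mem_offDiag] at h ⊢
    obtain ⟨hn, hb, hc, hne⟩ := h
    obtain ⟨n1, n2⟩ := addS_ne hb hc hne
    have i1 := ad_spec hb
    have i2 := ad_spec ((i1.add_ne n1 n2).2 hc)
    rw [i2.rm_eq, i1.rm_eq]
  · rintro ⟨Γ, b, c⟩ h
    simp only [Finset.mem_sigma, mem_YD, Finset.mem_offDiag] at h ⊢
    obtain ⟨hn, hb, hc, hne⟩ := h
    obtain ⟨n1, n2⟩ := remS_ne hb hc hne
    have i1 := rm_spec hc
    have i2 := rm_spec ((i1.rem_ne n1.symm n2.symm).1 hb)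
    rw [i2.ad_eq, i1.ad_eq]
  · rintro ⟨Γ, b, c⟩ h
    simp only [Finset.mem_sigma, mem_YD, Finset.mem_offDiag] at h ⊢
    obtain ⟨hn, hb, hc, hne⟩ := h
    obtain ⟨n1, n2⟩ := addS_ne hb hc hne
    have i1 := ad_spec hb
    have i2 := ad_spec ((i1.add_ne n1 n2).2 hc)
    rw [diamond_pos i1 i2 n1 n2, pow_add]
    ring

end LW

namespace LW

/-- Poincaré polynomial of the punctual Hilbert scheme -/
noncomputable def PP (n : ℕ) : ℤ[X] := ∑ Γ ∈ YD n, X ^ posY Γ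
/-- sum over one added box -/
noncomputable def AA (n : ℕ) : ℤ[X] := ∑ Γ ∈ YD n, ∑ b ∈ addS Γ, X ^ (posY Γ + wA Γ b)
/-- sum over one removable box -/
noncomputable def RR (n : ℕ) : ℤ[X] := ∑ Γ ∈ YD n, ∑ b ∈ remS Γ, X ^ (posY Γ + wR Γ b)
/-- sum over pairs of removable boxes -/
noncomputable def EE (n : ℕ) : ℤ[X] :=
  ∑ Γ ∈ YD n, ∑ p ∈ (remS Γ).offDiag, X ^ (posY Γ + wR Γ p.1 + wR Γ p.2)
/-- the full sum -/
noncomputable def TT (n : ℕ) : ℤ[X] :=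
  ∑ Γ ∈ YD (n + 1), ∑ b ∈ remS Γ, ∑ c ∈ addS Γ,
    X ^ (posY (rm Γ b) + wA (rm Γ b) b + wA Γ c + dl b c)

lemma sum_offDiag' {α : Type*} [DecidableEq α] (s : Finset α) (g : α → α → ℤ[X]) :
    ∑ p ∈ s.offDiag, g p.1 p.2 = ∑ b ∈ s, ∑ c ∈ s.erase b, g b c := by
  rw [Finset.sum_sigma']
  refine Finset.sum_bij' (fun p _ => (⟨p.1, p.2⟩ : (_ : α) × α)) (fun x _ => (x.1, x.2)) ?_ ?_ ?_ ?_ ?_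
  · rintro ⟨b, c⟩ h
    simp only [Finset.mem_sigma, Finset.mem_offDiag, Finset.mem_erase] at h ⊢
    tauto
  · rintro ⟨b, c⟩ h
    simp only [Finset.mem_sigma, Finset.mem_offDiag, Finset.mem_erase] at h ⊢
    tauto
  · intro _ _; rfl
  · intro _ _; rfl
  · intro _ _; rfl

lemma sq_sum {α : Type*} [DecidableEq α] (s : Finset α) (f : α → ℤ[X]) :
    (∑ b ∈ s, f b) ^ 2 = ∑ p ∈ s.offDiag, f p.1 * f p.2 + ∑ b ∈ s, f b ^ 2 := by
  rw [sum_offDiag' s (fun b c => f b * f c), ← Finset.sum_add_distrib, sq, Finset.sum_mul]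
  apply Finset.sum_congr rfl
  intro b hb
  rw [← Finset.mul_sum, ← Finset.add_sum_erase s f hb]
  ring

lemma AA_eq (n : ℕ) : AA n = PP n + RR n := by
  unfold AA PP RR
  rw [← Finset.sum_add_distrib]
  apply Finset.sum_congr rfl
  intro Γ _
  have h := add_rem Γ (fun i => X ^ i)
  simp only [pow_add, ← Finset.mul_sum]
  rw [h]; ring

lemma RR_succ (n : ℕ) : RR (n + 1) = X * AA n := by
  have h := sum_ins n (fun Γ Γ' b => (X : ℤ[X]) ^ (posY Γ' + wR Γ' b))
  unfold RR AA
  rw [← h, Finset.mul_sum]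
  apply Finset.sum_congr rfl
  intro Γ _
  rw [Finset.mul_sum]
  apply Finset.sum_congr rfl
  intro b hb
  have e := ins_pos (ad_spec hb)
  simp only [Prod.mk.eta] at e
  rw [e, pow_succ]; ring

lemma EE_succ (n : ℕ) : EE (n + 2) = X ^ 2 * (2 * RR n + EE n) := by
  unfold EE
  rw [sum_ins2]
  congr 1
  unfold RR
  rw [Finset.mul_sum, ← Finset.sum_add_distrib]
  apply Finset.sum_congr rfl
  intro Γ _
  have h1 := add_rem Γ (fun i => X ^ i)
  have h2 := add_rem Γ (fun i => (X ^ i) ^ 2)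
  have h3 := sq_sum (addS Γ) (fun b => X ^ wA Γ b)
  have h4 := sq_sum (remS Γ) (fun b => X ^ wR Γ b)
  simp only [pow_add, mul_assoc, ← Finset.mul_sum]
  rw [h1, h2] at h3
  linear_combination (-(X : ℤ[X]) ^ posY Γ) * h3 + (X : ℤ[X]) ^ posY Γ * h4

lemma remS_zero {Γ : YoungDiagram} (h : Γ.card = 0) : remS Γ = ∅ := by
  have : Γ.cells = ∅ := Finset.card_eq_zero.1 h
  simp [remS, this]

lemma RR_zero : RR 0 = 0 := by
  unfold RR
  apply Finset.sum_eq_zero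
  intro Γ h
  rw [remS_zero (mem_YD.1 h)]; simp
lemma EE_zero : EE 0 = 0 := by
  unfold EE
  apply Finset.sum_eq_zero
  intro Γ h
  rw [remS_zero (mem_YD.1 h)]; simp
lemma EE_one : EE 1 = 0 := by
  unfold EE
  apply Finset.sum_eq_zero
  intro Γ h
  have h1 : Γ.cells.card = 1 := mem_YD.1 h
  have h2 : (remS Γ).offDiag = ∅ := by
    rw [Finset.eq_empty_iff_forall_notMem]
    rintro ⟨b, c⟩ hp
    rw [Finset.mem_offDiag] at hp
    obtain ⟨x, hx⟩ := Finset.card_eq_one.1 h1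
    simp only [remS, hx, Finset.mem_filter, Finset.mem_singleton] at hp
    exact hp.2.2 (hp.1.1.trans hp.2.1.1.symm)
  rw [h2]; simp

lemma dr_swap {b c : ℕ × ℕ} (h : b ≠ c) : (X : ℤ[X]) ^ dr b c + X ^ dr c b = 1 + X := by
  have h' : ¬ (b.1 = c.1 ∧ b.2 = c.2) := fun h' => h (Prod.ext h'.1 h'.2)
  unfold dr
  split_ifs with h1 h2 h2
  · omega
  · simp; ring
  · simp
  · omega

lemma TT_eq (n : ℕ) : 2 * (X * TT n) = (1 + X) * (2 * RR (n + 1) + EE (n + 1)) := by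
  unfold TT RR EE
  rw [Finset.mul_sum, Finset.mul_sum, Finset.mul_sum, ← Finset.sum_add_distrib, Finset.mul_sum]
  apply Finset.sum_congr rfl
  intro Γ _
  have e1 : X * ∑ b ∈ remS Γ, ∑ c ∈ addS Γ, (X : ℤ[X]) ^ (posY (rm Γ b) + wA (rm Γ b) b + wA Γ c + dl b c)
      = (1 + X) * ∑ b ∈ remS Γ, X ^ (posY Γ + wR Γ b)
        + ∑ p ∈ (remS Γ).offDiag, X ^ (posY Γ + wR Γ p.1 + wR Γ p.2) * X ^ dr p.1 p.2 := by
    rw [sum_offDiag' (remS Γ) (fun b c => X ^ (posY Γ + wR Γ b + wR Γ c) * X ^ dr b c), Finset.mul_sum,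
      Finset.mul_sum, ← Finset.sum_add_distrib]
    apply Finset.sum_congr rfl
    intro b hb
    have h1 := add_rem_dl Γ b hb
    have e := ins_pos (rm_spec hb)
    simp only [Prod.mk.eta] at e
    have e2 : ∑ c ∈ addS Γ, (X : ℤ[X]) ^ (posY (rm Γ b) + wA (rm Γ b) b + wA Γ c + dl b c)
        = X ^ (posY (rm Γ b) + wA (rm Γ b) b) * ∑ c ∈ addS Γ, (X : ℤ[X]) ^ (wA Γ c + dl b c) := by
      rw [Finset.mul_sum]
      apply Finset.sum_congr rfl
      intro c _
      rw [← pow_add, add_assoc]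
    have e3 : ∑ c ∈ (remS Γ).erase b, (X : ℤ[X]) ^ (posY Γ + wR Γ b + wR Γ c) * X ^ dr b c
        = X ^ (posY Γ + wR Γ b) * ∑ c ∈ (remS Γ).erase b, (X : ℤ[X]) ^ (wR Γ c + dr b c) := by
      rw [Finset.mul_sum]
      apply Finset.sum_congr rfl
      intro c _
      rw [← pow_add, ← pow_add]
      congr 1; ring
    rw [e2, e3, h1, e, pow_succ]
    ring
  have e2 : ∑ p ∈ (remS Γ).offDiag, (X : ℤ[X]) ^ (posY Γ + wR Γ p.1 + wR Γ p.2) * X ^ dr p.1 p.2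
      = ∑ p ∈ (remS Γ).offDiag, X ^ (posY Γ + wR Γ p.1 + wR Γ p.2) * X ^ dr p.2 p.1 := by
    refine Finset.sum_bij' (fun p _ => (p.2, p.1)) (fun p _ => (p.2, p.1)) ?_ ?_ ?_ ?_ ?_
    · rintro ⟨b, c⟩ h
      simp only [Finset.mem_offDiag] at h ⊢
      exact ⟨h.2.1, h.1, h.2.2.symm⟩
    · rintro ⟨b, c⟩ h
      simp only [Finset.mem_offDiag] at h ⊢
      exact ⟨h.2.1, h.1, h.2.2.symm⟩
    · intro _ _; rfl
    · intro _ _; rfl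
    · rintro ⟨b, c⟩ _
      simp only
      rw [show posY Γ + wR Γ b + wR Γ c = posY Γ + wR Γ c + wR Γ b by ring]
  have e3 : ∑ p ∈ (remS Γ).offDiag, (X : ℤ[X]) ^ (posY Γ + wR Γ p.1 + wR Γ p.2) * X ^ dr p.1 p.2
      + ∑ p ∈ (remS Γ).offDiag, X ^ (posY Γ + wR Γ p.1 + wR Γ p.2) * X ^ dr p.2 p.1
      = (1 + X) * ∑ p ∈ (remS Γ).offDiag, X ^ (posY Γ + wR Γ p.1 + wR Γ p.2) := by
    rw [← Finset.sum_add_distrib, Finset.mul_sum]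
    apply Finset.sum_congr rfl
    rintro ⟨b, c⟩ h
    simp only [Finset.mem_offDiag] at h
    rw [← mul_add, dr_swap h.2.2]; ring
  rw [← e2] at e3
  linear_combination 2 * e1 + e3

/-- partial sums of the answer -/
noncomputable def FF : ℕ → ℤ[X]
  | 0 => AA 0
  | 1 => AA 1
  | (n + 2) => AA (n + 2) + X ^ 2 * FF n

lemma FF_eq : ∀ n, 2 * (X * FF n) = 2 * RR (n + 1) + EE (n + 1)
  | 0 => by rw [FF, RR_succ, EE_one]; ring
  | 1 => by rw [FF, RR_succ, EE_succ, RR_zero, EE_zero]; ring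
  | (n + 2) => by
    have ih := FF_eq n
    rw [FF, RR_succ, EE_succ (n + 1)]
    linear_combination X ^ 2 * ih

lemma TT_FF (n : ℕ) : TT n = (1 + X) * FF n := by
  have h1 := TT_eq n
  rw [← FF_eq] at h1
  have h2 : (2 * X : ℤ[X]) ≠ 0 := by
    apply mul_ne_zero _ X_ne_zero
    exact two_ne_zero
  apply mul_left_cancel₀ h2
  linear_combination h1

lemma PP_eq (n : ℕ) : PP n = ∑ ν : Nat.Partition n, X ^ (n - ν.parts.card) := by
  rw [← sum_st01 n (fun j => X ^ (n - j))]
  unfold PP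
  apply Finset.sum_congr rfl
  intro Γ h
  unfold posY
  rw [mem_YD.1 h]

lemma part_card_le {n : ℕ} (ν : Nat.Partition n) : ν.parts.card ≤ n := by
  have h : ν.parts.card • 1 ≤ ν.parts.sum := Multiset.card_nsmul_le_sum (fun x hx => ν.parts_pos hx)
  rw [ν.parts_sum] at h
  simpa using h

lemma AA_sum (n : ℕ) : AA n = ∑ a ∈ Finset.range (n + 1), X ^ a * PP (n - a) := by
  induction n with
  | zero => rw [AA_eq, RR_zero]; simp
  | succ n ih =>
    rw [AA_eq, RR_succ, ih, Finset.sum_range_succ' _ (n + 1), Finset.mul_sum, add_comm]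
    congr 1
    · apply Finset.sum_congr rfl
      intro a _
      rw [show n + 1 - (a + 1) = n - a by omega]; ring
    · simp

lemma FF_sum : ∀ n, FF n = ∑ b ∈ (Finset.range (n + 1)).filter (fun b => 2 * b ≤ n), X ^ (2 * b) * AA (n - 2 * b)
  | 0 => by
    rw [FF, Finset.sum_filter]; simp
  | 1 => by
    rw [FF, Finset.sum_filter]; simp [Finset.sum_range_succ]
  | (n + 2) => by
    rw [FF, FF_sum n, Finset.sum_filter, Finset.sum_filter, Finset.sum_range_succ' _ (n + 2),
      Finset.sum_range_succ _ (n + 1), if_neg (by omega), Finset.mul_sum, add_comm]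
    congr 1
    · rw [add_zero]
      apply Finset.sum_congr rfl
      intro b _
      by_cases h : 2 * b ≤ n
      · rw [if_pos h, if_pos (by omega), show n + 2 - 2 * (b + 1) = n - 2 * b by omega]; ring
      · rw [if_neg h, if_neg (by omega)]; ring
    · simp

lemma fPoly_FF (n : ℕ) : fPoly n = FF n := by
  unfold fPoly
  rw [FF_sum, Finset.sum_filter, Finset.sum_product_right, Finset.sum_filter]
  apply Finset.sum_congr rfl
  intro b _
  by_cases hb : 2 * b ≤ n
  · rw [if_pos hb, AA_sum, Finset.mul_sum]
    have e : Finset.range (n - 2 * b + 1) = (Finset.range (n + 1)).filter (fun a => a + 2 * b ≤ n) := by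
      ext a; simp only [Finset.mem_filter, Finset.mem_range]; omega
    rw [e, Finset.sum_filter]
    apply Finset.sum_congr rfl
    intro a _
    simp only
    split_ifs with h
    · rw [PP_eq, Finset.mul_sum, Finset.mul_sum, show n - 2 * b - a = n - a - 2 * b by omega]
      apply Finset.sum_congr rfl
      intro ν _
      have := part_card_le ν
      rw [← pow_add, ← pow_add]
      congr 1; omega
    · rfl
  · rw [if_neg hb]
    apply Finset.sum_eq_zero
    intro a _
    rw [if_neg]
    simp only; omega

lemma insOne {n : ℕ} (T : TripleFlag n) : Ins T.Γ₁ T.b₁.1 T.b₁.2 T.Γ₂ := ⟨T.not_mem₁, T.cells₂⟩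
lemma insTwo {n : ℕ} (T : TripleFlag n) : Ins T.Γ₂ T.b₂.1 T.b₂.2 T.Γ₃ := ⟨T.not_mem₂, T.cells₃⟩

/-- index set of the sum -/
noncomputable def idx (n : ℕ) : Finset ((_ : YoungDiagram) × ((_ : ℕ × ℕ) × (ℕ × ℕ))) :=
  (YD (n + 1)).sigma (fun Γ => (remS Γ).sigma (fun _ => addS Γ))

/-- the index of a triple -/
def toIdx {n : ℕ} (T : TripleFlag n) : {x // x ∈ idx n} :=
  ⟨⟨T.Γ₂, ⟨T.b₁, T.b₂⟩⟩, by
    simp only [idx, Finset.mem_sigma, mem_YD]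
    exact ⟨by rw [(insOne T).card, T.card₁], (insOne T).memR, (insTwo T).memA⟩⟩

lemma toIdx_bij (n : ℕ) : Function.Bijective (toIdx (n := n)) := by
  constructor
  · intro T T' h
    have h0 := congrArg Subtype.val h
    have i1 := insOne T
    have i2 := insTwo T
    have j1 := insOne T'
    have j2 := insTwo T'
    obtain ⟨Γ₁, Γ₂, Γ₃, b₁, b₂, _, _, _, _, _⟩ := T
    obtain ⟨Γ₁', Γ₂', Γ₃', b₁', b₂', _, _, _, _, _⟩ := T'
    simp only [toIdx, Sigma.mk.injEq, heq_eq_eq] at h0 i1 i2 j1 j2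
    obtain ⟨rfl, rfl, rfl⟩ := h0
    obtain rfl := i1.unique' j1
    obtain rfl := i2.unique j2
    rfl
  · rintro ⟨⟨Γ, b, c⟩, h⟩
    have h' := h
    simp only [idx, Finset.mem_sigma, mem_YD] at h'
    obtain ⟨hn, hb, hc⟩ := h'
    have i1 := rm_spec hb
    have i2 := ad_spec hc
    exact ⟨⟨rm Γ b, Γ, ad Γ c, b, c, by have := i1.card; omega, i1.notMem, i1.cells, i2.notMem, i2.cells⟩, rfl⟩

/-- the summand in terms of the index -/
noncomputable def smd (x : (_ : YoungDiagram) × ((_ : ℕ × ℕ) × (ℕ × ℕ))) : ℤ[X] :=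
  X ^ (posY (rm x.1 x.2.1) + wA (rm x.1 x.2.1) x.2.1 + wA x.1 x.2.2 + dl x.2.1 x.2.2)

lemma main (n : ℕ) : (∑ᶠ T : TripleFlag n,
        (X : Polynomial ℤ) ^ posOne T.Γ₁.cells T.Γ₂.cells T.b₁ T.b₂) = TT n := by
  have h : ∀ T : TripleFlag n, (X : Polynomial ℤ) ^ posOne T.Γ₁.cells T.Γ₂.cells T.b₁ T.b₂
      = smd (toIdx T).1 := by
    intro T
    have e : rm T.Γ₂ T.b₁ = T.Γ₁ := (insOne T).rm_eq
    rw [posOne_eq (insOne T).isAdd (insTwo T).isAdd]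
    simp only [toIdx, smd]
    rw [e]
  have h2 := finsum_comp_equiv (f := fun x : {x // x ∈ idx n} => smd x.1) (Equiv.ofBijective _ (toIdx_bij n))
  simp only [Equiv.ofBijective_apply] at h2
  rw [finsum_congr h, h2, finsum_eq_sum_of_fintype, Finset.sum_coe_sort (idx n) smd]
  unfold idx TT
  rw [Finset.sum_sigma]
  apply Finset.sum_congr rfl
  intro Γ _
  rw [Finset.sum_sigma]
  rfl

end LW

/-- The Poincaré polynomial of `Hilb^{n,n+1,n+2}(0)` equals `(1+q)·f_n(q)`. -/
theorem statement0 (n : ℕ) :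
    (∑ᶠ T : TripleFlag n,
        (X : Polynomial ℤ) ^ posOne T.Γ₁.cells T.Γ₂.cells T.b₁ T.b₂)
      = (1 + X) * fPoly n := by
  rw [LW.main, LW.TT_FF, LW.fPoly_FF]
end

section
/- Let n ≥ 0 and let T = (t_i)_{i≥0} be a sequence of nonnegative integers with ∑_i t_i = n. There exists an ideal I ⊆ R̂ = ℂ[[x,y]] with dim_ℂ(R̂/I) = n and t_i(I) = t_i for all i if and only if T is admissible, i.e. there exists d ≥ 0 such that t_i = i+1 for all i < d, t_d ≤ d, and t_{i+1} ≤ t_i for all i ≥ d. -/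
/-!
Statement 12: a sequence (t_i) of nonnegative integers with Σ t_i = n is the
Hilbert–Samuel type of an ideal of ℂ[[x,y]] of colength n iff it is admissible, i.e.
of the form (1, 2, …, d, t_d, t_{d+1}, …) with d ≥ t_d ≥ t_{d+1} ≥ ….
-/

set_option synthInstance.maxHeartbeats 1000000
set_option maxHeartbeats 1000000

noncomputable section

/-- `R̂ = ℂ[[x,y]]`. -/
abbrev Rhat : Type := MvPowerSeries (Fin 2) ℂ

/-- The maximal ideal `m = (x,y)` of `ℂ[[x,y]]`. -/
def mxy : Ideal Rhat := Ideal.span {MvPowerSeries.X 0, MvPowerSeries.X 1}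

/-- The `i`-th entry `t_i(I) = dim_ℂ (m^i / (I ∩ m^i + m^{i+1}))` of the Hilbert–Samuel
type of an ideal `I`. -/
def hsType (I : Ideal Rhat) (i : ℕ) : ℕ :=
  Module.finrank ℂ
    (↥(mxy ^ i) ⧸ Submodule.comap (mxy ^ i).subtype ((I ⊓ mxy ^ i) ⊔ mxy ^ (i + 1)))

/-- A sequence `(t_i)` is admissible if there is `d` with `t_i = i+1` for `i < d`,
`t_d ≤ d`, and `t` weakly decreasing from `d` on. -/
def Admissible (t : ℕ → ℕ) : Prop :=
  ∃ d : ℕ, (∀ i, i < d → t i = i + 1) ∧ t d ≤ d ∧ ∀ i, d ≤ i → t (i + 1) ≤ t i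


def ee (j k : ℕ) : Fin 2 →₀ ℕ := Finsupp.single 0 j + Finsupp.single 1 k

@[simp] lemma ee_zero (j k : ℕ) : ee j k 0 = j := by simp [ee]
@[simp] lemma ee_one (j k : ℕ) : ee j k 1 = k := by simp [ee]

lemma eq_ee (s : Fin 2 →₀ ℕ) : s = ee (s 0) (s 1) := by
  ext i; fin_cases i <;> simp

def co (j k : ℕ) : Rhat →ₗ[ℂ] ℂ := MvPowerSeries.coeff (ee j k)

def mkS (c : ℕ → ℕ → ℂ) : Rhat := fun s => c (s 0) (s 1)

@[simp] lemma co_mkS (c : ℕ → ℕ → ℂ) (j k : ℕ) : co j k (mkS c) = c j k := by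
  show mkS c (ee j k) = _
  simp [mkS]

lemma ext_co {f g : Rhat} (h : ∀ j k, co j k f = co j k g) : f = g := by
  ext s
  rw [eq_ee s]
  exact h _ _

lemma co_mul (f g : Rhat) (j k : ℕ) (h : ∀ j' k', j' ≤ j → k' ≤ k → co j' k' g = 0) :
    co j k (f * g) = 0 := by
  unfold co
  rw [MvPowerSeries.coeff_mul]
  apply Finset.sum_eq_zero
  rintro ⟨a, b⟩ hab
  rw [Finset.HasAntidiagonal.mem_antidiagonal] at hab
  have h0 := DFunLike.congr_fun hab 0
  have h1 := DFunLike.congr_fun hab 1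
  simp at h0 h1
  have := h (b 0) (b 1) (by omega) (by omega)
  unfold co at this
  rw [← eq_ee] at this
  simp [this]

@[simp] lemma co_X0_succ (j k : ℕ) (f : Rhat) : co (j+1) k (MvPowerSeries.X 0 * f) = co j k f := by
  unfold co
  have : ee (j+1) k = Finsupp.single 0 1 + ee j k := by
    ext i; fin_cases i <;> simp [ee, add_comm]
  rw [this, MvPowerSeries.X, MvPowerSeries.coeff_add_monomial_mul, one_mul]

@[simp] lemma co_X1_succ (j k : ℕ) (f : Rhat) : co j (k+1) (MvPowerSeries.X 1 * f) = co j k f := by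
  unfold co
  have : ee j (k+1) = Finsupp.single 1 1 + ee j k := by
    ext i; fin_cases i <;> simp [ee, add_comm]
  rw [this, MvPowerSeries.X, MvPowerSeries.coeff_add_monomial_mul, one_mul]

@[simp] lemma co_X0_zero (k : ℕ) (f : Rhat) : co 0 k (MvPowerSeries.X 0 * f) = 0 := by
  classical
  unfold co
  rw [MvPowerSeries.X, MvPowerSeries.coeff_monomial_mul, if_neg]
  intro h
  have := h 0
  simp at this

@[simp] lemma co_X1_zero (j : ℕ) (f : Rhat) : co j 0 (MvPowerSeries.X 1 * f) = 0 := by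
  classical
  unfold co
  rw [MvPowerSeries.X, MvPowerSeries.coeff_monomial_mul, if_neg]
  intro h
  have := h 1
  simp at this

lemma X0_mem : (MvPowerSeries.X 0 : Rhat) ∈ mxy := Ideal.subset_span (by simp)
lemma X1_mem : (MvPowerSeries.X 1 : Rhat) ∈ mxy := Ideal.subset_span (by simp)

lemma mem_pow_iff (i : ℕ) : ∀ f : Rhat, f ∈ mxy ^ i ↔ ∀ j k, j + k < i → co j k f = 0 := by
  induction i with
  | zero => intro f; simp
  | succ i ih =>
    intro f
    constructor
    · intro hf
      rw [pow_succ'] at hf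
      refine Submodule.mul_induction_on hf ?_ ?_
      · intro m hm n hn j k hjk
        unfold mxy at hm
        rw [Ideal.mem_span_pair] at hm
        obtain ⟨a, b, rfl⟩ := hm
        have e : (a * MvPowerSeries.X 0 + b * MvPowerSeries.X 1) * n
          = a * (MvPowerSeries.X 0 * n) + b * (MvPowerSeries.X 1 * n) := by ring
        rw [e, map_add, co_mul, co_mul, add_zero]
        · intro j' k' h1 h2
          cases k' with
          | zero => simp
          | succ k' => rw [co_X1_succ]; exact (ih n).1 hn _ _ (by omega)
        · intro j' k' h1 h2
          cases j' with
          | zero => simp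
          | succ j' => rw [co_X0_succ]; exact (ih n).1 hn _ _ (by omega)
      · intro x y hx hy j k h
        rw [map_add, hx j k h, hy j k h, add_zero]
    · intro h
      have e : f = MvPowerSeries.X 0 * mkS (fun j k => co (j+1) k f)
          + MvPowerSeries.X 1 * mkS (fun j k => if j = 0 then co 0 (k+1) f else 0) := by
        apply ext_co
        intro j k
        rw [map_add]
        rcases j with _ | j <;> rcases k with _ | k <;> simp
        exact h 0 0 (by omega)
      rw [e, pow_succ']
      apply Ideal.add_mem
      · apply Ideal.mul_mem_mul X0_mem
        rw [ih]
        intro j k hjk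
        rw [co_mkS]; exact h _ _ (by omega)
      · apply Ideal.mul_mem_mul X1_mem
        rw [ih]
        intro j k hjk
        rw [co_mkS]
        split_ifs with hj
        · exact h _ _ (by omega)
        · rfl

def quotEquiv {M W : Type*} [AddCommGroup M] [Module ℂ M] [Module Rhat M]
    [IsScalarTower ℂ Rhat M] [AddCommGroup W] [Module ℂ W] (N : Submodule Rhat M)
    (g : M →ₗ[ℂ] W) (hg : Function.Surjective g) (h : ∀ x, x ∈ N ↔ g x = 0) :
    (M ⧸ N) ≃ₗ[ℂ] W :=
  (Submodule.Quotient.restrictScalarsEquiv ℂ N).symm.trans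
    ((Submodule.quotEquivOfEq _ _ (by ext x; simp [h])).trans (g.quotKerEquivOfSurjective hg))

open Polynomial in
def phi (i : ℕ) : Rhat →ₗ[ℂ] ℂ[X] :=
  ∑ j ∈ Finset.range (i+1), (Polynomial.monomial j).comp (co j (i - j))

lemma coeff_phi (i j : ℕ) (f : Rhat) :
    (phi i f).coeff j = if j ≤ i then co j (i - j) f else 0 := by
  simp [phi, Polynomial.coeff_monomial, LinearMap.sum_apply]

lemma phi_X0 (i : ℕ) (f : Rhat) : phi (i+1) (MvPowerSeries.X 0 * f) = Polynomial.X * phi i f := by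
  ext j
  rw [coeff_phi]
  cases j with
  | zero => simp
  | succ j => rw [Polynomial.coeff_X_mul, coeff_phi]; simp

lemma phi_X1 (i : ℕ) (f : Rhat) : phi (i+1) (MvPowerSeries.X 1 * f) = phi i f := by
  ext j
  rw [coeff_phi, coeff_phi]
  rcases lt_trichotomy j (i+1) with h | h | h
  · rw [if_pos (by omega), if_pos (by omega), show i + 1 - j = (i - j) + 1 by omega, co_X1_succ]
  · subst h; simp
  · rw [if_neg (by omega), if_neg (by omega)]

lemma phi_mem (i : ℕ) (f : Rhat) : phi i f ∈ Polynomial.degreeLT ℂ (i+1) := by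
  rw [Polynomial.mem_degreeLT, Polynomial.degree_lt_iff_coeff_zero]
  intro m hm
  rw [coeff_phi, if_neg (by omega)]

open Polynomial in
def VV (I : Ideal Rhat) (i : ℕ) : Submodule ℂ ℂ[X] :=
  ((I ⊓ mxy ^ i).restrictScalars ℂ).map (phi i)

lemma VV_le (I : Ideal Rhat) (i : ℕ) : VV I i ≤ Polynomial.degreeLT ℂ (i+1) := by
  rintro _ ⟨f, -, rfl⟩
  exact phi_mem i f

lemma VV_step1 (I : Ideal Rhat) (i : ℕ) : VV I i ≤ VV I (i+1) := by
  rintro _ ⟨f, hf, rfl⟩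
  exact ⟨MvPowerSeries.X 1 * f, ⟨I.mul_mem_left _ hf.1, by
    rw [pow_succ']; exact Ideal.mul_mem_mul X1_mem hf.2⟩, phi_X1 i f⟩

lemma VV_step0 (I : Ideal Rhat) (i : ℕ) {p : Polynomial ℂ} (hp : p ∈ VV I i) :
    Polynomial.X * p ∈ VV I (i+1) := by
  obtain ⟨f, hf, rfl⟩ := hp
  exact ⟨MvPowerSeries.X 0 * f, ⟨I.mul_mem_left _ hf.1, by
    rw [pow_succ']; exact Ideal.mul_mem_mul X0_mem hf.2⟩, phi_X0 i f⟩

instance degreeLT_fin (n : ℕ) : Module.Finite ℂ (Polynomial.degreeLT ℂ n) :=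
  Module.Finite.equiv (Polynomial.degreeLTEquiv ℂ n).symm

lemma degreeLT_finrank (n : ℕ) : Module.finrank ℂ (Polynomial.degreeLT ℂ n) = n := by
  rw [(Polynomial.degreeLTEquiv ℂ n).finrank_eq]; simp

instance VV_fin (I : Ideal Rhat) (i : ℕ) : Module.Finite ℂ (VV I i) :=
  Submodule.finiteDimensional_of_le (VV_le I i)

lemma VV_lt (I : Ideal Rhat) (i : ℕ) (h : VV I i ≠ ⊥) : VV I i < VV I (i+1) := by
  refine lt_of_le_of_ne (VV_step1 I i) fun heq => ?_
  obtain ⟨p, hp, hp0⟩ := Submodule.exists_mem_ne_zero_of_ne_bot h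
  have key : ∀ n : ℕ, Polynomial.X ^ n * p ∈ VV I i := by
    intro n
    induction n with
    | zero => simpa using hp
    | succ n ih =>
      have := VV_step0 I i ih
      rwa [← heq, ← mul_assoc, ← pow_succ'] at this
  have h2 := VV_le I i (key (i+1))
  rw [Polynomial.mem_degreeLT, Polynomial.degree_lt_iff_coeff_zero] at h2
  apply hp0
  ext j
  have := h2 (j + (i+1)) (by omega)
  rwa [Polynomial.coeff_X_pow_mul] at this

lemma phi_surj (i : ℕ) (p : Polynomial ℂ) (hp : p ∈ Polynomial.degreeLT ℂ (i+1)) :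
    ∃ f ∈ mxy ^ i, phi i f = p := by
  rw [Polynomial.mem_degreeLT, Polynomial.degree_lt_iff_coeff_zero] at hp
  refine ⟨mkS fun j k => if j + k = i then p.coeff j else 0, ?_, ?_⟩
  · rw [mem_pow_iff]
    intro j k h
    rw [co_mkS, if_neg (by omega)]
  · ext j
    rw [coeff_phi]
    split_ifs with h
    · rw [co_mkS, if_pos (by omega)]
    · rw [hp j (by omega)]

lemma phi_eq_zero (i : ℕ) (f : Rhat) (hf : f ∈ mxy ^ i) : phi i f = 0 ↔ f ∈ mxy ^ (i+1) := by
  rw [mem_pow_iff] at *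
  constructor
  · intro h j k hjk
    by_cases h' : j + k < i
    · exact hf _ _ h'
    · have := congrArg (fun q => Polynomial.coeff q j) h
      simp only [coeff_phi, Polynomial.coeff_zero] at this
      rw [if_pos (by omega), show i - j = k by omega] at this
      exact this
  · intro h
    ext j
    rw [coeff_phi]
    split_ifs with h'
    · exact h _ _ (by omega)
    · simp

lemma hsType_add (I : Ideal Rhat) (i : ℕ) : hsType I i + Module.finrank ℂ (VV I i) = i + 1 := by
  let D := Polynomial.degreeLT ℂ (i+1)
  let V' : Submodule ℂ D := (VV I i).comap D.subtype
  let g0 : ↥(mxy ^ i) →ₗ[ℂ] D :=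
    ((phi i).comp ((mxy ^ i).subtype.restrictScalars ℂ)).codRestrict D (fun f => phi_mem i f)
  have e := quotEquiv (Submodule.comap (mxy ^ i).subtype ((I ⊓ mxy ^ i) ⊔ mxy ^ (i + 1)))
    (V'.mkQ.comp g0) (by
      apply (Submodule.mkQ_surjective V').comp
      rintro ⟨p, hp⟩
      obtain ⟨f, hf, hfp⟩ := phi_surj i p hp
      exact ⟨⟨f, hf⟩, Subtype.ext hfp⟩) (by
      rintro ⟨f, hf⟩
      have h1 : (V'.mkQ.comp g0) ⟨f, hf⟩ = 0 ↔ phi i f ∈ VV I i := by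
        rw [LinearMap.comp_apply, Submodule.mkQ_apply, Submodule.Quotient.mk_eq_zero]
        rfl
      rw [h1]
      change f ∈ (I ⊓ mxy ^ i) ⊔ mxy ^ (i + 1) ↔ _
      rw [Submodule.mem_sup]
      constructor
      · rintro ⟨a, ha, b, hb, rfl⟩
        have hb' := (phi_eq_zero i b (Ideal.pow_le_pow_right (Nat.le_succ i) hb)).2 hb
        rw [map_add, hb', add_zero]
        exact ⟨a, ha, rfl⟩
      · rintro ⟨a, ha, hab⟩
        refine ⟨a, ha, f - a, ?_, by ring⟩
        rw [← phi_eq_zero i _ (Ideal.sub_mem _ hf ha.2), map_sub, hab, sub_self])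
  have h1 : hsType I i = Module.finrank ℂ (D ⧸ V') := e.finrank_eq
  have h2 : Module.finrank ℂ V' = Module.finrank ℂ (VV I i) :=
    (Submodule.comapSubtypeEquivOfLe (VV_le I i)).finrank_eq
  rw [h1, ← h2, Submodule.finrank_quotient_add_finrank, degreeLT_finrank]

lemma forward (t : ℕ → ℕ) (hfin : (Function.support t).Finite) (I : Ideal Rhat)
    (h : ∀ i, hsType I i = t i) : Admissible t := by
  classical
  have hadd := hsType_add I
  simp only [h] at hadd
  have hex : ∃ i, VV I i ≠ ⊥ := by
    obtain ⟨i, hi⟩ := hfin.exists_notMem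
    refine ⟨i, fun hb => ?_⟩
    have := hadd i
    rw [hb, finrank_bot] at this
    simp at hi
    omega
  have hmono : ∀ i, Nat.find hex ≤ i → VV I i ≠ ⊥ := by
    intro i hi
    induction i, hi using Nat.le_induction with
    | base => exact Nat.find_spec hex
    | succ i hi ih => exact (lt_of_le_of_lt bot_le (VV_lt I i ih)).ne'
  refine ⟨Nat.find hex, ?_, ?_, ?_⟩
  · intro i hi
    have := Nat.find_min hex hi
    push Not at this
    have h2 := hadd i
    rw [this, finrank_bot] at h2
    omega
  · have h2 := hadd (Nat.find hex)
    have : Module.finrank ℂ (VV I (Nat.find hex)) ≠ 0 := by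
      rw [Ne, Submodule.finrank_eq_zero]
      exact Nat.find_spec hex
    omega
  · intro i hi
    have h1 := hadd i
    have h2 := hadd (i+1)
    have h3 := Submodule.finrank_lt_finrank_of_lt (VV_lt I i (hmono i hi))
    omega

/-- the monomial ideal attached to `t` -/
def monI (t : ℕ → ℕ) (hup : ∀ j k j' k', j' ≤ j → k' ≤ k → j < t (j + k) → j' < t (j' + k')) :
    Ideal Rhat where
  carrier := {f | ∀ j k, j < t (j + k) → co j k f = 0}
  zero_mem' := by intro j k _; simp
  add_mem' := by
    intro a b ha hb j k h
    rw [map_add, ha j k h, hb j k h, add_zero]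
  smul_mem' := by
    intro c f hf j k h
    rw [smul_eq_mul]
    apply co_mul
    intro j' k' h1 h2
    exact hf _ _ (hup _ _ _ _ h1 h2 h)

lemma adm_le {t : ℕ → ℕ} (ht : Admissible t) (i : ℕ) : t i ≤ i + 1 := by
  obtain ⟨d, h1, h2, h3⟩ := ht
  rcases lt_or_ge i d with h | h
  · rw [h1 i h]
  · induction i, h using Nat.le_induction with
    | base => omega
    | succ i hi ih => have := h3 i hi; omega

lemma adm_up {t : ℕ → ℕ} (ht : Admissible t) (j k j' k' : ℕ) (hj : j' ≤ j) (hk : k' ≤ k)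
    (h : j < t (j + k)) : j' < t (j' + k') := by
  obtain ⟨d, h1, h2, h3⟩ := ht
  rcases lt_or_ge (j' + k') d with h' | h'
  · rw [h1 _ h']; omega
  · have : t (j + k) ≤ t (j' + k') := by
      have : j' + k' ≤ j + k := by omega
      revert this
      generalize j + k = b
      intro hb
      induction b, hb using Nat.le_induction with
      | base => exact le_rfl
      | succ b hb ih => exact (h3 b (by omega)).trans ih
    omega

lemma backward (t : ℕ → ℕ) (hfin : (Function.support t).Finite) (ht : Admissible t) :
    ∃ I : Ideal Rhat, Module.rank ℂ (Rhat ⧸ I) = ((∑ᶠ i : ℕ, t i : ℕ) : Cardinal) ∧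
      ∀ i : ℕ, hsType I i = t i := by
  classical
  refine ⟨monI t (adm_up ht), ?_, ?_⟩
  · let S := Σ i : hfin.toFinset, Fin (t i)
    let g : Rhat →ₗ[ℂ] (S → ℂ) := LinearMap.pi fun s => co s.2 (s.1 - s.2)
    have e := quotEquiv (monI t (adm_up ht)) g (by
      intro c
      refine ⟨mkS fun j k => if h : j + k ∈ hfin.toFinset ∧ j < t (j + k) then
        c ⟨⟨j + k, h.1⟩, ⟨j, h.2⟩⟩ else 0, ?_⟩
      funext ⟨⟨i, hi⟩, ⟨j, hj⟩⟩
      have hj' : j < t i := hj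
      have h1 := adm_le ht i
      obtain ⟨k, rfl⟩ : ∃ k, i = j + k := ⟨i - j, by omega⟩
      simp only [g, LinearMap.pi_apply, co_mkS, Nat.add_sub_cancel_left]
      rw [dif_pos ⟨hi, hj'⟩]) (by
      intro f
      constructor
      · intro hf
        funext ⟨⟨i, hi⟩, ⟨j, hj⟩⟩
        have hj' : j < t i := hj
        have h1 := adm_le ht i
        exact hf j (i - j) (by rwa [show j + (i - j) = i by omega])
      · intro hf j k hjk
        have hi : j + k ∈ hfin.toFinset := by
          simp; omega
        have := congrFun hf ⟨⟨j + k, hi⟩, ⟨j, hjk⟩⟩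
        simpa [g] using this)
    rw [e.rank_eq, rank_fun']
    simp only [S, Fintype.card_sigma, Fintype.card_fin]
    rw [finsum_eq_sum t hfin, Finset.univ_eq_attach, Finset.sum_attach]
  · intro i
    have h1 := adm_le ht i
    let g : ↥(mxy ^ i) →ₗ[ℂ] (Fin (t i) → ℂ) :=
      (LinearMap.pi fun s : Fin (t i) => co s (i - s)).comp ((mxy ^ i).subtype.restrictScalars ℂ)
    have e := quotEquiv (Submodule.comap (mxy ^ i).subtype
      ((monI t (adm_up ht) ⊓ mxy ^ i) ⊔ mxy ^ (i + 1))) g (by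
        intro c
        refine ⟨⟨mkS fun j k => if h : j + k = i ∧ j < t i then c ⟨j, h.2⟩ else 0, ?_⟩, ?_⟩
        · rw [mem_pow_iff]
          intro j k h
          rw [co_mkS, dif_neg (by omega)]
        · funext ⟨j, hj⟩
          change co j (i - j) (mkS fun j k => if h : j + k = i ∧ j < t i then c ⟨j, h.2⟩ else 0) =
            c ⟨j, hj⟩
          rw [co_mkS, dif_pos ⟨by omega, hj⟩]) (by
        rintro ⟨f, hf⟩
        change f ∈ (monI t (adm_up ht) ⊓ mxy ^ i) ⊔ mxy ^ (i + 1) ↔ _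
        have hg : g ⟨f, hf⟩ = 0 ↔ ∀ j, j < t i → co j (i - j) f = 0 :=
          ⟨fun h j hj => congrFun h ⟨j, hj⟩, fun h => funext fun s => h s s.2⟩
        rw [hg, Submodule.mem_sup]
        constructor
        · rintro ⟨a, ha, b, hb, rfl⟩ j hj
          rw [map_add, ha.1 j (i - j) (by rwa [show j + (i - j) = i by omega]),
            (mem_pow_iff _ _).1 hb j (i - j) (by omega), add_zero]
        · intro h
          rw [mem_pow_iff] at hf
          refine ⟨mkS fun j k => if j + k = i then co j k f else 0, ⟨?_, ?_⟩,
            mkS fun j k => if j + k = i then 0 else co j k f, ?_, ?_⟩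
          · intro j k hjk
            rw [co_mkS]
            split_ifs with hi
            · subst hi
              have := h j hjk
              rwa [Nat.add_sub_cancel_left] at this
            · rfl
          · refine (mem_pow_iff _ _).2 ?_
            intro j k hjk
            rw [co_mkS, if_neg (by omega)]
          · rw [mem_pow_iff]
            intro j k hjk
            rw [co_mkS]
            split_ifs with hi
            · rfl
            · exact hf _ _ (by omega)
          · apply ext_co
            intro j k
            rw [map_add, co_mkS, co_mkS]
            split_ifs <;> simp)
    have h2 : hsType (monI t (adm_up ht)) i = _ := e.finrank_eq
    rw [h2]; simp

/-- A sequence of total sum `n` is the Hilbert–Samuel type of an ideal of colength `n`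
iff it is admissible. -/
theorem statement12 (n : ℕ) (t : ℕ → ℕ)
    (hfin : (Function.support t).Finite) (hsum : (∑ᶠ i : ℕ, t i) = n) :
    (∃ I : Ideal Rhat,
        Module.rank ℂ (Rhat ⧸ I) = (n : Cardinal) ∧ ∀ i : ℕ, hsType I i = t i)
      ↔ Admissible t := by
  constructor
  · rintro ⟨I, -, h⟩
    exact forward t hfin I h
  · intro ht
    subst hsum
    exact backward t hfin ht
end
end
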